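/- (Grötzsch's theorem) Every finite simple planar graph containing no triangle is 3-colorable, i.e., its chromatic number is at most 3. -/

import Mathlib

/-- `G` has an `H`-minor: there are pairwise disjoint branch sets in `G`,
each inducing a connected subgraph, with an edge of `G` between the branch sets
corresponding to each edge of `H`. -/
def SimpleGraph.HasMinor {V : Type*} {W : Type*} (G : SimpleGraph V) (H : SimpleGraph W) : Prop :=
  ∃ f : W → Set V,
    (∀ w, (G.induce (f w)).Connected) ∧
    (Pairwise fun w₁ w₂ => Disjoint (f w₁) (f w₂)) ∧
    (∀ ⦃w₁ w₂⦄, H.Adj w₁ w₂ → ∃ a ∈ f w₁, ∃ b ∈ f w₂, G.Adj a b)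

/-- A graph is outerplanar iff it has no `K₄` minor and no `K_{2,3}` minor. -/
def SimpleGraph.Outerplanar {V : Type*} (G : SimpleGraph V) : Prop :=
  ¬ G.HasMinor (completeGraph (Fin 4)) ∧
  ¬ G.HasMinor (completeBipartiteGraph (Fin 2) (Fin 3))

/-- Wagner's characterization: a graph is planar iff it has no `K₅` minor and
no `K_{3,3}` minor. -/
def SimpleGraph.IsPlanar {V : Type*} (G : SimpleGraph V) : Prop :=
  ¬ G.HasMinor (completeGraph (Fin 5)) ∧
  ¬ G.HasMinor (completeBipartiteGraph (Fin 3) (Fin 3))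

namespace TwoBasis

open Finset
open scoped Classical

set_option linter.unusedSectionVars false
set_option linter.unusedSimpArgs false
set_option linter.unusedDecidableInType false

universe u

/-- A one-dimensional chain modulo two, as a function on ordered pairs of vertices. -/
abbrev Chain (V : Type*) := V → V → ZMod 2

noncomputable section Basic

variable {V : Type*} [Fintype V]

/-- The chains of a graph: symmetric functions supported on the edges. -/
def chains (G : SimpleGraph V) : Submodule (ZMod 2) (Chain V) where
  carrier := {f | (∀ u v, f u v = f v u) ∧ ∀ u v, ¬ G.Adj u v → f u v = 0}
  zero_mem' := by simp
  add_mem' := by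
    rintro f g ⟨hf, hf'⟩ ⟨hg, hg'⟩
    refine ⟨fun u v => ?_, fun u v h => ?_⟩
    · simp only [Pi.add_apply]; rw [hf, hg]
    · simp [hf' u v h, hg' u v h]
  smul_mem' := by
    rintro c f ⟨hf, hf'⟩
    refine ⟨fun u v => ?_, fun u v h => ?_⟩
    · simp only [Pi.smul_apply]; rw [hf]
    · simp [hf' u v h]

/-- The boundary of a chain. -/
def bd : Chain V →ₗ[ZMod 2] (V → ZMod 2) where
  toFun f v := ∑ w, f v w
  map_add' f g := by ext v; simp [sum_add_distrib]
  map_smul' c f := by ext v; simp [mul_sum]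

theorem bd_apply (f : Chain V) (v : V) : bd f v = ∑ w, f v w := rfl

/-- The cycle space of a graph. -/
def cycles (G : SimpleGraph V) : Submodule (ZMod 2) (Chain V) :=
  chains G ⊓ LinearMap.ker bd

variable {G H A B : SimpleGraph V}

theorem mem_chains {f : Chain V} :
    f ∈ chains G ↔ (∀ u v, f u v = f v u) ∧ ∀ u v, ¬ G.Adj u v → f u v = 0 := Iff.rfl

theorem chains_symm {f : Chain V} (hf : f ∈ chains G) (u v : V) : f u v = f v u := hf.1 u v

theorem adj_of_chains {f : Chain V} (hf : f ∈ chains G) {u v : V} (h : f u v ≠ 0) : G.Adj u v := by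
  by_contra h'
  exact h (hf.2 u v h')

theorem chains_mono (h : G ≤ H) : chains G ≤ chains H :=
  fun _ hf => ⟨hf.1, fun u v huv => hf.2 u v fun h' => huv (h h')⟩

theorem cycles_mono (h : G ≤ H) : cycles G ≤ cycles H :=
  fun _ hf => ⟨chains_mono h hf.1, hf.2⟩

theorem sum_row_of_cycles {f : Chain V} (hf : f ∈ cycles G) (v : V) : ∑ w, f v w = 0 :=
  congrFun hf.2 v

theorem zmod_two_add_self (a : ZMod 2) : a + a = 0 := CharTwo.add_self_eq_zero a

theorem zmod_two_eq_one {a : ZMod 2} (h : a ≠ 0) : a = 1 := by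
  revert a; decide

theorem fun_add_self {α : Type*} (f : α → ZMod 2) : f + f = 0 :=
  funext fun _ => zmod_two_add_self _

theorem chain_add_self (f : Chain V) : f + f = 0 := funext fun _ => fun_add_self _

/-- The chain consisting of a single edge (zero if both ends agree). -/
def edge (u v : V) : Chain V := fun a b =>
  (if a = u ∧ b = v then 1 else 0) + (if a = v ∧ b = u then 1 else 0)

theorem edge_comm (u v : V) : edge u v = edge v u := by
  funext a b
  exact add_comm _ _

theorem edge_symm (u v a b : V) : edge u v a b = edge u v b a := by
  unfold edge
  rw [add_comm]
  simp only [and_comm]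

theorem edge_apply_left {u v : V} (h : u ≠ v) (b : V) :
    edge u v u b = if b = v then 1 else 0 := by
  simp [edge, h]

theorem edge_apply_self {u v : V} (h : u ≠ v) : edge u v u v = 1 := by
  simp [edge, h]

theorem edge_apply_of_ne {u v a : V} (h : a ≠ u) (h' : a ≠ v) (b : V) : edge u v a b = 0 := by
  simp [edge, h, h']

theorem edge_apply_of_ne_right {u v b : V} (h : b ≠ u) (h' : b ≠ v) (a : V) :
    edge u v a b = 0 := by
  rw [edge_symm, edge_apply_of_ne h h']

theorem edge_ne_zero {u v a b : V} (h : edge u v a b ≠ 0) :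
    a ≠ b ∧ ((a = u ∧ b = v) ∨ (a = v ∧ b = u)) := by
  constructor
  · rintro rfl
    apply h
    unfold edge
    simp only [and_comm (a := a = v)]
    exact zmod_two_add_self _
  · by_contra h'
    push Not at h'
    apply h
    unfold edge
    rw [if_neg (fun h => h'.1 h.1 h.2), if_neg (fun h => h'.2 h.1 h.2), add_zero]

theorem edge_mem_chains {u v : V} (h : G.Adj u v) : edge u v ∈ chains G := by
  refine ⟨edge_symm u v, fun a b hab => ?_⟩
  by_contra hne
  rcases (edge_ne_zero hne).2 with ⟨rfl, rfl⟩ | ⟨rfl, rfl⟩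
  · exact hab h
  · exact hab h.symm

/-- The indicator of a vertex. -/
def pt (u : V) : V → ZMod 2 := Pi.single u 1

theorem bd_edge (u v : V) : bd (edge u v) = pt u + pt v := by
  funext a
  rw [bd_apply]
  simp only [edge, sum_add_distrib, Pi.add_apply, pt, Pi.single_apply]
  congr 1
  · by_cases h : a = u <;> simp [h]
  · by_cases h : a = v <;> simp [h]

theorem pt_add_self (u : V) : pt u + pt u = 0 := fun_add_self _

theorem sum_sum_symm_eq_zero {f : Chain V} (hs : ∀ u v, f u v = f v u) (hd : ∀ u, f u u = 0)
    (K : Finset V) : ∑ u ∈ K, ∑ v ∈ K, f u v = 0 := by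
  rw [← sum_product']
  refine sum_involution (fun p _ => p.swap) ?_ ?_ ?_ ?_
  · rintro ⟨a, b⟩ -
    simp only [Prod.fst_swap, Prod.snd_swap]
    rw [hs b a]; exact zmod_two_add_self _
  · rintro ⟨a, b⟩ - h heq
    simp only [Prod.swap_prod_mk, Prod.mk.injEq] at heq
    obtain ⟨rfl, -⟩ := heq
    exact h (hd _)
  · rintro ⟨a, b⟩ h
    simp only [mem_product, Prod.fst_swap, Prod.snd_swap] at h ⊢
    exact h.symm
  · rintro ⟨a, b⟩ -
    rfl

theorem chains_diag {f : Chain V} (hf : f ∈ chains G) (u : V) : f u u = 0 :=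
  hf.2 u u (G.irrefl)

/-- A vertex set closed under the support of a chain has even boundary. -/
theorem sum_bd_eq_zero {f : Chain V} (hf : f ∈ chains G) (K : Finset V)
    (hK : ∀ u ∈ K, ∀ v, f u v ≠ 0 → v ∈ K) : ∑ u ∈ K, bd f u = 0 := by
  rw [← sum_sum_symm_eq_zero hf.1 (chains_diag hf) K]
  refine sum_congr rfl fun u hu => ?_
  rw [bd_apply]
  symm
  refine sum_subset (subset_univ _) fun v _ hv => ?_
  by_contra h
  exact hv (hK u hu v h)

theorem mem_of_reachable {V : Type*} {G : SimpleGraph V} {K : Set V} (hK : ∀ u ∈ K, ∀ v, G.Adj u v → v ∈ K)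
    {u v : V} (h : G.Reachable u v) (hu : u ∈ K) : v ∈ K := by
  obtain ⟨p⟩ := h
  induction p with
  | nil => exact hu
  | cons h p ih => exact ih (hK _ hu _ h)

theorem reachable_of_bd {f : Chain V} (hf : f ∈ chains G) {u v : V}
    (hbd : bd f = pt u + pt v) : G.Reachable u v := by
  by_contra hne
  have h := sum_bd_eq_zero hf (univ.filter fun w => G.Reachable u w) (by
    intro a ha b hab
    simp only [mem_filter, mem_univ, true_and] at ha ⊢
    exact ha.trans (adj_of_chains hf hab).reachable)
  rw [hbd] at h
  simp only [Pi.add_apply, pt, sum_add_distrib] at h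
  simp [hne] at h

theorem exists_chain_of_reachable {u v : V} (h : G.Reachable u v) :
    ∃ f ∈ chains G, bd f = pt u + pt v := by
  obtain ⟨p⟩ := h
  induction p with
  | nil => exact ⟨0, zero_mem _, by rw [map_zero, pt_add_self]⟩
  | @cons a b c h p ih =>
    obtain ⟨f, hf, hb⟩ := ih
    refine ⟨edge a b + f, add_mem (edge_mem_chains h) hf, ?_⟩
    rw [map_add, hb, bd_edge, add_assoc, ← add_assoc (pt b), pt_add_self, zero_add]

theorem exists_chain_of_sum_eq_zero {L : SimpleGraph V} {U : Set V}
    (hL : ∀ u ∈ U, ∀ v ∈ U, L.Reachable u v) (g : V → ZMod 2) (hg : ∀ v, g v ≠ 0 → v ∈ U)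
    (hsum : ∑ v, g v = 0) : ∃ f ∈ chains L, bd f = g := by
  by_cases hU : ∃ u, u ∈ U
  · obtain ⟨u, hu⟩ := hU
    have : ∀ v, ∃ f ∈ chains L, v ∈ U → bd f = pt u + pt v := by
      intro v
      by_cases hv : v ∈ U
      · obtain ⟨f, hf, hb⟩ := exists_chain_of_reachable (hL u hu v hv)
        exact ⟨f, hf, fun _ => hb⟩
      · exact ⟨0, zero_mem _, fun h => absurd h hv⟩
    choose f hf hb using this
    refine ⟨∑ v, g v • f v, sum_mem fun v _ => Submodule.smul_mem _ _ (hf v), ?_⟩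
    rw [map_sum]
    have h1 : ∀ v ∈ (univ : Finset V), bd (g v • f v) = g v • pt u + g v • pt v := by
      intro v _
      rw [map_smul]
      by_cases hv : g v = 0
      · simp [hv]
      · rw [hb v (hg v hv), smul_add]
    rw [sum_congr rfl h1, sum_add_distrib, ← sum_smul, hsum, zero_smul, zero_add]
    funext a
    simp [pt, Pi.single_apply]
  · refine ⟨0, zero_mem _, ?_⟩
    funext v
    rw [map_zero]
    by_contra h
    exact hU ⟨v, hg v (Ne.symm h)⟩

theorem bd_sum_univ {f : Chain V} (hf : f ∈ chains G) : ∑ v, bd f v = 0 :=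
  sum_bd_eq_zero hf univ fun _ _ _ _ => mem_univ _

/-- Restriction of a chain to the edges of a graph. -/
def restr (A : SimpleGraph V) (f : Chain V) : Chain V := fun u v => if A.Adj u v then f u v else 0

theorem restr_mem {f : Chain V} (hf : f ∈ chains G) : restr A f ∈ chains A := by
  refine ⟨fun u v => ?_, fun u v h => by simp [restr, h]⟩
  simp only [restr, A.adj_comm u v, hf.1 u v]

theorem sub_restr_mem {f : Chain V} (hf : f ∈ chains (A ⊔ B)) : f + restr A f ∈ chains B := by
  have h : f + restr A f = fun u v => if A.Adj u v then 0 else f u v := by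
    funext u v
    simp only [Pi.add_apply, restr]
    split_ifs
    · exact zmod_two_add_self _
    · simp
  rw [h]
  refine ⟨fun u v => ?_, fun u v huv => ?_⟩
  · simp only [A.adj_comm u v, hf.1 u v]
  · by_cases hA : A.Adj u v
    · simp [hA]
    · simp only [hA, if_false]
      exact hf.2 u v fun h => h.elim hA huv

theorem bd_eq_zero_of_not_adj {f : Chain V} (hf : f ∈ chains A) {v : V}
    (h : ∀ w, ¬ A.Adj v w) : bd f v = 0 := by
  rw [bd_apply]
  exact sum_eq_zero fun w _ => hf.2 v w (h w)

/-- If two graphs meet in a connected piece, the cycle space of their union splits. -/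
theorem cycles_sup_split {L : SimpleGraph V} (hLA : L ≤ A) (hLB : L ≤ B) {U : Set V}
    (hU : ∀ v, (∃ w, A.Adj v w) → (∃ w, B.Adj v w) → v ∈ U)
    (hL : ∀ u ∈ U, ∀ v ∈ U, L.Reachable u v) {Q : Chain V} (hQ : Q ∈ cycles (A ⊔ B)) :
    ∃ Q₁ ∈ cycles A, ∃ Q₂ ∈ cycles B, Q = Q₁ + Q₂ := by
  have h1 : restr A Q ∈ chains A := restr_mem hQ.1
  have h2 : Q + restr A Q ∈ chains B := sub_restr_mem hQ.1
  have hQ0 : bd Q = 0 := hQ.2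
  have hbd : bd (Q + restr A Q) = bd (restr A Q) := by
    rw [map_add, hQ0, zero_add]
  obtain ⟨r, hr, hrb⟩ := exists_chain_of_sum_eq_zero hL (bd (restr A Q)) (by
    intro v hv
    apply hU
    · by_contra h
      push Not at h
      exact hv (bd_eq_zero_of_not_adj h1 h)
    · by_contra h
      push Not at h
      rw [← hbd] at hv
      exact hv (bd_eq_zero_of_not_adj h2 h)) (bd_sum_univ h1)
  refine ⟨restr A Q + r, ⟨add_mem h1 (chains_mono hLA hr), ?_⟩, Q + restr A Q + r,
    ⟨add_mem h2 (chains_mono hLB hr), ?_⟩, ?_⟩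
  · change bd _ = 0
    rw [map_add, hrb]; exact fun_add_self _
  · change bd _ = 0
    rw [map_add, hbd, hrb]; exact fun_add_self _
  · have e1 := chain_add_self (restr A Q)
    have e2 := chain_add_self r
    have : restr A Q + r + (Q + restr A Q + r) = Q + (restr A Q + restr A Q) + (r + r) := by abel
    rw [this, e1, e2, add_zero, add_zero]

end Basic

noncomputable section Families

variable {V : Type*} [Fintype V]
variable {G H A B : SimpleGraph V} {ι : Type} [Fintype ι] {F : ι → Chain V}

/-- Linear combinations of a family of chains. -/
def comb (F : ι → Chain V) (t : ι → ZMod 2) : Chain V := fun u v => ∑ i, t i * F i u v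

theorem comb_add (t r : ι → ZMod 2) : comb F (t + r) = comb F t + comb F r := by
  funext u v
  simp [comb, add_mul, sum_add_distrib]

theorem comb_eq_sum (t : ι → ZMod 2) : comb F t = ∑ i, t i • F i := by
  funext u v
  simp [comb, Finset.sum_apply]

theorem comb_one : comb F 1 = ∑ i, F i := by
  simp [comb_eq_sum]

/-- A family of cycles generating the cycle space, covering each edge zero or two times. -/
structure IsPlaneFamily (G : SimpleGraph V) (F : ι → Chain V) : Prop where
  mem : ∀ i, F i ∈ cycles G
  sum_eq_zero : ∑ i, F i = 0
  card_le : ∀ u v, #{i | F i u v ≠ 0} ≤ 2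
  span : ∀ Q ∈ cycles G, ∃ t, comb F t = Q

/-- `G` satisfies MacLane's planarity criterion. -/
def MacLane (G : SimpleGraph V) : Prop :=
  ∃ (ι : Type) (_ : Fintype ι) (F : ι → Chain V), IsPlaneFamily G F

/-- `f` is a member of some family witnessing MacLane's criterion. -/
def MacLaneFace (G : SimpleGraph V) (f : Chain V) : Prop :=
  ∃ (ι : Type) (_ : Fintype ι) (F : ι → Chain V), IsPlaneFamily G F ∧ ∃ i, F i = f

theorem MacLaneFace.macLane {f : Chain V} (h : MacLaneFace G f) : MacLane G := by
  obtain ⟨ι, _, F, hF, -⟩ := h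
  exact ⟨ι, _, F, hF⟩

theorem MacLaneFace.mem {f : Chain V} (h : MacLaneFace G f) : f ∈ cycles G := by
  obtain ⟨ι, _, F, hF, i, rfl⟩ := h
  exact hF.mem i

theorem comb_mem (hF : ∀ i, F i ∈ cycles G) (t : ι → ZMod 2) : comb F t ∈ cycles G := by
  rw [comb_eq_sum]
  exact sum_mem fun i _ => Submodule.smul_mem _ _ (hF i)

theorem sum_eq_card_filter (x : ι → ZMod 2) : ∑ i, x i = (#{i | x i ≠ 0} : ZMod 2) := by
  rw [card_eq_sum_ones, Nat.cast_sum, sum_filter]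
  refine sum_congr rfl fun i _ => ?_
  by_cases h : x i = 0
  · simp [h]
  · simp [zmod_two_eq_one h]

/-- A spanning family covering each edge at most twice can be completed by its sum. -/
theorem exists_completion (hmem : ∀ i, F i ∈ cycles G) (hcard : ∀ u v, #{i | F i u v ≠ 0} ≤ 2)
    (hspan : ∀ Q ∈ cycles G, ∃ t, comb F t = Q) :
    IsPlaneFamily G (fun o : Option ι => o.elim (∑ i, F i) F) where
  mem o := by
    cases o with
    | none => exact sum_mem fun i _ => hmem i
    | some i => exact hmem i
  sum_eq_zero := by
    rw [Fintype.sum_option]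
    exact chain_add_self _
  card_le u v := by
    have h1 : #{o : Option ι | o.elim (∑ i, F i) F u v ≠ 0} =
        (if (∑ i, F i u v) ≠ 0 then 1 else 0) + #{i | F i u v ≠ 0} := by
      rw [card_filter, Fintype.sum_option, card_filter]
      simp only [Option.elim_none, Option.elim_some, Finset.sum_apply]
      congr!
    rw [h1]
    have h2 := hcard u v
    by_cases h3 : #{i | F i u v ≠ 0} = 2
    · have : ∑ i, F i u v = 0 := by
        rw [sum_eq_card_filter, h3]; rfl
      simp [this, h3]
    · split_ifs <;> omega
  span Q hQ := by
    obtain ⟨t, ht⟩ := hspan Q hQ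
    refine ⟨fun o => o.elim 0 t, ?_⟩
    rw [← ht]
    funext u v
    simp [comb, Fintype.sum_option]

theorem IsPlaneFamily.sum_apply (hF : IsPlaneFamily G F) (u v : V) : ∑ i, F i u v = 0 := by
  have := congrFun (congrFun hF.sum_eq_zero u) v
  simpa [Finset.sum_apply] using this

theorem IsPlaneFamily.comb_compl (hF : IsPlaneFamily G F) (t : ι → ZMod 2) :
    comb F (t + 1) = comb F t := by
  rw [comb_add, comb_one, hF.sum_eq_zero, add_zero]

theorem IsPlaneFamily.span_avoid (hF : IsPlaneFamily G F) (i : ι) {Q : Chain V}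
    (hQ : Q ∈ cycles G) : ∃ t, t i = 0 ∧ comb F t = Q := by
  obtain ⟨t, ht⟩ := hF.span Q hQ
  by_cases h : t i = 0
  · exact ⟨t, h, ht⟩
  · refine ⟨t + 1, ?_, by rw [hF.comb_compl, ht]⟩
    rw [Pi.add_apply, zmod_two_eq_one h]; rfl

theorem IsPlaneFamily.eq_or_eq (hF : IsPlaneFamily G F) {u v : V} {i j k : ι} (hij : i ≠ j)
    (hi : F i u v ≠ 0) (hj : F j u v ≠ 0) (hk : F k u v ≠ 0) : k = i ∨ k = j := by
  by_contra h
  push Not at h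
  have h3 : #({i, j, k} : Finset ι) = 3 := card_eq_three.2 ⟨i, j, k, hij, h.1.symm, h.2.symm, rfl⟩
  have : #({i, j, k} : Finset ι) ≤ #{i | F i u v ≠ 0} := card_le_card (by
    intro x hx
    simp only [mem_insert, mem_singleton] at hx
    simp only [mem_filter, mem_univ, true_and]
    rcases hx with rfl | rfl | rfl <;> assumption)
  have := hF.card_le u v
  omega

theorem IsPlaneFamily.exists_ne (hF : IsPlaneFamily G F) {u v : V} {i : ι} (hi : F i u v ≠ 0) :
    ∃ j, j ≠ i ∧ F j u v ≠ 0 := by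
  by_contra h
  push Not at h
  have := hF.sum_apply u v
  rw [sum_eq_single i (fun j _ hj => h j hj) (by simp)] at this
  exact hi this

/-- The two values of a coefficient function at the faces on an edge. -/
theorem IsPlaneFamily.comb_apply (hF : IsPlaneFamily G F) {u v : V} {i j : ι} (hij : i ≠ j)
    (hi : F i u v ≠ 0) (hj : F j u v ≠ 0) (t : ι → ZMod 2) : comb F t u v = t i + t j := by
  unfold comb
  rw [← sum_subset (subset_univ {i, j}), sum_pair hij, zmod_two_eq_one hi, zmod_two_eq_one hj,
    mul_one, mul_one]
  intro k _ hk
  simp only [mem_insert, mem_singleton] at hk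
  by_contra h
  exact hk (hF.eq_or_eq hij hi hj (right_ne_zero_of_mul h))

/-- If a combination avoids an edge, its coefficients agree on both faces at that edge. -/
theorem IsPlaneFamily.eq_of_comb_eq_zero (hF : IsPlaneFamily G F) {u v : V} {t : ι → ZMod 2}
    (h : comb F t u v = 0) {i j : ι} (hi : F i u v ≠ 0) (hj : F j u v ≠ 0) : t i = t j := by
  by_cases hij : i = j
  · rw [hij]
  · rw [hF.comb_apply hij hi hj] at h
    exact CharTwo.add_eq_zero.1 h

theorem IsPlaneFamily.comb_mul_of_eq (hF : IsPlaneFamily G F) {u v : V} {t : ι → ZMod 2}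
    (h : comb F t u v = 0) {i : ι} (hi : F i u v ≠ 0) (r : ι → ZMod 2) :
    comb F (t * r) u v = t i * comb F r u v := by
  unfold comb
  rw [mul_sum]
  refine sum_congr rfl fun j _ => ?_
  by_cases hj : F j u v = 0
  · simp [hj]
  · rw [Pi.mul_apply, hF.eq_of_comb_eq_zero h hi hj, mul_assoc]

theorem comb_apply_of_forall {u v : V} (h : ∀ i, F i u v = 0) (t : ι → ZMod 2) :
    comb F t u v = 0 := by
  simp [comb, h]

theorem exists_face_of_comb_ne_zero {u v : V} {t : ι → ZMod 2} (h : comb F t u v ≠ 0) :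
    ∃ i, t i ≠ 0 ∧ F i u v ≠ 0 := by
  obtain ⟨i, -, hi⟩ := exists_ne_zero_of_sum_ne_zero h
  exact ⟨i, left_ne_zero_of_mul hi, right_ne_zero_of_mul hi⟩

theorem IsPlaneFamily.comb_mul_eq_zero (hF : IsPlaneFamily G F) {u v : V} {t r : ι → ZMod 2}
    (h : comb F t u v = 0) (h' : comb F r u v = 0) : comb F (t * r) u v = 0 := by
  by_cases hi : ∃ i, F i u v ≠ 0
  · obtain ⟨i, hi⟩ := hi
    rw [hF.comb_mul_of_eq h hi, h', mul_zero]
  · push Not at hi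
    exact comb_apply_of_forall hi _

/-- Two edges at a vertex off the boundary of a region which are traversed by a common cycle lie
on the same side. -/
theorem IsPlaneFamily.transfer (hF : IsPlaneFamily G F) {p : V} {t : ι → ZMod 2}
    (hp : ∀ w, comb F t p w = 0) {Q : Chain V} (hQ : Q ∈ cycles G) {u v : V}
    (hQp : ∀ w, Q p w ≠ 0 → w = u ∨ w = v) {i j : ι}
    (hu : Q p u ≠ 0) (hi : F i p u ≠ 0) (hj : F j p v ≠ 0) (hv : Q p v ≠ 0) : t i = t j := by
  by_cases huv : u = v
  · subst huv
    exact hF.eq_of_comb_eq_zero (hp u) hi hj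
  obtain ⟨r, rfl⟩ := hF.span Q hQ
  have h := sum_row_of_cycles (comb_mem hF.mem (t * r)) p
  rw [← sum_subset (subset_univ {u, v}), sum_pair huv, hF.comb_mul_of_eq (hp u) hi,
    hF.comb_mul_of_eq (hp v) hj, zmod_two_eq_one hu, zmod_two_eq_one hv, mul_one, mul_one] at h
  · exact CharTwo.add_eq_zero.1 h
  · intro w _ hw
    simp only [mem_insert, mem_singleton] at hw
    refine hF.comb_mul_eq_zero (hp w) ?_
    by_contra h'
    exact hw (hQp w h')

theorem IsPlaneFamily.exists_face (hF : IsPlaneFamily G F) {Q : Chain V} (hQ : Q ∈ cycles G)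
    {u v : V} (h : Q u v ≠ 0) : ∃ i, F i u v ≠ 0 := by
  obtain ⟨r, rfl⟩ := hF.span Q hQ
  obtain ⟨i, -, hi⟩ := exists_face_of_comb_ne_zero h
  exact ⟨i, hi⟩

theorem macLane_of_span (hmem : ∀ i, F i ∈ cycles G) (hcard : ∀ u v, #{i | F i u v ≠ 0} ≤ 2)
    (hspan : ∀ Q ∈ cycles G, ∃ t, comb F t = Q) : MacLane G :=
  ⟨Option ι, inferInstance, _, exists_completion hmem hcard hspan⟩

theorem MacLane.face_zero (h : MacLane G) : MacLaneFace G 0 := by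
  obtain ⟨ι, _, F, hF⟩ := h
  refine ⟨Option ι, inferInstance, _, exists_completion hF.mem hF.card_le hF.span, none, ?_⟩
  exact hF.sum_eq_zero

theorem macLane_of_span_singleton {Q₀ : Chain V} (h₀ : Q₀ ∈ cycles G)
    (h : ∀ Q ∈ cycles G, Q = 0 ∨ Q = Q₀) : MacLane G := by
  refine macLane_of_span (ι := Unit) (F := fun _ => Q₀) (fun _ => h₀) (fun u v => ?_) ?_
  · exact (card_le_univ _).trans (by simp)
  · intro Q hQ
    rcases h Q hQ with rfl | rfl
    · exact ⟨0, by funext u v; simp [comb]⟩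
    · exact ⟨1, by funext u v; simp [comb]⟩

theorem cycles_deleteEdges {Q : Chain V} {u v : V} (hQ : Q ∈ cycles G) (h : Q u v = 0) :
    Q ∈ cycles (G.deleteEdges {s(u, v)}) := by
  refine ⟨⟨hQ.1.1, fun a b hab => ?_⟩, hQ.2⟩
  rw [SimpleGraph.deleteEdges_adj] at hab
  by_cases hG : G.Adj a b
  · have : s(a, b) = s(u, v) := by
      by_contra hne
      exact hab ⟨hG, by simpa using hne⟩
    rcases Sym2.eq_iff.1 this with ⟨rfl, rfl⟩ | ⟨rfl, rfl⟩
    · exact h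
    · rw [hQ.1.1]; exact h
  · exact hQ.1.2 a b hG

theorem MacLaneFace.deleteEdge {f : Chain V} (hf : MacLaneFace G f) {u v : V} (h : f u v = 0) :
    MacLaneFace (G.deleteEdges {s(u, v)}) f := by
  obtain ⟨ι, _, F, hF, i₀, rfl⟩ := hf
  have hle : cycles (G.deleteEdges {s(u, v)}) ≤ cycles G := cycles_mono (G.deleteEdges_le _)
  by_cases hi : ∃ i, F i u v ≠ 0
  · obtain ⟨i, hi⟩ := hi
    obtain ⟨j, hji, hj⟩ := hF.exists_ne hi
    have hi0 : i₀ ≠ i := by rintro rfl; exact hi h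
    have hj0 : i₀ ≠ j := by rintro rfl; exact hj h
    refine ⟨ι, _, fun k => if k = i then F i + F j else if k = j then 0 else F k,
      ⟨?_, ?_, ?_, ?_⟩, i₀, by simp [hi0, hj0]⟩
    · intro k
      split_ifs with h1 h2
      · refine cycles_deleteEdges (add_mem (hF.mem i) (hF.mem j)) ?_
        rw [Pi.add_apply, Pi.add_apply, zmod_two_eq_one hi, zmod_two_eq_one hj]; rfl
      · exact zero_mem _
      · refine cycles_deleteEdges (hF.mem k) ?_
        by_contra hk
        rcases hF.eq_or_eq hji.symm hi hj hk with h' | h' <;> contradiction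
    · have : ∀ k, (if k = i then F i + F j else if k = j then 0 else F k) =
          F k + ((if k = i then F j else 0) + (if k = j then F j else 0)) := by
        intro k
        by_cases h1 : k = i
        · subst h1; simp [hji.symm]
        · by_cases h2 : k = j
          · subst h2; simp [h1, chain_add_self]
          · simp [h1, h2]
      simp only [this, sum_add_distrib, hF.sum_eq_zero, zero_add, sum_ite_eq', mem_univ, if_true]
      exact chain_add_self _
    · intro a b
      have hc := hF.card_le a b
      by_cases hjab : F j a b = 0
      · refine le_trans (card_le_card ?_) hc
        intro k
        simp only [mem_filter, mem_univ, true_and]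
        by_cases h1 : k = i
        · subst h1; simp [hjab]
        · by_cases h2 : k = j
          · subst h2; simp [h1]
          · simp [h1, h2]
      · have hsub : univ.filter (fun k => (if k = i then F i + F j else if k = j then 0 else F k)
            a b ≠ 0) ⊆ insert i ((univ.filter fun k => F k a b ≠ 0).erase j) := by
          intro k
          simp only [mem_filter, mem_univ, true_and, mem_insert, mem_erase]
          by_cases h1 : k = i
          · simp [h1]
          · by_cases h2 : k = j
            · subst h2; simp [h1]
            · simp [h1, h2]
        have h1 := card_le_card hsub
        have h2 := card_insert_le i ((univ.filter fun k => F k a b ≠ 0).erase j)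
        have h3 : #((univ.filter fun k => F k a b ≠ 0).erase j) + 1 =
            #(univ.filter fun k => F k a b ≠ 0) := card_erase_add_one (by simp [hjab])
        omega
    · intro Q hQ
      obtain ⟨t, rfl⟩ := hF.span Q (hle hQ)
      have h0 : comb F t u v = 0 := hQ.1.2 u v (by simp)
      have htij := hF.eq_of_comb_eq_zero h0 hi hj
      refine ⟨t, ?_⟩
      rw [comb_eq_sum, comb_eq_sum]
      have : ∀ k, t k • (if k = i then F i + F j else if k = j then 0 else F k) =
          t k • F k + ((if k = i then t j • F j else 0) + (if k = j then t j • F j else 0)) := by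
        intro k
        by_cases h1 : k = i
        · subst h1; simp [hji.symm, htij]
        · by_cases h2 : k = j
          · subst h2; simp [h1, chain_add_self]
          · simp [h1, h2]
      simp only [this, sum_add_distrib, sum_ite_eq', mem_univ, if_true]
      rw [chain_add_self, add_zero]
  · push Not at hi
    exact ⟨ι, _, F, ⟨fun i => cycles_deleteEdges (hF.mem i) (hi i), hF.sum_eq_zero, hF.card_le,
      fun Q hQ => hF.span Q (hle hQ)⟩, i₀, rfl⟩

theorem MacLaneFace.mono {f : Chain V} (hle : H ≤ G) (hf : MacLaneFace G f) (hfH : f ∈ cycles H) :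
    MacLaneFace H f := by
  induction hn : #(univ.filter fun p : V × V => G.Adj p.1 p.2 ∧ ¬ H.Adj p.1 p.2) using
    Nat.strong_induction_on generalizing G with
  | _ n ih =>
    by_cases h : ∃ u v, G.Adj u v ∧ ¬ H.Adj u v
    · obtain ⟨u, v, hG, hH⟩ := h
      refine ih _ ?_ ?_ (hf.deleteEdge (hfH.1.2 u v hH)) rfl
      · rw [← hn]
        refine card_lt_card ⟨?_, ?_⟩
        · intro p
          simp only [mem_filter, mem_univ, true_and, SimpleGraph.deleteEdges_adj]
          exact fun h => ⟨h.1.1, h.2⟩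
        · intro h
          have := h (show (u, v) ∈ _ by simp [hG, hH])
          simp at this
      · intro a b hab
        rw [SimpleGraph.deleteEdges_adj]
        refine ⟨hle hab, fun h => hH ?_⟩
        rcases Sym2.eq_iff.1 (Set.mem_singleton_iff.1 h) with ⟨rfl, rfl⟩ | ⟨rfl, rfl⟩
        · exact hab
        · exact hab.symm
    · push Not at h
      have : G = H := le_antisymm (fun u v huv => h u v huv) hle
      exact this ▸ hf

theorem MacLane.mono (hle : H ≤ G) (h : MacLane G) : MacLane H :=
  (h.face_zero.mono hle (zero_mem _)).macLane

/-- Gluing two graphs along a common piece lying on a face of both. -/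
theorem macLane_glue {f g : Chain V} (hf : MacLaneFace A f) (hg : MacLaneFace B g)
    (hA : A ≤ G) (hB : B ≤ G)
    (hAB : ∀ u v, A.Adj u v → B.Adj u v → f u v ≠ 0 ∧ g u v ≠ 0)
    (hspan : ∀ Q ∈ cycles G, ∃ Q₁ ∈ cycles A, ∃ Q₂ ∈ cycles B, Q = Q₁ + Q₂) : MacLane G := by
  obtain ⟨ι, _, F, hF, i₀, rfl⟩ := hf
  obtain ⟨κ, _, E, hE, j₀, rfl⟩ := hg
  refine macLane_of_span (ι := ι ⊕ κ) (F := Sum.elim (fun i => if i = i₀ then 0 else F i)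
    (fun j => if j = j₀ then 0 else E j)) ?_ ?_ ?_
  · rintro (i | j)
    · dsimp only [Sum.elim_inl]
      split_ifs
      · exact zero_mem _
      · exact cycles_mono hA (hF.mem i)
    · dsimp only [Sum.elim_inr]
      split_ifs
      · exact zero_mem _
      · exact cycles_mono hB (hE.mem j)
  · intro u v
    have hc : #{x : ι ⊕ κ | Sum.elim (fun i => if i = i₀ then 0 else F i)
        (fun j => if j = j₀ then 0 else E j) x u v ≠ 0} =
        #((univ.filter fun i => F i u v ≠ 0).erase i₀) +
        #((univ.filter fun j => E j u v ≠ 0).erase j₀) := by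
      have h1 : (univ.filter fun i => F i u v ≠ 0).erase i₀ =
          univ.filter fun i => F i u v ≠ 0 ∧ i ≠ i₀ := by
        ext i; simp [and_comm]
      have h2 : (univ.filter fun j => E j u v ≠ 0).erase j₀ =
          univ.filter fun j => E j u v ≠ 0 ∧ j ≠ j₀ := by
        ext i; simp [and_comm]
      rw [h1, h2, card_filter, Fintype.sum_sum_type, card_filter, card_filter]
      congr 1
      · refine sum_congr rfl fun i _ => ?_
        by_cases h : i = i₀ <;> simp [h]
      · refine sum_congr rfl fun i _ => ?_
        by_cases h : i = j₀ <;> simp [h]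
    rw [hc]
    have h1 := hF.card_le u v
    have h2 := hE.card_le u v
    by_cases hAuv : A.Adj u v
    · by_cases hBuv : B.Adj u v
      · obtain ⟨h3, h4⟩ := hAB u v hAuv hBuv
        rw [card_erase_of_mem (by simp [h3]), card_erase_of_mem (by simp [h4])]
        omega
      · have : univ.filter (fun j => E j u v ≠ 0) = ∅ :=
          filter_eq_empty_iff.2 fun j _ h => h ((hE.mem j).1.2 u v hBuv)
        rw [this]
        have := card_erase_le (s := univ.filter fun i => F i u v ≠ 0) (a := i₀)
        simp only [erase_empty, card_empty]
        omega
    · have : univ.filter (fun j => F j u v ≠ 0) = ∅ :=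
        filter_eq_empty_iff.2 fun j _ h => h ((hF.mem j).1.2 u v hAuv)
      rw [this]
      have := card_erase_le (s := univ.filter fun i => E i u v ≠ 0) (a := j₀)
      simp only [erase_empty, card_empty]
      omega
  · intro Q hQ
    obtain ⟨Q₁, h₁, Q₂, h₂, rfl⟩ := hspan Q hQ
    obtain ⟨t, ht0, rfl⟩ := hF.span_avoid i₀ h₁
    obtain ⟨r, hr0, rfl⟩ := hE.span_avoid j₀ h₂
    refine ⟨Sum.elim t r, ?_⟩
    funext u v
    simp only [comb, Fintype.sum_sum_type, Sum.elim_inl, Sum.elim_inr, Pi.add_apply]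
    congr 1
    · refine sum_congr rfl fun i _ => ?_
      by_cases h : i = i₀
      · subst h; simp [ht0]
      · simp [h]
    · refine sum_congr rfl fun i _ => ?_
      by_cases h : i = j₀
      · subst h; simp [hr0]
      · simp [h]

end Families

noncomputable section Minors

variable {V : Type*} {G G' H : SimpleGraph V}

/-- A vertex set inducing a connected subgraph, phrased by closed subsets. -/
def ConnOn (G : SimpleGraph V) (A : Set V) : Prop :=
  A.Nonempty ∧ ∀ T : Set V, (∃ a ∈ A, a ∈ T) →
    (∀ u ∈ A, u ∈ T → ∀ v ∈ A, G.Adj u v → v ∈ T) → A ⊆ T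

theorem connOn_iff {A : Set V} : (G.induce A).Connected ↔ ConnOn G A := by
  constructor
  · intro h
    obtain ⟨⟨a, ha⟩⟩ := h.nonempty
    refine ⟨⟨a, ha⟩, ?_⟩
    rintro T ⟨b, hb, hbT⟩ hT v hv
    exact mem_of_reachable (G := G.induce A) (K := {x | (x : V) ∈ T})
      (fun u hu w huw => hT u u.2 hu w w.2 huw) (h.preconnected ⟨b, hb⟩ ⟨v, hv⟩) hbT
  · rintro ⟨⟨a, ha⟩, h⟩
    have key : ∀ b : A, (G.induce A).Reachable ⟨a, ha⟩ b := by
      have := h {v | ∀ hv : v ∈ A, (G.induce A).Reachable ⟨a, ha⟩ ⟨v, hv⟩}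
        ⟨a, ha, fun _ => SimpleGraph.Reachable.refl _⟩ (by
          intro u hu hu' v hv huv _
          exact (hu' hu).trans (SimpleGraph.Adj.reachable (G := G.induce A)
            (u := ⟨u, hu⟩) (v := ⟨v, hv⟩) huv))
      exact fun b => this b.2 b.2
    have : Nonempty A := ⟨⟨a, ha⟩⟩
    exact SimpleGraph.Connected.mk fun u v => (key u).symm.trans (key v)

theorem ConnOn.mono {A : Set V} (hle : G ≤ H) (h : ConnOn G A) : ConnOn H A :=
  ⟨h.1, fun T hT hc => h.2 T hT fun u hu huT v hv huv => hc u hu huT v hv (hle huv)⟩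

theorem connOn_singleton (v : V) : ConnOn G {v} :=
  ⟨⟨v, rfl⟩, by rintro T ⟨a, rfl, ha⟩ - b rfl; exact ha⟩

theorem connOn_pair {u v : V} (h : G.Adj u v) : ConnOn G {u, v} := by
  refine ⟨⟨u, by simp⟩, ?_⟩
  rintro T ⟨a, ha, haT⟩ hT b hb
  have h1 := hT u (by simp)
  have h2 := hT v (by simp)
  rcases ha with rfl | rfl <;> rcases hb with rfl | rfl
  · exact haT
  · exact h1 haT _ (by simp) h
  · exact h2 haT _ (by simp) h.symm
  · exact haT

theorem connOn_reachable (v : V) : ConnOn G {w | G.Reachable v w} := by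
  refine ⟨⟨v, SimpleGraph.Reachable.refl _⟩, ?_⟩
  rintro T ⟨a, ha, haT⟩ hT b hb
  refine (mem_of_reachable (G := G) (K := {w | G.Reachable v w ∧ w ∈ T}) ?_
    ((SimpleGraph.Reachable.symm ha).trans hb) ⟨ha, haT⟩).2
  rintro u ⟨hu, huT⟩ w huw
  exact ⟨hu.trans huw.reachable, hT u hu huT w (hu.trans huw.reachable) huw⟩

/-- The vertices of a path form a connected set. -/
theorem connOn_image_Icc {c : ℕ → V} {a b : ℕ} (hab : a ≤ b)
    (h : ∀ i, a ≤ i → i < b → G.Adj (c i) (c (i + 1))) : ConnOn G (c '' Set.Icc a b) := by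
  induction b, hab using Nat.le_induction with
  | base =>
    rw [Set.Icc_self, Set.image_singleton]
    exact connOn_singleton _
  | succ b hab ih =>
    have ih := ih fun i h1 h2 => h i h1 (by omega)
    have hsub : c '' Set.Icc a b ⊆ c '' Set.Icc a (b + 1) :=
      Set.image_mono (Set.Icc_subset_Icc_right (by omega))
    have hb : c b ∈ c '' Set.Icc a b := ⟨b, ⟨hab, le_rfl⟩, rfl⟩
    have hb1 : c (b + 1) ∈ c '' Set.Icc a (b + 1) := ⟨b + 1, ⟨by omega, le_rfl⟩, rfl⟩
    have hadj := h b hab (by omega)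
    refine ⟨ih.1.mono hsub, ?_⟩
    rintro T ⟨x, ⟨i, ⟨h1, h2⟩, rfl⟩, hxT⟩ hT
    have step : (∃ y ∈ c '' Set.Icc a b, y ∈ T) → c '' Set.Icc a (b + 1) ⊆ T := by
      intro hy
      have := ih.2 T hy fun u hu huT v hv huv => hT u (hsub hu) huT v (hsub hv) huv
      rintro _ ⟨j, ⟨h3, h4⟩, rfl⟩
      rcases Nat.lt_or_ge j (b + 1) with h5 | h5
      · exact this ⟨j, ⟨h3, by omega⟩, rfl⟩
      · obtain rfl : j = b + 1 := by omega
        exact hT _ (hsub hb) (this hb) _ hb1 hadj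
    rcases Nat.lt_or_ge i (b + 1) with h5 | h5
    · exact step ⟨_, ⟨i, ⟨h1, by omega⟩, rfl⟩, hxT⟩
    · obtain rfl : i = b + 1 := by omega
      exact step ⟨_, hb, hT _ hb1 hxT _ (hsub hb) hadj.symm⟩

theorem HasMinor_mono {W : Type*} {K : SimpleGraph W} (hle : G ≤ H) (h : G.HasMinor K) :
    H.HasMinor K := by
  obtain ⟨f, h1, h2, h3⟩ := h
  refine ⟨f, fun w => connOn_iff.2 ((connOn_iff.1 (h1 w)).mono hle), h2, fun w₁ w₂ h => ?_⟩
  obtain ⟨a, ha, b, hb, hab⟩ := h3 h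
  exact ⟨a, ha, b, hb, hle hab⟩

/-- Contracting a connected set `S` onto its member `p` yields a minor. -/
theorem HasMinor_of_contract {W : Type*} {K : SimpleGraph W} (hK : ∀ w, ∃ w', K.Adj w w')
    {S : Set V} {p : V} (hp : p ∈ S) (hS : ConnOn G S)
    (hadj : ∀ u v, G'.Adj u v → G.Adj u v ∨ (u = p ∧ ∃ s ∈ S, G.Adj s v) ∨
      (v = p ∧ ∃ s ∈ S, G.Adj s u))
    (hiso : ∀ s ∈ S, s ≠ p → ∀ w, ¬ G'.Adj s w) (h : G'.HasMinor K) : G.HasMinor K := by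
  obtain ⟨f, h1, h2, h3⟩ := h
  have hconn := fun w => connOn_iff.1 (h1 w)
  have hS' : ∀ w, ∀ s ∈ S, s ∈ f w → s = p := by
    intro w s hs hsw
    by_contra hne
    obtain ⟨w', hw'⟩ := hK w
    obtain ⟨a, ha, b, hb, hab⟩ := h3 hw'
    have := (hconn w).2 {s} ⟨s, hsw, rfl⟩ (by
      rintro u - rfl v - huv
      exact absurd huv (hiso u hs hne v)) ha
    rw [Set.mem_singleton_iff.1 this] at hab
    exact hiso s hs hne b hab
  refine ⟨fun w => if p ∈ f w then f w ∪ S else f w, fun w => connOn_iff.2 ?_, ?_, ?_⟩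
  · by_cases hpw : p ∈ f w
    · simp only [hpw, if_true]
      refine ⟨⟨p, Or.inl hpw⟩, ?_⟩
      rintro T ⟨a, ha, haT⟩ hT
      have hST : (∃ s ∈ S, s ∈ T) → S ⊆ T := fun h => hS.2 T h
        fun u hu huT v hv huv => hT u (Or.inr hu) huT v (Or.inr hv) huv
      have hfT : (∃ s ∈ f w, s ∈ T) → f w ⊆ T := fun h => (hconn w).2 T h (by
        intro u hu huT v hv huv
        rcases hadj u v huv with h | ⟨rfl, s, hs, hsv⟩ | ⟨rfl, s, hs, hsu⟩
        · exact hT u (Or.inl hu) huT v (Or.inl hv) h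
        · exact hT s (Or.inr hs) (hST ⟨u, hp, huT⟩ hs) v (Or.inl hv) hsv
        · exact hST ⟨s, hs, hT u (Or.inl hu) huT s (Or.inr hs) hsu.symm⟩ hp)
      have hpT : p ∈ T := by
        rcases ha with ha | ha
        · exact hfT ⟨a, ha, haT⟩ hpw
        · exact hST ⟨a, ha, haT⟩ hp
      exact Set.union_subset (hfT ⟨p, hpw, hpT⟩) (hST ⟨p, hp, hpT⟩)
    · simp only [hpw, if_false]
      refine ⟨(hconn w).1, fun T hT hc => (hconn w).2 T hT ?_⟩
      intro u hu huT v hv huv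
      rcases hadj u v huv with h | ⟨rfl, -⟩ | ⟨rfl, -⟩
      · exact hc u hu huT v hv h
      · exact absurd hu hpw
      · exact absurd hv hpw
  · intro w₁ w₂ hne
    have hd := h2 hne
    change Disjoint _ _ at hd
    change Disjoint _ _
    rw [Set.disjoint_left] at hd ⊢
    intro a ha hb
    have key : ∀ w, (a ∈ if p ∈ f w then f w ∪ S else f w) → a ∈ f w ∨ (p ∈ f w ∧ a ∈ S) := by
      intro w h
      split_ifs at h with hpw
      · exact h.imp id fun h => ⟨hpw, h⟩
      · exact Or.inl h
    rcases key _ ha with ha | ⟨ha, has⟩ <;> rcases key _ hb with hb | ⟨hb, hbs⟩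
    · exact hd ha hb
    · rw [hS' _ a hbs ha] at ha
      exact hd ha hb
    · rw [hS' _ a has hb] at hb
      exact hd ha hb
    · exact hd ha hb
  · intro w₁ w₂ hw
    have hsub : ∀ w, f w ⊆ if p ∈ f w then f w ∪ S else f w := by
      intro w
      split_ifs
      · exact Set.subset_union_left
      · exact le_rfl
    have hsub' : ∀ w, p ∈ f w → S ⊆ if p ∈ f w then f w ∪ S else f w := by
      intro w hw
      rw [if_pos hw]
      exact Set.subset_union_right
    obtain ⟨a, ha, b, hb, hab⟩ := h3 hw
    rcases hadj a b hab with h | ⟨rfl, s, hs, hsv⟩ | ⟨rfl, s, hs, hsu⟩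
    · exact ⟨a, hsub _ ha, b, hsub _ hb, h⟩
    · exact ⟨s, hsub' _ ha hs, b, hsub _ hb, hsv⟩
    · exact ⟨a, hsub _ ha, s, hsub' _ hb hs, hsu.symm⟩

theorem completeGraph_no_isolated (w : Fin 5) : ∃ w', (SimpleGraph.completeGraph (Fin 5)).Adj w w' :=
  ⟨w + 1, by revert w; simp⟩

theorem completeBipartiteGraph_no_isolated (w : Fin 3 ⊕ Fin 3) :
    ∃ w', (completeBipartiteGraph (Fin 3) (Fin 3)).Adj w w' := by
  rcases w with w | w
  · exact ⟨Sum.inr 0, by simp⟩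
  · exact ⟨Sum.inl 0, by simp⟩

theorem IsPlanar_mono (hle : G ≤ H) (h : H.IsPlanar) : G.IsPlanar :=
  ⟨fun h' => h.1 (HasMinor_mono hle h'), fun h' => h.2 (HasMinor_mono hle h')⟩

theorem IsPlanar_of_contract {S : Set V} {p : V} (hp : p ∈ S) (hS : ConnOn G S)
    (hadj : ∀ u v, G'.Adj u v → G.Adj u v ∨ (u = p ∧ ∃ s ∈ S, G.Adj s v) ∨
      (v = p ∧ ∃ s ∈ S, G.Adj s u))
    (hiso : ∀ s ∈ S, s ≠ p → ∀ w, ¬ G'.Adj s w) (h : G.IsPlanar) : G'.IsPlanar :=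
  ⟨fun hm => h.1 (HasMinor_of_contract completeGraph_no_isolated hp hS hadj hiso hm),
    fun hm => h.2 (HasMinor_of_contract completeBipartiteGraph_no_isolated hp hS hadj hiso hm)⟩

/-- Two sets joined by an edge. -/
def Touch (G : SimpleGraph V) (A B : Set V) : Prop := ∃ a ∈ A, ∃ b ∈ B, G.Adj a b

theorem Touch.symm {A B : Set V} (h : Touch G A B) : Touch G B A := by
  obtain ⟨a, ha, b, hb, hab⟩ := h
  exact ⟨b, hb, a, ha, hab.symm⟩

theorem not_isPlanar_of_five (f : Fin 5 → Set V) (hc : ∀ i, ConnOn G (f i))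
    (hd : ∀ i j, i < j → Disjoint (f i) (f j)) (ht : ∀ i j, i < j → Touch G (f i) (f j)) :
    ¬ G.IsPlanar := by
  refine fun h => h.1 ⟨f, fun i => connOn_iff.2 (hc i), ?_, ?_⟩
  · intro i j hij
    rcases lt_or_gt_of_ne hij with h | h
    · exact hd i j h
    · exact (hd j i h).symm
  · intro i j hij
    rcases lt_or_gt_of_ne hij.ne with h | h
    · exact ht i j h
    · exact (ht j i h).symm

theorem not_isPlanar_of_three_three (f g : Fin 3 → Set V) (hf : ∀ i, ConnOn G (f i))
    (hg : ∀ i, ConnOn G (g i)) (hff : ∀ i j, i < j → Disjoint (f i) (f j))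
    (hgg : ∀ i j, i < j → Disjoint (g i) (g j)) (hfg : ∀ i j, Disjoint (f i) (g j))
    (ht : ∀ i j, Touch G (f i) (g j)) : ¬ G.IsPlanar := by
  refine fun h => h.2 ⟨Sum.elim f g, ?_, ?_, ?_⟩
  · rintro (i | i)
    · exact connOn_iff.2 (hf i)
    · exact connOn_iff.2 (hg i)
  · rintro (i | i) (j | j) hij
    · rcases lt_or_gt_of_ne (show i ≠ j by simpa using hij) with h | h
      · exact hff i j h
      · exact (hff j i h).symm
    · exact hfg i j
    · exact (hfg j i).symm
    · rcases lt_or_gt_of_ne (show i ≠ j by simpa using hij) with h | h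
      · exact hgg i j h
      · exact (hgg j i h).symm
  · rintro (i | i) (j | j) hij
    · simp at hij
    · exact ht i j
    · exact (ht j i).symm
    · simp at hij

end Minors

noncomputable section Separation

variable {V : Type*} [Fintype V] {G A B H : SimpleGraph V} {p q : V}

/-- The number of ordered adjacent pairs. -/
def darts (G : SimpleGraph V) : ℕ := #(univ.filter fun p : V × V => G.Adj p.1 p.2)

theorem darts_lt (hle : H ≤ G) (hG : G.Adj p q) (hH : ¬ H.Adj p q) : darts H < darts G := by
  refine card_lt_card ⟨?_, ?_⟩
  · intro x
    simp only [mem_filter, mem_univ, true_and]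
    exact fun h => hle h
  · intro h
    have := h (show (p, q) ∈ _ by simp [hG])
    simp [hH] at this

/-- A counterexample to MacLane's criterion with the least number of edges. -/
structure MinCex (G : SimpleGraph V) : Prop where
  planar : G.IsPlanar
  not_macLane : ¬ MacLane G
  ih : ∀ H : SimpleGraph V, darts H < darts G → H.IsPlanar → MacLane H

theorem MinCex.macLane_of_le (h : MinCex G) (hle : H ≤ G) (hG : G.Adj p q) (hH : ¬ H.Adj p q) :
    MacLane H :=
  h.ih H (darts_lt hle hG hH) (IsPlanar_mono hle h.planar)

theorem MinCex.sep (h : MinCex G) (hA : A ≤ G)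
    (hb : ∀ v w w', A.Adj v w → G.Adj v w' → ¬ A.Adj v w' → v = p ∨ v = q)
    (h1 : ∃ u v, A.Adj u v) (h2 : ∃ u v, G.Adj u v ∧ ¬ A.Adj u v) :
    p ≠ q ∧ A.Reachable p q := by
  by_contra hcon
  apply h.not_macLane
  obtain ⟨a, a', ha⟩ := h1
  obtain ⟨b, b', hb1, hb2⟩ := h2
  have hfA : MacLaneFace A 0 := (h.macLane_of_le hA hb1 hb2).face_zero
  have hfB : MacLaneFace (G \ A) 0 :=
    (h.macLane_of_le sdiff_le (hA ha) (by simp [ha])).face_zero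
  refine macLane_glue hfA hfB hA sdiff_le (fun u v h1 h2 => absurd h1 ?_) ?_
  · rw [SimpleGraph.sdiff_adj] at h2
    exact h2.2
  intro Q hQ
  have hr : restr A Q ∈ chains A := restr_mem hQ.1
  have hg0 : ∀ v, v ≠ p → v ≠ q → bd (restr A Q) v = 0 := by
    intro v hvp hvq
    by_cases hv : ∃ w, A.Adj v w
    · obtain ⟨w, hw⟩ := hv
      rw [← sum_row_of_cycles hQ v, bd_apply]
      refine sum_congr rfl fun x _ => ?_
      unfold restr
      split_ifs with hx
      · rfl
      · symm
        by_contra hne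
        rcases hb v w x hw (adj_of_chains hQ.1 hne) hx with h | h <;> contradiction
    · push Not at hv
      exact bd_eq_zero_of_not_adj hr hv
  have hsum := bd_sum_univ hr
  have hbd : bd (restr A Q) = 0 := by
    by_cases hpq : p = q
    · subst hpq
      rw [sum_eq_single p (fun v _ hv => hg0 v hv hv) (by simp)] at hsum
      funext v
      by_cases hv : v = p
      · rw [hv]; exact hsum
      · exact hg0 v hv hv
    · rw [← sum_subset (subset_univ {p, q}) (by
        intro v _ hv
        simp only [mem_insert, mem_singleton, not_or] at hv
        exact hg0 v hv.1 hv.2), sum_pair hpq] at hsum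
      have hpq' : bd (restr A Q) p = bd (restr A Q) q := CharTwo.add_eq_zero.1 hsum
      by_cases hp0 : bd (restr A Q) p = 0
      · funext v
        by_cases hv : v = p
        · rw [hv]; exact hp0
        · by_cases hv' : v = q
          · rw [hv', ← hpq']; exact hp0
          · exact hg0 v hv hv'
      · exfalso
        refine hcon ⟨hpq, reachable_of_bd hr ?_⟩
        funext v
        have hp1 := zmod_two_eq_one hp0
        by_cases hv : v = p
        · subst hv; simp [pt, hp1, hpq]
        · by_cases hv' : v = q
          · subst hv'; rw [← hpq']; simp [pt, hp1, Ne.symm hpq, hpq]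
          · simp [pt, hg0 v hv hv', hv, hv']
  refine ⟨restr A Q, ⟨hr, hbd⟩, Q + restr A Q, ⟨?_, ?_⟩, ?_⟩
  · refine sub_restr_mem ?_
    rw [sup_sdiff_self_right, sup_eq_right.2 hA]
    exact hQ.1
  · change bd _ = 0
    rw [map_add, hbd, add_zero]
    exact hQ.2
  · rw [add_left_comm, chain_add_self, add_zero]

/-- A 2-separation at `p, q`, not taking the possible edge `p q` into account. -/
structure Sep (G A B : SimpleGraph V) (p q : V) : Prop where
  leA : A ≤ G
  leB : B ≤ G
  cover : ∀ u v, G.Adj u v → A.Adj u v ∨ B.Adj u v ∨ s(u, v) = s(p, q)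
  common : ∀ u v w, A.Adj u v → B.Adj u w → u = p ∨ u = q
  notA : ¬ A.Adj p q
  notB : ¬ B.Adj p q
  neA : ∃ u v, A.Adj u v
  neB : ∃ u v, B.Adj u v

theorem Sep.symm (h : Sep G A B p q) : Sep G B A p q where
  leA := h.leB
  leB := h.leA
  cover u v huv := by rcases h.cover u v huv with h | h | h <;> simp [h]
  common u v w h1 h2 := h.common u w v h2 h1
  notA := h.notB
  notB := h.notA
  neA := h.neB
  neB := h.neA

theorem Sep.disjoint (h : Sep G A B p q) {u v : V} (h1 : A.Adj u v) : ¬ B.Adj u v := by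
  intro h2
  have := h1.ne
  rcases h.common u v v h1 h2 with rfl | rfl <;>
    rcases h.common v u u h1.symm h2.symm with rfl | rfl
  · exact this rfl
  · exact h.notA h1
  · exact h.notA h1.symm
  · exact this rfl

theorem Sep.reach (h : Sep G A B p q) (hG : MinCex G) : p ≠ q ∧ A.Reachable p q := by
  obtain ⟨b, b', hb⟩ := h.neB
  refine hG.sep h.leA ?_ h.neA ⟨b, b', h.leB hb, fun h' => h.disjoint h' hb⟩
  intro v w w' hw hw' hw''
  rcases h.cover v w' hw' with h1 | h1 | h1
  · contradiction
  · exact h.common v w w' hw h1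
  · rcases Sym2.eq_iff.1 h1 with h1 | h1
    · exact Or.inl h1.1
    · exact Or.inr h1.1

theorem exists_side (hpq : p ≠ q) (h : B.Reachable p q) :
    ∃ S : Set V, p ∈ S ∧ q ∉ S ∧ ConnOn B S ∧ (∃ s ∈ S, B.Adj s q) ∧
      ∀ s ∈ S, s = p ∨ ∃ w, B.Adj s w := by
  let B' : SimpleGraph V :=
    { Adj := fun u v => B.Adj u v ∧ u ≠ q ∧ v ≠ q
      symm := ⟨fun u v h => ⟨h.1.symm, h.2.2, h.2.1⟩⟩
      loopless := ⟨fun u h => h.1.ne rfl⟩ }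
  have hB' : B' ≤ B := fun u v h => h.1
  have hq : ∀ s, B'.Reachable p s → s ≠ q := by
    intro s hs
    exact mem_of_reachable (G := B') (K := {s | s ≠ q}) (fun u _ v huv => huv.2.2) hs hpq
  refine ⟨{s | B'.Reachable p s}, SimpleGraph.Reachable.refl _, fun h => hq q h rfl,
    (connOn_reachable p).mono hB', ?_, ?_⟩
  · by_contra hcon
    push Not at hcon
    refine hq q (mem_of_reachable (G := B) (K := {s | B'.Reachable p s}) ?_ h
      (SimpleGraph.Reachable.refl _)) rfl
    intro u hu v huv
    have hvq : v ≠ q := by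
      rintro rfl
      exact hcon u hu huv
    exact SimpleGraph.Reachable.trans hu (SimpleGraph.Adj.reachable ⟨huv, hq u hu, hvq⟩)
  · intro s hs
    refine mem_of_reachable (G := B') (K := {s | s = p ∨ ∃ w, B.Adj s w}) ?_ hs (Or.inl rfl)
    exact fun u _ v huv => Or.inr ⟨u, huv.1.symm⟩

theorem exists_adj_of_reachable (hpq : p ≠ q) (h : B.Reachable p q) : ∃ a, B.Adj p a := by
  by_contra hcon
  push Not at hcon
  have := mem_of_reachable (G := B) (K := {p}) (by
    rintro u rfl v huv
    exact absurd huv (hcon v)) h rfl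
  exact hpq this.symm

theorem Sep.plus (h : Sep G A B p q) (hG : MinCex G) :
    ∃ f, MacLaneFace (A ⊔ SimpleGraph.edge p q) f ∧ f p q ≠ 0 := by
  obtain ⟨hpq, hreach⟩ := h.reach hG
  have hB := (h.symm.reach hG).2
  obtain ⟨S, hpS, hqS, hconn, ⟨s, hs, hsq⟩, hiso⟩ := exists_side hpq hB
  obtain ⟨a, ha⟩ := exists_adj_of_reachable hpq hB
  have hplanar : (A ⊔ SimpleGraph.edge p q).IsPlanar := by
    refine IsPlanar_of_contract hpS (hconn.mono h.leB) ?_ ?_ hG.planar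
    · intro u v huv
      rw [SimpleGraph.sup_adj, SimpleGraph.edge_adj] at huv
      rcases huv with huv | ⟨⟨rfl, rfl⟩ | ⟨rfl, rfl⟩, -⟩
      · exact Or.inl (h.leA huv)
      · exact Or.inr (Or.inl ⟨rfl, s, hs, h.leB hsq⟩)
      · exact Or.inr (Or.inr ⟨rfl, s, hs, h.leB hsq⟩)
    · intro s' hs' hne w hw
      have hneq : s' ≠ q := by rintro rfl; exact hqS hs'
      rw [SimpleGraph.sup_adj, SimpleGraph.edge_adj] at hw
      rcases hw with hw | ⟨⟨rfl, rfl⟩ | ⟨rfl, rfl⟩, -⟩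
      · rcases hiso s' hs' with h' | ⟨w', hw'⟩
        · exact hne h'
        · rcases h.common s' w w' hw hw' with h' | h' <;> contradiction
      · exact hne rfl
      · exact hneq rfl
  have hlt : darts (A ⊔ SimpleGraph.edge p q) < darts G := by
    have hsub1 : (univ.filter fun x : V × V => (A ⊔ SimpleGraph.edge p q).Adj x.1 x.2) ⊆
        (univ.filter fun x : V × V => A.Adj x.1 x.2) ∪ {(p, q), (q, p)} := by
      rintro ⟨x, y⟩
      simp only [mem_filter, mem_univ, true_and, mem_union, mem_insert, mem_singleton,
        SimpleGraph.sup_adj, SimpleGraph.edge_adj, Prod.mk.injEq]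
      tauto
    have hsp : s ≠ p := by rintro rfl; exact h.notB hsq
    have hdisj : Disjoint (univ.filter fun x : V × V => A.Adj x.1 x.2)
        {(p, a), (a, p), (s, q)} := by
      rw [disjoint_left]
      intro x hx hx'
      simp only [mem_filter, mem_univ, true_and] at hx
      simp only [mem_insert, mem_singleton] at hx'
      rcases hx' with rfl | rfl | rfl
      · exact h.disjoint hx ha
      · exact h.disjoint hx ha.symm
      · exact h.disjoint hx hsq
    have hsub2 : (univ.filter fun x : V × V => A.Adj x.1 x.2) ∪ {(p, a), (a, p), (s, q)} ⊆
        univ.filter fun x : V × V => G.Adj x.1 x.2 := by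
      intro x
      simp only [mem_filter, mem_univ, true_and, mem_union, mem_insert, mem_singleton]
      rintro (hx | rfl | rfl | rfl)
      · exact h.leA hx
      · exact h.leB ha
      · exact h.leB ha.symm
      · exact h.leB hsq
    have hap := ha.ne
    have h3 : #({(p, a), (a, p), (s, q)} : Finset (V × V)) = 3 := by
      refine card_eq_three.2 ⟨_, _, _, ?_, ?_, ?_, rfl⟩
      · simp [hap]
      · simp [hsp.symm]
      · simp [hpq]
    have e1 := card_le_card hsub1
    have e2 := card_union_le (univ.filter fun x : V × V => A.Adj x.1 x.2) {(p, q), (q, p)}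
    have e3 := card_le_two (a := (p, q)) (b := (q, p))
    have e4 := card_le_card hsub2
    rw [card_union_of_disjoint hdisj, h3] at e4
    have e0 : darts (A ⊔ SimpleGraph.edge p q) = #(univ.filter fun x : V × V =>
        (A ⊔ SimpleGraph.edge p q).Adj x.1 x.2) := by
      unfold darts
      congr!
    rw [e0]
    unfold darts
    omega
  obtain ⟨ι, _, F, hF⟩ := hG.ih _ hlt hplanar
  obtain ⟨P, hP, hPb⟩ := exists_chain_of_reachable hreach
  have hQ : P + edge p q ∈ cycles (A ⊔ SimpleGraph.edge p q) := by
    refine ⟨add_mem (chains_mono le_sup_left hP) (edge_mem_chains ?_), ?_⟩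
    · simp [SimpleGraph.edge_adj, hpq]
    · change bd _ = 0
      rw [map_add, hPb, bd_edge]
      exact fun_add_self _
  obtain ⟨i, hi⟩ := hF.exists_face hQ (u := p) (v := q) (by
    simp [hP.2 p q h.notA, edge_apply_self hpq])
  exact ⟨F i, ⟨ι, _, F, hF, i, rfl⟩, hi⟩

theorem Sep.false (h : Sep G A B p q) (hG : MinCex G) : False := by
  obtain ⟨f, hf, hfpq⟩ := h.plus hG
  obtain ⟨g, hg, hgpq⟩ := h.symm.plus hG
  have hpq := (h.reach hG).1
  apply hG.not_macLane
  have hG' : G ≤ (A ⊔ SimpleGraph.edge p q) ⊔ (B ⊔ SimpleGraph.edge p q) := by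
    intro u v huv
    have hne := huv.ne
    simp only [SimpleGraph.sup_adj, SimpleGraph.edge_adj]
    rcases h.cover u v huv with h1 | h1 | h1
    · tauto
    · tauto
    · rcases Sym2.eq_iff.1 h1 with h1 | h1 <;> tauto
  refine MacLane.mono hG' (macLane_glue hf hg le_sup_left le_sup_right ?_ ?_)
  · intro u v h1 h2
    have key : s(u, v) = s(p, q) := by
      simp only [SimpleGraph.sup_adj, SimpleGraph.edge_adj] at h1 h2
      rw [Sym2.eq_iff]
      rcases h1 with h1 | h1
      · rcases h2 with h2 | h2
        · exact absurd h2 (h.disjoint h1)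
        · exact h2.1
      · exact h1.1
    rcases Sym2.eq_iff.1 key with ⟨rfl, rfl⟩ | ⟨rfl, rfl⟩
    · exact ⟨hfpq, hgpq⟩
    · rw [hf.mem.1.1, hg.mem.1.1]
      exact ⟨hfpq, hgpq⟩
  · intro Q hQ
    refine cycles_sup_split (L := SimpleGraph.edge p q) le_sup_right le_sup_right
      (U := {p, q}) ?_ ?_ hQ
    · rintro v ⟨w, hw⟩ ⟨w', hw'⟩
      simp only [SimpleGraph.sup_adj, SimpleGraph.edge_adj] at hw hw'
      simp only [Set.mem_insert_iff, Set.mem_singleton_iff]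
      rcases hw with hw | hw
      · rcases hw' with hw' | hw'
        · exact h.common v w w' hw hw'
        · tauto
      · tauto
    · have hr : (SimpleGraph.edge p q).Reachable p q :=
        SimpleGraph.Adj.reachable (by simp [SimpleGraph.edge_adj, hpq])
      rintro u (rfl | rfl) v (rfl | rfl)
      · exact SimpleGraph.Reachable.refl _
      · exact hr
      · exact hr.symm
      · exact SimpleGraph.Reachable.refl _

theorem MinCex.sep_small (h : MinCex G) (hA : A ≤ G)
    (hb : ∀ v w w', A.Adj v w → G.Adj v w' → ¬ A.Adj v w' → v = p ∨ v = q)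
    (h1 : ∃ u v, A.Adj u v ∧ s(u, v) ≠ s(p, q))
    (h2 : ∃ u v, G.Adj u v ∧ ¬ A.Adj u v ∧ s(u, v) ≠ s(p, q)) : False := by
  refine Sep.false (G := G) (A := A.deleteEdges {s(p, q)}) (B := (G \ A).deleteEdges {s(p, q)})
    (p := p) (q := q) ⟨?_, ?_, ?_, ?_, ?_, ?_, ?_, ?_⟩ h
  · exact (A.deleteEdges_le _).trans hA
  · exact (SimpleGraph.deleteEdges_le _).trans sdiff_le
  · intro u v huv
    simp only [SimpleGraph.deleteEdges_adj, SimpleGraph.sdiff_adj, Set.mem_singleton_iff]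
    tauto
  · intro u v w h1 h2
    simp only [SimpleGraph.deleteEdges_adj, SimpleGraph.sdiff_adj] at h1 h2
    exact hb u v w h1.1 h2.1.1 h2.1.2
  · simp [SimpleGraph.deleteEdges_adj]
  · simp [SimpleGraph.deleteEdges_adj]
  · obtain ⟨u, v, h1, h1'⟩ := h1
    refine ⟨u, v, ?_⟩
    simp only [SimpleGraph.deleteEdges_adj, Set.mem_singleton_iff]
    exact ⟨h1, h1'⟩
  · obtain ⟨u, v, h3, h4, h5⟩ := h2
    refine ⟨u, v, ?_⟩
    simp only [SimpleGraph.deleteEdges_adj, SimpleGraph.sdiff_adj, Set.mem_singleton_iff]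
    exact ⟨⟨h3, h4⟩, h5⟩

/-- Vertex sets closed off two vertices. -/
theorem MinCex.conn (h : MinCex G) {x y : V} {K : Set V} (hx : x ∉ K) (hy : y ∉ K)
    (hK : ∃ k ∈ K, ∃ w, G.Adj k w)
    (hcl : ∀ u ∈ K, ∀ v, G.Adj u v → v ∈ K ∨ v = x ∨ v = y) {v w : V} (hv : G.Adj v w) :
    v ∈ K ∨ v = x ∨ v = y := by
  by_contra hcon
  push Not at hcon
  let A : SimpleGraph V :=
    { Adj := fun u v => G.Adj u v ∧ (u ∈ K ∨ v ∈ K)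
      symm := ⟨fun u v h => ⟨h.1.symm, h.2.symm⟩⟩
      loopless := ⟨fun u h => h.1.ne rfl⟩ }
  obtain ⟨k, hk, k', hk'⟩ := hK
  refine h.sep_small (A := A) (p := x) (q := y) (fun _ _ h => h.1) ?_ ?_ ?_
  · rintro a b b' ⟨hab, hab'⟩ hb' hn
    have ha : a ∉ K := fun ha => hn ⟨hb', Or.inl ha⟩
    have hbK : b ∈ K := hab'.resolve_left ha
    exact (hcl b hbK a hab.symm).resolve_left ha
  · refine ⟨k, k', ⟨hk', Or.inl hk⟩, fun heq => ?_⟩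
    rcases Sym2.eq_iff.1 heq with ⟨rfl, -⟩ | ⟨rfl, -⟩
    · exact hx hk
    · exact hy hk
  · refine ⟨v, w, hv, ?_, fun heq => ?_⟩
    · rintro ⟨-, h1 | h1⟩
      · exact hcon.1 h1
      · rcases hcl w h1 v hv.symm with h2 | h2 | h2
        · exact hcon.1 h2
        · exact hcon.2.1 h2
        · exact hcon.2.2 h2
    · rcases Sym2.eq_iff.1 heq with ⟨rfl, -⟩ | ⟨rfl, -⟩
      · exact hcon.2.1 rfl
      · exact hcon.2.2 rfl

theorem macLane_of_edge_determines {v a : V} (h : ∀ Q ∈ cycles G, Q v a = 0 → Q = 0) :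
    MacLane G := by
  by_cases hex : ∃ Q ∈ cycles G, Q v a ≠ 0
  · obtain ⟨Q₀, hQ₀, h₀⟩ := hex
    refine macLane_of_span_singleton hQ₀ fun Q hQ => ?_
    by_cases hva : Q v a = 0
    · exact Or.inl (h Q hQ hva)
    · right
      have := h (Q + Q₀) (add_mem hQ hQ₀) (by
        rw [Pi.add_apply, Pi.add_apply, zmod_two_eq_one hva, zmod_two_eq_one h₀]; rfl)
      have h2 := congrArg (· + Q₀) this
      simpa [add_assoc, chain_add_self] using h2
  · push Not at hex
    exact macLane_of_span_singleton (zero_mem _) fun Q hQ => Or.inl (h Q hQ (hex Q hQ))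

theorem MinCex.three_le_degree (h : MinCex G) {v w : V} (hv : G.Adj v w) (a b : V) :
    ∃ c, G.Adj v c ∧ c ≠ a ∧ c ≠ b := by
  by_contra hcon
  push Not at hcon
  have hall : ∀ c, G.Adj v c → c = a ∨ c = b := fun c hc => by
    by_cases h' : c = a
    · exact Or.inl h'
    · exact Or.inr (hcon c hc h')
  clear hcon
  wlog hva : G.Adj v a generalizing a b
  · refine this b a (fun c hc => (hall c hc).symm) ?_
    rcases hall w hv with rfl | rfl
    · contradiction
    · exact hv
  let A : SimpleGraph V :=
    { Adj := fun u u' => G.Adj u u' ∧ (u = v ∨ u' = v)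
      symm := ⟨fun u v h => ⟨h.1.symm, h.2.symm⟩⟩
      loopless := ⟨fun u h => h.1.ne rfl⟩ }
  by_cases hB : ∃ u u', G.Adj u u' ∧ ¬ A.Adj u u' ∧ s(u, u') ≠ s(a, b)
  · by_cases hvb : v = b
    · have := h.sep (A := A) (p := a) (q := a) (fun _ _ h => h.1) ?_ ⟨v, a, hva, Or.inl rfl⟩ ?_
      · exact this.1 rfl
      · rintro x y y' ⟨hxy, h1⟩ hxy' hn
        have hxv : x ≠ v := by rintro rfl; exact hn ⟨hxy', Or.inl rfl⟩
        obtain rfl : y = v := h1.resolve_left hxv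
        rcases hall x hxy.symm with h | h
        · exact Or.inl h
        · exact absurd (h.trans hvb.symm) hxv
      · obtain ⟨u, u', h1, h2, -⟩ := hB
        exact ⟨u, u', h1, h2⟩
    · refine h.sep_small (A := A) (p := a) (q := b) (fun _ _ h => h.1) ?_
        ⟨v, a, ⟨hva, Or.inl rfl⟩, ?_⟩ hB
      · rintro x y y' ⟨hxy, h1⟩ hxy' hn
        have hxv : x ≠ v := by rintro rfl; exact hn ⟨hxy', Or.inl rfl⟩
        obtain rfl : y = v := h1.resolve_left hxv
        exact hall x hxy.symm
      · intro heq
        rcases Sym2.eq_iff.1 heq with ⟨h1, -⟩ | ⟨h1, -⟩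
        · exact hva.ne h1
        · exact hvb h1
  · push Not at hB
    apply h.not_macLane
    refine macLane_of_edge_determines (v := v) (a := a) fun Q hQ h0 => ?_
    have hrow : ∀ c, Q v c = 0 := by
      intro c
      by_contra hc
      have hc' := hall c (adj_of_chains hQ.1 hc)
      have hcb : c = b := hc'.resolve_left (by rintro rfl; exact hc h0)
      subst hcb
      have := sum_row_of_cycles hQ v
      rw [sum_eq_single c] at this
      · exact hc this
      · intro d _ hd
        by_contra hne
        rcases hall d (adj_of_chains hQ.1 hne) with rfl | rfl
        · exact hne h0
        · exact hd rfl
      · simp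
    have hcol : ∀ c, Q c v = 0 := fun c => by rw [hQ.1.1]; exact hrow c
    have hedge : ∀ u u', Q u u' ≠ 0 → s(u, u') = s(a, b) := by
      intro u u' hne
      refine hB u u' (adj_of_chains hQ.1 hne) ?_
      rintro ⟨-, rfl | rfl⟩
      · exact hne (hrow _)
      · exact hne (hcol _)
    funext u u'
    by_contra hne
    have huu := (adj_of_chains hQ.1 hne).ne
    have := sum_row_of_cycles hQ u
    rw [sum_eq_single u'] at this
    · exact hne this
    · intro d _ hd
      by_contra hne'
      have h1 := (hedge u u' hne).trans (hedge u d hne').symm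
      rcases Sym2.eq_iff.1 h1 with h1 | h1
      · exact hd h1.2.symm
      · exact huu h1.2.symm
    · simp

/-- In a minimal counterexample there is an edge not contained in a separating triple. -/
theorem MinCex.exists_contractible (h : MinCex G) (hne : ∃ x y, G.Adj x y) :
    ∃ x y, G.Adj x y ∧ ∀ (z : V) (K : Set V), x ∉ K → y ∉ K → z ∉ K →
      (∃ k ∈ K, ∃ w, G.Adj k w) →
      (∀ u ∈ K, ∀ v, G.Adj u v → v ∈ K ∨ v = x ∨ v = y ∨ v = z) →
      ∀ v w, G.Adj v w → v ∈ K ∨ v = x ∨ v = y ∨ v = z := by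
  by_contra hcon
  push Not at hcon
  let U : Set V := {v | ∃ w, G.Adj v w}
  let Bad : V → V → V → Finset V → Prop := fun x y z K => G.Adj x y ∧ (∀ k ∈ K, k ∈ U) ∧
    x ∉ K ∧ y ∉ K ∧ z ∉ K ∧ K.Nonempty ∧
    (∀ u ∈ K, ∀ v, G.Adj u v → v ∈ K ∨ v = x ∨ v = y ∨ v = z) ∧
    ∃ v ∈ U, v ∉ K ∧ v ≠ x ∧ v ≠ y ∧ v ≠ z
  have hbad : ∀ x y, G.Adj x y → ∃ z K, Bad x y z K := by
    intro x y hxy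
    obtain ⟨z, K, h1, h2, h3, ⟨k, hk, hkU⟩, h5, v, w, hvw, hv⟩ := hcon x y hxy
    refine ⟨z, univ.filter fun v => v ∈ K ∧ v ∈ U, hxy, ?_, ?_, ?_, ?_, ⟨k, ?_⟩, ?_, v, ⟨w, hvw⟩,
      ?_, hv.2⟩
    · intro k hk
      simp only [mem_filter, mem_univ, true_and] at hk
      exact hk.2
    · simp [h1]
    · simp [h2]
    · simp [h3]
    · simpa using ⟨hk, hkU⟩
    · intro u hu v huv
      simp only [mem_filter, mem_univ, true_and] at hu ⊢
      rcases h5 u hu.1 v huv with h | h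
      · exact Or.inl ⟨h, u, huv.symm⟩
      · exact Or.inr h
    · simp [hv.1]
  have hmin : ∀ n x y z (K : Finset V), #K = n → ¬ Bad x y z K := by
    intro n
    induction n using Nat.strong_induction_on with
    | _ n ih =>
      rintro x y z K hn ⟨hxy, hKU, hx, hy, hz, ⟨k, hk⟩, hcl, v, ⟨v', hv'⟩, hvK, hvx, hvy, hvz⟩
      have hzu : ∃ u ∈ K, G.Adj z u := by
        by_contra hz'
        push Not at hz'
        rcases h.conn (K := (K : Set V)) (x := x) (y := y) (by simpa) (by simpa)
          ⟨k, by simpa, hKU k hk⟩ (by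
            intro a ha b hab
            rcases hcl a (by simpa using ha) b hab with h | h | h | h
            · simp [h]
            · simp [h]
            · simp [h]
            · subst h
              exact absurd hab.symm (hz' a (by simpa using ha))) hv' with h | h | h
        · exact hvK (by simpa using h)
        · exact hvx h
        · exact hvy h
      obtain ⟨u, huK, hzu⟩ := hzu
      have main : ∀ w (D : Finset V), Bad z u w D → x ∉ D → y ∉ D → False := by
        rintro w D ⟨-, hDU, hzD, huD, hwD, ⟨d₀, hd₀⟩, hDcl, e, ⟨e', he'⟩, heD, hez, heu, hew⟩ hxD hyD
        have hud : ∃ d ∈ D, G.Adj u d := by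
          by_contra hz'
          push Not at hz'
          rcases h.conn (K := (D : Set V)) (x := z) (y := w) (by simpa) (by simpa)
            ⟨d₀, by simpa, hDU d₀ hd₀⟩ (by
              intro a ha b hab
              rcases hDcl a (by simpa using ha) b hab with h | h | h | h
              · simp [h]
              · simp [h]
              · subst h
                exact absurd hab.symm (hz' a (by simpa using ha))
              · simp [h]) he' with h | h | h
          · exact heD (by simpa using h)
          · exact hez h
          · exact hew h
        obtain ⟨d, hdD, hud⟩ := hud
        have hdK : d ∈ K := by
          rcases hcl u huK d hud with h | rfl | rfl | rfl
          · exact h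
          · contradiction
          · contradiction
          · contradiction
        refine ih #(D ∩ K) ?_ z u w (D ∩ K) rfl ⟨hzu, ?_, ?_, ?_, ?_, ⟨d, ?_⟩, ?_, e, ⟨e', he'⟩, ?_,
          hez, heu, hew⟩
        · rw [← hn]
          refine card_lt_card ⟨inter_subset_right, fun hsub => huD ?_⟩
          exact (mem_inter.1 (hsub huK)).1
        · intro k hk
          exact hDU k (mem_inter.1 hk).1
        · simp [hzD]
        · simp [huD]
        · simp [hwD]
        · simp [hdD, hdK]
        · intro a ha b hab
          rw [mem_inter] at ha ⊢
          rcases hDcl a ha.1 b hab with h1 | h1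
          · rcases hcl a ha.2 b hab with h2 | rfl | rfl | rfl
            · exact Or.inl ⟨h1, h2⟩
            · contradiction
            · contradiction
            · contradiction
          · exact Or.inr h1
        · simp [heD]
      obtain ⟨w, D, hD⟩ := hbad z u hzu
      have hD0 := hD
      obtain ⟨-, hDU, hzD, huD, hwD, ⟨d₀, hd₀⟩, hDcl, e, he, heD, hez, heu, hew⟩ := hD
      by_cases hxyD : x ∉ D ∧ y ∉ D
      · exact main w D hD0 hxyD.1 hxyD.2
      · have hnot : ∀ a b, a ∈ D → G.Adj a b →
            ¬ (b ∈ U ∧ b ∉ D ∧ b ≠ z ∧ b ≠ u ∧ b ≠ w) := by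
          rintro a b ha hab ⟨-, h1, h2, h3, h4⟩
          rcases hDcl a ha b hab with h | h | h | h <;> contradiction
        refine main w (univ.filter fun b => b ∈ U ∧ b ∉ D ∧ b ≠ z ∧ b ≠ u ∧ b ≠ w)
          ⟨hzu, ?_, ?_, ?_, ?_, ⟨e, ?_⟩, ?_, d₀, hDU _ hd₀, ?_, ?_, ?_, ?_⟩ ?_ ?_
        · intro k hk
          simp only [mem_filter, mem_univ, true_and] at hk
          exact hk.1
        · simp
        · simp
        · simp
        · simpa using ⟨he, heD, hez, heu, hew⟩
        · intro a ha b hab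
          simp only [mem_filter, mem_univ, true_and] at ha ⊢
          by_contra hb
          have hbD : b ∈ D := by
            by_contra hbD
            apply hb
            left
            refine ⟨⟨a, hab.symm⟩, hbD, ?_, ?_, ?_⟩ <;> tauto
          exact hnot b a hbD hab.symm ha
        · simp [hd₀]
        · rintro rfl; exact hzD hd₀
        · rintro rfl; exact huD hd₀
        · rintro rfl; exact hwD hd₀
        · simp only [mem_filter, mem_univ, true_and]
          intro hx'
          by_cases hyD : y ∈ D
          · exact hnot y x hyD hxy.symm hx'
          · exact hxyD ⟨hx'.2.1, hyD⟩
        · simp only [mem_filter, mem_univ, true_and]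
          intro hy'
          by_cases hxD : x ∈ D
          · exact hnot x y hxD hxy hy'
          · exact hxyD ⟨hxD, hy'.2.1⟩
  obtain ⟨x, y, hxy⟩ := hne
  obtain ⟨z, K, hK⟩ := hbad x y hxy
  exact hmin _ x y z K rfl hK

end Separation

noncomputable section Insertion

variable {V : Type*} [Fintype V] {G A B H : SimpleGraph V}

theorem edge_apply_eq_zero_or {u v a b : V} (h : ¬ (a = u ∧ b = v)) (h' : ¬ (a = v ∧ b = u)) :
    edge u v a b = 0 := by
  by_contra hne
  rcases (edge_ne_zero hne).2 with h1 | h1 <;> contradiction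

theorem cycles_of_apply_eq_zero {u v : V} {Q : Chain V}
    (hQ : Q ∈ cycles (G ⊔ SimpleGraph.edge u v)) (h : Q u v = 0) : Q ∈ cycles G := by
  refine ⟨⟨hQ.1.1, fun a b hab => ?_⟩, hQ.2⟩
  by_contra hne
  have := adj_of_chains hQ.1 hne
  simp only [SimpleGraph.sup_adj, SimpleGraph.edge_adj, hab, false_or] at this
  rcases this.1 with ⟨rfl, rfl⟩ | ⟨rfl, rfl⟩
  · exact hne h
  · exact hne (by rw [hQ.1.1]; exact h)

/-- Adding a chord inside a face. -/
theorem MacLaneFace.addEdge {f : Chain V} (hf : MacLaneFace G f) {u v : V} (huv : u ≠ v)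
    (hG : ¬ G.Adj u v) {P : Chain V} (hP : P ∈ chains G) (hb : bd P = pt u + pt v)
    (hPf : ∀ a b, P a b ≠ 0 → f a b ≠ 0 ∨ ∀ Q ∈ cycles G, Q a b = 0) :
    MacLaneFace (G ⊔ SimpleGraph.edge u v) (f + P + edge u v) := by
  obtain ⟨ι, _, F, hF, i₀, rfl⟩ := hf
  have hadj : (G ⊔ SimpleGraph.edge u v).Adj u v := by simp [SimpleGraph.edge_adj, huv]
  have hle : cycles G ≤ cycles (G ⊔ SimpleGraph.edge u v) := cycles_mono le_sup_left
  have hPe : P + edge u v ∈ cycles (G ⊔ SimpleGraph.edge u v) := by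
    refine ⟨add_mem (chains_mono le_sup_left hP) (edge_mem_chains hadj), ?_⟩
    change bd _ = 0
    rw [map_add, hb, bd_edge]
    exact fun_add_self _
  let E : Option ι → Chain V := fun o =>
    o.elim (P + edge u v) (fun i => F i + if i = i₀ then P + edge u v else 0)
  refine ⟨Option ι, inferInstance, E, ⟨?_, ?_, ?_, ?_⟩, some i₀, by simp [E, add_assoc]⟩
  · rintro (_ | i)
    · exact hPe
    · refine add_mem (hle (hF.mem i)) ?_
      split_ifs
      · exact hPe
      · exact zero_mem _
  · rw [Fintype.sum_option]
    simp only [E, Option.elim_none, Option.elim_some, sum_add_distrib, hF.sum_eq_zero, zero_add,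
      sum_ite_eq', mem_univ, if_true]
    exact chain_add_self _
  · intro a b
    have two : #({none, some i₀} : Finset (Option ι)) ≤ 2 := card_le_two
    by_cases he : edge u v a b = 0
    · by_cases hPab : P a b = 0
      · refine le_trans ?_ (hF.card_le a b)
        rw [← card_map Function.Embedding.some (s := univ.filter fun i => F i a b ≠ 0)]
        refine card_le_card ?_
        rintro (_ | i)
        · simp [E, he, hPab]
        · by_cases hi : i = i₀ <;> simp [E, he, hPab, hi]
      · rcases hPf a b hPab with h | h
        · have hsub : (univ.filter fun o => E o a b ≠ 0) ⊆ insert none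
              (((univ.filter fun i => F i a b ≠ 0).erase i₀).map Function.Embedding.some) := by
            rintro (_ | i)
            · simp
            · by_cases hi : i = i₀
              · simp [E, he, hi, zmod_two_eq_one h, zmod_two_eq_one hPab]
                rfl
              · simp [E, hi]
          have h1 := card_le_card hsub
          have h2 := card_insert_le none
            (((univ.filter fun i => F i a b ≠ 0).erase i₀).map Function.Embedding.some)
          rw [card_map, card_erase_of_mem (by simp [h])] at h2
          have := hF.card_le a b
          omega
        · refine le_trans (card_le_card ?_) two
          rintro (_ | i)
          · simp
          · by_cases hi : i = i₀ <;> simp [E, h _ (hF.mem i), hi]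
    · refine le_trans (card_le_card ?_) two
      have hz : ∀ i, F i a b = 0 := by
        intro i
        rcases (edge_ne_zero he).2 with ⟨rfl, rfl⟩ | ⟨rfl, rfl⟩
        · exact (hF.mem i).1.2 _ _ hG
        · rw [(hF.mem i).1.1]
          exact (hF.mem i).1.2 _ _ hG
      rintro (_ | i)
      · simp
      · by_cases hi : i = i₀ <;> simp [E, hz, hi]
  · intro Q hQ
    have hQ' : Q + Q u v • (P + edge u v) ∈ cycles G := by
      refine cycles_of_apply_eq_zero (u := u) (v := v)
        (add_mem hQ (Submodule.smul_mem _ _ hPe)) ?_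
      simp only [Pi.add_apply, Pi.smul_apply, hP.2 u v hG, edge_apply_self huv, smul_eq_mul,
        zero_add, mul_one]
      exact zmod_two_add_self _
    obtain ⟨t, ht⟩ := hF.span _ hQ'
    refine ⟨fun o => o.elim (t i₀ + Q u v) t, ?_⟩
    rw [comb_eq_sum] at ht
    rw [comb_eq_sum, Fintype.sum_option]
    simp only [E, Option.elim_none, Option.elim_some, smul_add, sum_add_distrib, ht, smul_ite,
      smul_zero, sum_ite_eq', mem_univ, if_true]
    funext a b
    simp only [Pi.add_apply, Pi.smul_apply, smul_eq_mul]
    grind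

theorem MacLaneFace.addPendant {f : Chain V} (hf : MacLaneFace G f) {u v : V}
    (hu : ∀ w, ¬ G.Adj u w) : MacLaneFace (G ⊔ SimpleGraph.edge u v) f := by
  obtain ⟨ι, _, F, hF, i₀, rfl⟩ := hf
  refine ⟨ι, _, F, ⟨fun i => cycles_mono le_sup_left (hF.mem i), hF.sum_eq_zero, hF.card_le,
    fun Q hQ => hF.span Q (cycles_of_apply_eq_zero hQ ?_)⟩, i₀, rfl⟩
  have := sum_row_of_cycles hQ u
  rwa [sum_eq_single v] at this
  · intro w _ hw
    by_contra hne
    have h := adj_of_chains hQ.1 hne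
    simp only [SimpleGraph.sup_adj, SimpleGraph.edge_adj, hu, false_or] at h
    rcases h.1 with h1 | h1
    · exact hw h1.2
    · exact h.2 (h1.2.symm)
  · simp

/-- A closed sequence of `m` distinct vertices. -/
structure IsLoop (c : ℕ → V) (m : ℕ) : Prop where
  three_le : 3 ≤ m
  per : ∀ i, c (i + m) = c i
  inj : ∀ i j, i < m → j < m → c i = c j → i = j

/-- The chain of a segment of a sequence. -/
def arc (c : ℕ → V) (a b : ℕ) : Chain V := ∑ i ∈ Ico a b, edge (c i) (c (i + 1))

theorem arc_add (c : ℕ → V) {a b d : ℕ} (hab : a ≤ b) (hbd : b ≤ d) :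
    arc c a b + arc c b d = arc c a d :=
  sum_Ico_consecutive _ hab hbd

theorem arc_self (c : ℕ → V) (a : ℕ) : arc c a a = 0 := by simp [arc]

theorem arc_succ (c : ℕ → V) {a b : ℕ} (hab : a ≤ b) :
    arc c a (b + 1) = arc c a b + edge (c b) (c (b + 1)) := sum_Ico_succ_top hab _

theorem bd_arc (c : ℕ → V) {a b : ℕ} (hab : a ≤ b) : bd (arc c a b) = pt (c a) + pt (c b) := by
  induction b, hab using Nat.le_induction with
  | base => rw [arc_self, map_zero, pt_add_self]
  | succ b hab ih =>
    rw [arc_succ c hab, map_add, ih, bd_edge, add_assoc, ← add_assoc (pt (c b)), pt_add_self,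
      zero_add]

theorem arc_ne_zero {c : ℕ → V} {a b : ℕ} {x y : V} (h : arc c a b x y ≠ 0) :
    ∃ i, a ≤ i ∧ i < b ∧ edge (c i) (c (i + 1)) x y ≠ 0 := by
  unfold arc at h
  rw [Finset.sum_apply, Finset.sum_apply] at h
  obtain ⟨i, hi, h⟩ := exists_ne_zero_of_sum_ne_zero h
  rw [mem_Ico] at hi
  exact ⟨i, hi.1, hi.2, h⟩

theorem arc_mem_chains {c : ℕ → V} {a b : ℕ} (h : ∀ i, a ≤ i → i < b → G.Adj (c i) (c (i + 1))) :
    arc c a b ∈ chains G :=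
  sum_mem fun i hi => edge_mem_chains (h i (mem_Ico.1 hi).1 (mem_Ico.1 hi).2)

theorem arc_eq_zero_of_notMem {c : ℕ → V} {a b : ℕ} {x : V} (hx : ∀ i, a ≤ i → i ≤ b → c i ≠ x)
    (y : V) : arc c a b x y = 0 := by
  by_contra h
  obtain ⟨i, h1, h2, h3⟩ := arc_ne_zero h
  rcases (edge_ne_zero h3).2 with ⟨rfl, -⟩ | ⟨rfl, -⟩
  · exact hx i h1 h2.le rfl
  · exact hx (i + 1) (by omega) h2 rfl

namespace IsLoop

variable {c : ℕ → V} {m : ℕ}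

theorem mod (hc : IsLoop c m) (i : ℕ) : c (i % m) = c i := by
  have h : ∀ k j, c (j + m * k) = c j := by
    intro k
    induction k with
    | zero => simp
    | succ k ih =>
      intro j
      rw [Nat.mul_succ, ← add_assoc, hc.per, ih]
  conv_rhs => rw [← Nat.mod_add_div i m]
  exact (h _ _).symm

theorem eq_zero (hc : IsLoop c m) : c m = c 0 := by
  have := hc.per 0
  rwa [zero_add] at this

theorem rotate (hc : IsLoop c m) (k : ℕ) : IsLoop (fun i => c (i + k)) m where
  three_le := hc.three_le
  per i := by
    rw [add_right_comm, hc.per]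
  inj i j hi hj h := by
    change c (i + k) = c (j + k) at h
    rw [← hc.mod (i + k), ← hc.mod (j + k)] at h
    have hm : 0 < m := by omega
    have h2 := hc.inj _ _ (Nat.mod_lt _ hm) (Nat.mod_lt _ hm) h
    have h3 : i ≡ j [MOD m] := Nat.ModEq.add_right_cancel' k h2
    exact Nat.ModEq.eq_of_lt_of_lt h3 hi hj

theorem arc_rotate (hc : IsLoop c m) (k : ℕ) : arc (fun i => c (i + k)) 0 m = arc c 0 m := by
  have h1 : arc (fun i => c (i + k)) 0 m = arc c k (k + m) := by
    unfold arc
    rw [sum_Ico_eq_sum_range, sum_Ico_eq_sum_range]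
    simp only [Nat.sub_zero, zero_add, Nat.add_sub_cancel_left]
    refine sum_congr rfl fun i _ => ?_
    rw [add_comm k i, add_right_comm]
  rw [h1]
  clear h1
  induction k with
  | zero => simp
  | succ k ih =>
    have h1 := arc_add c (show k ≤ k + 1 by omega) (show k + 1 ≤ k + 1 + m by omega)
    have h2 := arc_add c (show k ≤ k + m by omega) (show k + m ≤ k + 1 + m by omega)
    have h3 : arc c (k + m) (k + 1 + m) = arc c k (k + 1) := by
      have e : k + 1 + m = k + m + 1 := by omega
      rw [e, arc_succ c le_rfl, arc_succ c le_rfl, arc_self, arc_self, hc.per,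
        show k + m + 1 = k + 1 + m by omega, hc.per]
    rw [h3, ih] at h2
    rw [← h2, add_comm] at h1
    exact add_right_cancel h1

theorem exists_index (hc : IsLoop c m) (i : ℕ) : ∃ j < m, c j = c i :=
  ⟨i % m, Nat.mod_lt _ (by have := hc.three_le; omega), hc.mod i⟩

theorem arc_apply (hc : IsLoop c m) {a b i : ℕ} (hb : b ≤ m) (hai : a ≤ i) (hib : i < b) :
    arc c a b (c i) (c (i + 1)) = 1 := by
  have h3 := hc.three_le
  have hnext : ∀ j < m, (j + 1 < m ∨ (j + 1 = m ∧ c (j + 1) = c 0)) := by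
    intro j hj
    rcases Nat.lt_or_ge (j + 1) m with h | h
    · exact Or.inl h
    · have : j + 1 = m := by omega
      exact Or.inr ⟨this, by rw [this, hc.eq_zero]⟩
  unfold arc
  rw [Finset.sum_apply, Finset.sum_apply, sum_eq_single i]
  · refine edge_apply_self fun h => ?_
    rcases hnext i (by omega) with h1 | ⟨h1, h2⟩
    · have := hc.inj _ _ (by omega) h1 h
      omega
    · rw [h2] at h
      have := hc.inj _ _ (by omega) (by omega) h
      omega
  · intro j hj hji
    rw [mem_Ico] at hj
    by_contra hne
    rcases (edge_ne_zero hne).2 with ⟨h1, -⟩ | ⟨h1, h2⟩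
    · exact hji (hc.inj _ _ (by omega) (by omega) h1).symm
    · rcases hnext j (by omega) with h4 | ⟨h4, h5⟩
      · have e1 := hc.inj _ _ (by omega) h4 h1
        rcases hnext i (by omega) with h6 | ⟨h6, h7⟩
        · have := hc.inj _ _ h6 (by omega) h2
          omega
        · rw [h7] at h2
          have := hc.inj _ _ (by omega) (by omega) h2
          omega
      · rw [h5] at h1
        have e1 := hc.inj _ _ (by omega) (by omega) h1
        rcases hnext i (by omega) with h6 | ⟨h6, h7⟩
        · have := hc.inj _ _ h6 (by omega) h2
          omega
        · omega
  · intro h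
    exact absurd (mem_Ico.2 ⟨hai, hib⟩) h

theorem arc_apply_of_edge (hc : IsLoop c m) {a b i : ℕ} (hb : b ≤ m) (hai : a ≤ i) (hib : i < b)
    {x y : V} (h : edge (c i) (c (i + 1)) x y ≠ 0) : arc c a b x y = 1 := by
  rcases (edge_ne_zero h).2 with ⟨rfl, rfl⟩ | ⟨rfl, rfl⟩
  · exact hc.arc_apply hb hai hib
  · rw [← hc.arc_apply hb hai hib]
    unfold arc
    rw [Finset.sum_apply, Finset.sum_apply, Finset.sum_apply, Finset.sum_apply]
    exact sum_congr rfl fun i _ => edge_symm _ _ _ _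

theorem adj (hc : IsLoop c m) (hf : arc c 0 m ∈ chains G) (i : ℕ) : G.Adj (c i) (c (i + 1)) := by
  have hm : 0 < m := by have := hc.three_le; omega
  have h1 : ∀ j < m, G.Adj (c j) (c (j + 1)) := by
    intro j hj
    refine adj_of_chains hf ?_
    rw [hc.arc_apply le_rfl (Nat.zero_le _) hj]
    exact one_ne_zero
  have h2 := h1 (i % m) (Nat.mod_lt _ hm)
  rw [hc.mod] at h2
  rw [← hc.mod (i % m + 1), Nat.mod_add_mod, hc.mod] at h2
  exact h2

end IsLoop

/-- The star with center `x` and leaves in `S`. -/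
def star (x : V) (S : Set V) : SimpleGraph V where
  Adj u v := u ≠ v ∧ ((u = x ∧ v ∈ S) ∨ (v = x ∧ u ∈ S))
  symm := ⟨fun _ _ h => ⟨h.1.symm, h.2.symm⟩⟩
  loopless := ⟨fun _ h => h.1 rfl⟩

theorem star_adj {x : V} {S : Set V} {u v : V} :
    (star x S).Adj u v ↔ u ≠ v ∧ ((u = x ∧ v ∈ S) ∨ (v = x ∧ u ∈ S)) := Iff.rfl

theorem star_insert {x w : V} {S : Set V} :
    star x (insert w S) = star x S ⊔ SimpleGraph.edge x w := by
  ext u v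
  simp only [star_adj, SimpleGraph.edge_adj, SimpleGraph.sup_adj, Set.mem_insert_iff]
  tauto

/-- Inserting a new vertex in a face bounded by a loop, sweeping along the loop. -/
theorem star_sweep {c : ℕ → V} {m : ℕ} (hc : IsLoop c m) {x : V} (hx : ∀ i, c i ≠ x)
    (hiso : ∀ w, ¬ G.Adj x w) (hf : MacLaneFace G (arc c 0 m)) {X : Set V} (hX : c 0 ∈ X)
    {j : ℕ} (hj : j < m) : ∃ l ≤ j, c l ∈ X ∧ (∀ i, l < i → i ≤ j → c i ∉ X) ∧
      MacLaneFace (G ⊔ star x {v | v ∈ X ∧ ∃ i ≤ j, c i = v})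
        (arc c l m + edge x (c 0) + edge x (c l)) := by
  have hadj := hc.adj hf.mem.1
  induction j with
  | zero =>
    refine ⟨0, le_rfl, hX, by intros; omega, ?_⟩
    rw [add_assoc, chain_add_self, add_zero]
    have : G ⊔ star x {v | v ∈ X ∧ ∃ i ≤ 0, c i = v} = G ⊔ SimpleGraph.edge x (c 0) := by
      congr 1
      ext u v
      simp only [star_adj, SimpleGraph.edge_adj, Set.mem_ofPred_eq]
      constructor
      · rintro ⟨h1, ⟨rfl, -, i, hi, rfl⟩ | ⟨rfl, -, i, hi, rfl⟩⟩
        · obtain rfl : i = 0 := by omega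
          simp [h1]
        · obtain rfl : i = 0 := by omega
          simp [h1]
      · rintro ⟨⟨rfl, rfl⟩ | ⟨rfl, rfl⟩, h1⟩
        · exact ⟨h1, Or.inl ⟨rfl, hX, 0, le_rfl, rfl⟩⟩
        · exact ⟨h1, Or.inr ⟨rfl, hX, 0, le_rfl, rfl⟩⟩
    rw [this]
    exact hf.addPendant hiso
  | succ j ih =>
    obtain ⟨l, hl, hlX, hlast, hface⟩ := ih (by omega)
    by_cases hjX : c (j + 1) ∈ X
    · refine ⟨j + 1, le_rfl, hjX, by intros; omega, ?_⟩
      have hgr : G ⊔ star x {v | v ∈ X ∧ ∃ i ≤ j + 1, c i = v} =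
          (G ⊔ star x {v | v ∈ X ∧ ∃ i ≤ j, c i = v}) ⊔ SimpleGraph.edge x (c (j + 1)) := by
        rw [sup_assoc]
        congr 1
        have hS : ∀ v, (∃ i ≤ j + 1, c i = v) ↔ (∃ i ≤ j, c i = v) ∨ v = c (j + 1) := by
          intro v
          constructor
          · rintro ⟨i, hi, rfl⟩
            rcases Nat.lt_or_ge i (j + 1) with h | h
            · exact Or.inl ⟨i, by omega, rfl⟩
            · obtain rfl : i = j + 1 := by omega
              exact Or.inr rfl
          · rintro (⟨i, hi, rfl⟩ | rfl)
            · exact ⟨i, by omega, rfl⟩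
            · exact ⟨j + 1, le_rfl, rfl⟩
        rw [← star_insert]
        congr 1
        ext v
        rw [Set.mem_insert_iff, Set.mem_ofPred_eq, Set.mem_ofPred_eq, hS]
        constructor
        · rintro ⟨h1, h2 | h2⟩
          · exact Or.inr ⟨h1, h2⟩
          · exact Or.inl h2
        · rintro (rfl | ⟨h1, h2⟩)
          · exact ⟨hjX, Or.inr rfl⟩
          · exact ⟨h1, Or.inl h2⟩
      have hxl : (star x {v | v ∈ X ∧ ∃ i ≤ j, c i = v}).Adj x (c l) :=
        ⟨(hx l).symm, Or.inl ⟨rfl, hlX, l, hl, rfl⟩⟩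
      have hPar : ∀ i, (G ⊔ star x {v | v ∈ X ∧ ∃ i ≤ j, c i = v}).Adj (c i) (c (i + 1)) :=
        fun i => Or.inl (hadj i)
      have hne : ∀ i, x ≠ c i := fun i => (hx i).symm
      have heq : arc c (j + 1) m + edge x (c 0) + edge x (c (j + 1)) =
          arc c l m + edge x (c 0) + edge x (c l) + (edge x (c l) + arc c l (j + 1)) +
            edge x (c (j + 1)) := by
        rw [← arc_add c (show l ≤ j + 1 by omega) hj.le]
        funext a b
        simp only [Pi.add_apply]
        grind
      rw [hgr, heq]
      refine hface.addEdge (u := x) (v := c (j + 1)) (P := edge x (c l) + arc c l (j + 1))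
        (hne _) ?_ (add_mem (edge_mem_chains (Or.inr hxl)) (arc_mem_chains fun i _ _ => hPar i))
        ?_ ?_
      · rintro (h | ⟨-, ⟨-, -, i, hi, h⟩ | ⟨h, -⟩⟩)
        · exact hiso _ h
        · have := hc.inj _ _ (by omega) hj h
          omega
        · exact hx _ h
      · rw [map_add, bd_edge, bd_arc c (by omega)]
        funext a
        simp only [Pi.add_apply]
        grind
      · intro a b hab
        by_cases h1 : edge x (c l) a b = 0
        · left
          rw [Pi.add_apply, Pi.add_apply, h1, zero_add] at hab
          obtain ⟨i, hi1, hi2, hi3⟩ := arc_ne_zero hab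
          have hax : a ≠ x := by
            rcases (edge_ne_zero hi3).2 with ⟨rfl, -⟩ | ⟨rfl, -⟩ <;> exact hx _
          have hbx : b ≠ x := by
            rcases (edge_ne_zero hi3).2 with ⟨-, rfl⟩ | ⟨-, rfl⟩ <;> exact hx _
          have h0 : edge x (c 0) a b = 0 := edge_apply_eq_zero_or (by tauto) (by tauto)
          simp only [Pi.add_apply, h1, h0, add_zero]
          rw [hc.arc_apply_of_edge le_rfl hi1 (by omega) hi3]
          exact one_ne_zero
        · by_cases hl0 : l = 0
          · right
            subst hl0
            have key : ∀ Q ∈ cycles (G ⊔ star x {v | v ∈ X ∧ ∃ i ≤ j, c i = v}),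
                Q x (c 0) = 0 := by
              intro Q hQ
              have := sum_row_of_cycles hQ x
              rwa [sum_eq_single (c 0)] at this
              · intro w _ hw
                by_contra hne'
                rcases adj_of_chains hQ.1 hne' with h | ⟨h2, ⟨-, h3, i, hi, rfl⟩ | ⟨h3, -⟩⟩
                · exact hiso _ h
                · have : i ≠ 0 := by rintro rfl; exact hw rfl
                  exact hlast i (by omega) hi h3
                · exact h2 h3.symm
              · simp
            intro Q hQ
            rcases (edge_ne_zero h1).2 with ⟨rfl, rfl⟩ | ⟨rfl, rfl⟩
            · exact key Q hQ
            · rw [hQ.1.1]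
              exact key Q hQ
          · left
            have h0l : c 0 ≠ c l := fun h => hl0 (hc.inj _ _ (by omega) (by omega) h).symm
            have hrow : ∀ y, arc c l m x y = 0 := arc_eq_zero_of_notMem fun i _ _ => hx i
            have key : (arc c l m + edge x (c 0) + edge x (c l)) x (c l) ≠ 0 := by
              simp only [Pi.add_apply, hrow, edge_apply_left (hne _), if_neg h0l.symm, if_true]
              decide
            rcases (edge_ne_zero h1).2 with ⟨rfl, rfl⟩ | ⟨rfl, rfl⟩
            · exact key
            · rw [hface.mem.1.1]
              exact key
    · refine ⟨l, by omega, hlX, ?_, ?_⟩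
      · intro i h1 h2
        rcases Nat.lt_or_ge i (j + 1) with h | h
        · exact hlast i h1 (by omega)
        · obtain rfl : i = j + 1 := by omega
          exact hjX
      · have : {v | v ∈ X ∧ ∃ i ≤ j + 1, c i = v} = {v | v ∈ X ∧ ∃ i ≤ j, c i = v} := by
          ext v
          constructor
          · rintro ⟨h, i, hi, rfl⟩
            refine ⟨h, i, ?_, rfl⟩
            rcases Nat.lt_or_ge i (j + 1) with h' | h'
            · omega
            · obtain rfl : i = j + 1 := by omega
              exact absurd h hjX
          · rintro ⟨h, i, hi, rfl⟩
            exact ⟨h, i, by omega, rfl⟩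
        rw [this]
        exact hface

end Insertion

noncomputable section Reinsertion

variable {V : Type*} [Fintype V] {G H : SimpleGraph V} {c : ℕ → V} {m : ℕ} {x y : V} {X Y : Set V}

theorem IsLoop.ne_of_lt (hc : IsLoop c m) {i j : ℕ} (h1 : i < j) (h2 : j < i + m) : c i ≠ c j := by
  intro h
  have hr := hc.rotate i
  have := hr.inj 0 (j - i) (by omega) (by omega)
    (by simpa [Nat.sub_add_cancel h1.le] using h)
  omega

theorem IsLoop.disjoint (hc : IsLoop c m) {a b a' b' : ℕ} (h1 : b < a') (h2 : b' < a + m) :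
    Disjoint (c '' Set.Icc a b) (c '' Set.Icc a' b') := by
  rw [Set.disjoint_left]
  rintro _ ⟨i, ⟨hi1, hi2⟩, rfl⟩ ⟨j, ⟨hj1, hj2⟩, h⟩
  exact hc.ne_of_lt (by omega : i < j) (by omega) h.symm

theorem disjoint_image_Icc (hx : ∀ i, c i ≠ x) (a b : ℕ) : Disjoint {x} (c '' Set.Icc a b) := by
  rw [Set.disjoint_singleton_left]
  rintro ⟨i, -, h⟩
  exact hx i h

/-- Two adjacent vertices whose neighbours alternate on a loop give a `K₃,₃` minor. -/
theorem IsLoop.not_isPlanar_of_cross (hc : IsLoop c m) (hG : ∀ i, G.Adj (c i) (c (i + 1)))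
    {u v : V} (hu : ∀ i, c i ≠ u) (hv : ∀ i, c i ≠ v) (huv : G.Adj u v) {q k p k' : ℕ}
    (h1 : q < k) (h2 : k < p) (h3 : p < k') (h4 : k' < q + m) (hq : G.Adj u (c q))
    (hp : G.Adj u (c p)) (hk : G.Adj v (c k)) (hk' : G.Adj v (c k')) : ¬ G.IsPlanar := by
  have hne : Disjoint ({u} : Set V) {v} := by simpa using huv.ne
  have e1 : ∀ i, ({c i} : Set V) = c '' Set.Icc i i := by simp
  have hmem : ∀ i a b, a ≤ i → i ≤ b → c i ∈ c '' Set.Icc a b :=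
    fun i a b h h' => ⟨i, ⟨h, h'⟩, rfl⟩
  refine not_isPlanar_of_three_three
    ![{u}, c '' Set.Icc (q + 1) (p - 1), c '' Set.Icc (p + 1) (q + m - 1)]
    ![{v}, c '' Set.Icc q q, c '' Set.Icc p p] ?_ ?_ ?_ ?_ ?_ ?_
  · intro i
    fin_cases i
    · exact connOn_singleton u
    · exact connOn_image_Icc (by omega) fun i _ _ => hG i
    · exact connOn_image_Icc (by omega) fun i _ _ => hG i
  · intro i
    fin_cases i
    · exact connOn_singleton v
    · exact connOn_image_Icc (by omega) fun i _ _ => hG i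
    · exact connOn_image_Icc (by omega) fun i _ _ => hG i
  · intro i j hij
    fin_cases i <;> fin_cases j <;> first | (exfalso; revert hij; decide) | skip
    · exact disjoint_image_Icc hu _ _
    · exact disjoint_image_Icc hu _ _
    · exact hc.disjoint (by omega) (by omega)
  · intro i j hij
    fin_cases i <;> fin_cases j <;> first | (exfalso; revert hij; decide) | skip
    · exact disjoint_image_Icc hv _ _
    · exact disjoint_image_Icc hv _ _
    · exact hc.disjoint (by omega) (by omega)
  · intro i j
    fin_cases i <;> fin_cases j
    · exact hne
    · exact disjoint_image_Icc hu _ _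
    · exact disjoint_image_Icc hu _ _
    · exact (disjoint_image_Icc hv _ _).symm
    · exact (hc.disjoint (by omega) (by omega)).symm
    · exact hc.disjoint (by omega) (by omega)
    · exact (disjoint_image_Icc hv _ _).symm
    · exact (hc.disjoint (by omega) (by omega)).symm
    · exact (hc.disjoint (by omega) (by omega)).symm
  · have hpm : c (q + m - 1 + 1) = c q := by
      rw [Nat.sub_add_cancel (by omega), hc.per]
    intro i j
    fin_cases i <;> fin_cases j
    · exact ⟨u, rfl, v, rfl, huv⟩
    · exact ⟨u, rfl, c q, hmem _ _ _ le_rfl le_rfl, hq⟩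
    · exact ⟨u, rfl, c p, hmem _ _ _ le_rfl le_rfl, hp⟩
    · exact ⟨c k, hmem _ _ _ (by omega) (by omega), v, rfl, hk.symm⟩
    · exact ⟨c (q + 1), hmem _ _ _ (by omega) (by omega), c q, hmem _ _ _ le_rfl le_rfl,
        (hG q).symm⟩
    · refine ⟨c (p - 1), hmem _ _ _ (by omega) (by omega), c p, hmem _ _ _ le_rfl le_rfl, ?_⟩
      have := hG (p - 1)
      rwa [Nat.sub_add_cancel (by omega)] at this
    · exact ⟨c k', hmem _ _ _ (by omega) (by omega), v, rfl, hk'.symm⟩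
    · refine ⟨c (q + m - 1), hmem _ _ _ (by omega) (by omega), c q, hmem _ _ _ le_rfl le_rfl, ?_⟩
      rw [← hpm]
      exact hG _
    · exact ⟨c (p + 1), hmem _ _ _ (by omega) (by omega), c p, hmem _ _ _ le_rfl le_rfl,
        (hG p).symm⟩

/-- Two adjacent vertices with three common neighbours on a loop give a `K₅` minor. -/
theorem IsLoop.not_isPlanar_of_common (hc : IsLoop c m) (hG : ∀ i, G.Adj (c i) (c (i + 1)))
    {u v : V} (hu : ∀ i, c i ≠ u) (hv : ∀ i, c i ≠ v) (huv : G.Adj u v) {k k' : ℕ}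
    (h1 : 0 < k) (h2 : k < k') (h3 : k' < m)
    (h : ∀ i, i = 0 ∨ i = k ∨ i = k' → G.Adj u (c i) ∧ G.Adj v (c i)) : ¬ G.IsPlanar := by
  have hne : Disjoint ({u} : Set V) {v} := by simpa using huv.ne
  have hmem : ∀ i a b, a ≤ i → i ≤ b → c i ∈ c '' Set.Icc a b :=
    fun i a b h h' => ⟨i, ⟨h, h'⟩, rfl⟩
  have hstep : ∀ i, 0 < i → G.Adj (c (i - 1)) (c i) := by
    intro i hi
    have := hG (i - 1)
    rwa [Nat.sub_add_cancel hi] at this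
  refine not_isPlanar_of_five ![{u}, {v}, c '' Set.Icc 0 (k - 1), c '' Set.Icc k (k' - 1),
    c '' Set.Icc k' (m - 1)] ?_ ?_ ?_
  · intro i
    fin_cases i
    · exact connOn_singleton u
    · exact connOn_singleton v
    · exact connOn_image_Icc (by omega) fun i _ _ => hG i
    · exact connOn_image_Icc (by omega) fun i _ _ => hG i
    · exact connOn_image_Icc (by omega) fun i _ _ => hG i
  · intro i j hij
    fin_cases i <;> fin_cases j <;> first | (exfalso; revert hij; decide) | skip
    · exact hne
    · exact disjoint_image_Icc hu _ _
    · exact disjoint_image_Icc hu _ _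
    · exact disjoint_image_Icc hu _ _
    · exact disjoint_image_Icc hv _ _
    · exact disjoint_image_Icc hv _ _
    · exact disjoint_image_Icc hv _ _
    · exact hc.disjoint (by omega) (by omega)
    · exact hc.disjoint (by omega) (by omega)
    · exact hc.disjoint (by omega) (by omega)
  · intro i j hij
    fin_cases i <;> fin_cases j <;> first | (exfalso; revert hij; decide) | skip
    · exact ⟨u, rfl, v, rfl, huv⟩
    · exact ⟨u, rfl, c 0, hmem _ _ _ le_rfl (by omega), (h _ (by omega)).1⟩
    · exact ⟨u, rfl, c k, hmem _ _ _ le_rfl (by omega), (h _ (by omega)).1⟩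
    · exact ⟨u, rfl, c k', hmem _ _ _ le_rfl (by omega), (h _ (by omega)).1⟩
    · exact ⟨v, rfl, c 0, hmem _ _ _ le_rfl (by omega), (h _ (by omega)).2⟩
    · exact ⟨v, rfl, c k, hmem _ _ _ le_rfl (by omega), (h _ (by omega)).2⟩
    · exact ⟨v, rfl, c k', hmem _ _ _ le_rfl (by omega), (h _ (by omega)).2⟩
    · exact ⟨c (k - 1), hmem _ _ _ (by omega) le_rfl, c k, hmem _ _ _ le_rfl (by omega),
        hstep k h1⟩
    · refine ⟨c 0, hmem _ _ _ (by omega) (by omega), c (m - 1), hmem _ _ _ (by omega) le_rfl, ?_⟩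
      rw [← hc.eq_zero]
      exact (hstep m (by omega)).symm
    · exact ⟨c (k' - 1), hmem _ _ _ (by omega) le_rfl, c k', hmem _ _ _ le_rfl (by omega),
        hstep k' (by omega)⟩

/-- Inserting `x` and then `y` in a face, when all neighbours of `y` lie between two consecutive
neighbours of `x`. -/
theorem macLane_of_sector (hc : IsLoop c m) (hf : MacLaneFace H (arc c 0 m)) (hxy : x ≠ y)
    (hx : ∀ i, c i ≠ x) (hy : ∀ i, c i ≠ y) (hxH : ∀ w, ¬ H.Adj x w) (hyH : ∀ w, ¬ H.Adj y w)
    (hX : ∀ v ∈ X, ∃ i < m, c i = v) {l : ℕ} (h0 : 0 < l) (hl : l < m) (hX0 : c 0 ∈ X)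
    (hXl : c l ∈ X) (hlast : ∀ i, l < i → i < m → c i ∉ X)
    (hY : ∀ v ∈ Y, ∃ i, l ≤ i ∧ i ≤ m ∧ c i = v) :
    MacLane (H ⊔ star x X ⊔ star y (insert x Y)) := by
  obtain ⟨l', hl', hl'X, hl'last, hface⟩ :=
    star_sweep hc hx hxH hf hX0 (j := m - 1) (by omega)
  obtain rfl : l' = l := by
    by_contra hne
    rcases lt_or_gt_of_ne hne with h | h
    · exact hl'last l h (by omega) hXl
    · exact hlast l' h (by omega) hl'X
  have hXe : {v | v ∈ X ∧ ∃ i ≤ m - 1, c i = v} = X := by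
    ext v
    constructor
    · exact fun h => h.1
    · intro h
      obtain ⟨i, hi, rfl⟩ := hX v h
      exact ⟨h, i, by omega, rfl⟩
  rw [hXe] at hface
  set n := m - l' + 2 with hn
  let d : ℕ → V := fun i => if i % n = 0 then x else c (l' + i % n - 1)
  have hd : IsLoop d n := by
    refine ⟨by omega, fun i => by simp [d], ?_⟩
    intro i j hi hj hij
    simp only [d, Nat.mod_eq_of_lt hi, Nat.mod_eq_of_lt hj] at hij
    split_ifs at hij with h1 h2 h2
    · omega
    · exact absurd hij.symm (hx _)
    · exact absurd hij (hx _)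
    · by_contra hne
      rcases lt_or_gt_of_ne hne with h | h
      · exact hc.ne_of_lt (show l' + i - 1 < l' + j - 1 by omega) (by omega) hij
      · exact hc.ne_of_lt (show l' + j - 1 < l' + i - 1 by omega) (by omega) hij.symm
  have hd0 : d 0 = x := by simp [d]
  have hdi : ∀ i, l' ≤ i → i ≤ m → d (i - l' + 1) = c i := by
    intro i h1 h2
    have h3 : (i - l' + 1) % n = i - l' + 1 := Nat.mod_eq_of_lt (by omega)
    simp only [d, h3]
    rw [if_neg (by omega)]
    congr 1
    omega
  have hdc : ∀ i, d i = x ∨ ∃ j, d i = c j := by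
    intro i
    by_cases h : i % n = 0
    · exact Or.inl (by simp [d, h])
    · exact Or.inr ⟨l' + i % n - 1, by simp [d, h]⟩
  have harc : arc d 0 n = arc c l' m + edge x (c 0) + edge x (c l') := by
    have h1 : arc d 1 (n - 1) = arc c l' m := by
      unfold arc
      rw [sum_Ico_eq_sum_range, sum_Ico_eq_sum_range]
      rw [show n - 1 - 1 = m - l' by omega]
      refine sum_congr rfl fun i hi => ?_
      rw [mem_range] at hi
      rw [← hdi (l' + i) (by omega) (by omega), ← hdi (l' + i + 1) (by omega) (by omega)]
      congr 2 <;> omega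
    have h2 : arc d 0 1 = edge x (c l') := by
      rw [arc_succ d le_rfl, arc_self, zero_add, hd0, ← hdi l' le_rfl hl.le]
      simp
    have h3 : arc d (n - 1) n = edge x (c 0) := by
      have : n = n - 1 + 1 := by omega
      conv_lhs => rw [this]
      rw [Nat.add_sub_cancel, arc_succ d le_rfl, arc_self, zero_add, ← this, hd.eq_zero, hd0,
        ← hc.eq_zero, ← hdi m hl.le le_rfl, show m - l' + 1 = n - 1 by omega, edge_comm]
    rw [← arc_add d (show 0 ≤ n - 1 by omega) (show n - 1 ≤ n by omega),
      ← arc_add d (show 0 ≤ 1 by omega) (show 1 ≤ n - 1 by omega), h1, h2, h3]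
    abel
  rw [← harc] at hface
  have hdy : ∀ i, d i ≠ y := by
    intro i
    rcases hdc i with h | ⟨j, h⟩
    · rw [h]
      exact hxy
    · rw [h]
      exact hy j
  have hyS : ∀ w, ¬ (H ⊔ star x X).Adj y w := by
    rintro w (h | ⟨-, ⟨h, -⟩ | ⟨-, h⟩⟩)
    · exact hyH w h
    · exact hxy h.symm
    · obtain ⟨i, -, h⟩ := hX y h
      exact hy i h
  obtain ⟨l, -, -, -, hfin⟩ := star_sweep hd hdy hyS hface (X := insert x Y)
    (by rw [hd0]; exact Set.mem_insert _ _) (j := n - 1) (by omega)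
  have hYe : {v | v ∈ insert x Y ∧ ∃ i ≤ n - 1, d i = v} = insert x Y := by
    ext v
    constructor
    · exact fun h => h.1
    · intro h
      refine ⟨h, ?_⟩
      rcases h with rfl | h
      · exact ⟨0, by omega, hd0⟩
      · obtain ⟨i, h1, h2, rfl⟩ := hY v h
        exact ⟨i - l' + 1, by omega, hdi i h1 h2⟩
  rw [hYe] at hfin
  exact hfin.macLane

theorem IsLoop.exists_rotate (hc : IsLoop c m) (k : ℕ) {v : V} (h : ∃ i < m, c i = v) :
    ∃ i < m, c (i + k) = v := by
  obtain ⟨i, -, rfl⟩ := h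
  obtain ⟨j, hj, h⟩ := (hc.rotate k).exists_index (i + m * k - k)
  refine ⟨j, hj, h.trans ?_⟩
  have h3 : k ≤ m * k := Nat.le_mul_of_pos_left k (by have := hc.three_le; omega)
  change c (i + m * k - k + k) = c i
  rw [Nat.sub_add_cancel (by omega), ← hc.mod, Nat.add_mul_mod_self_left, hc.mod]

theorem macLane_of_loop_of_notMem (hc : IsLoop c m) (hf : MacLaneFace H (arc c 0 m)) (hxy : x ≠ y)
    (hx : ∀ i, c i ≠ x) (hy : ∀ i, c i ≠ y) (hxH : ∀ w, ¬ H.Adj x w) (hyH : ∀ w, ¬ H.Adj y w)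
    (hX : ∀ v ∈ X, ∃ i < m, c i = v) (hY : ∀ v ∈ Y, ∃ i < m, c i = v)
    (hX2 : ∃ a ∈ X, ∃ b ∈ X, a ≠ b) (h0Y : c 0 ∈ Y) (h0X : c 0 ∉ X)
    (hpl : (H ⊔ star x X ⊔ star y (insert x Y)).IsPlanar) :
    MacLane (H ⊔ star x X ⊔ star y (insert x Y)) := by
  have hadj := hc.adj hf.mem.1
  have hex : ∃ i, c i ∈ X := by
    obtain ⟨a, ha, -⟩ := hX2
    obtain ⟨i, -, rfl⟩ := hX a ha
    exact ⟨i, ha⟩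
  obtain ⟨q, hq, hqmin⟩ : ∃ q, c q ∈ X ∧ ∀ i < q, c i ∉ X :=
    ⟨Nat.find hex, Nat.find_spec hex, fun i hi => Nat.find_min hex hi⟩
  have hbound : ∀ a b, a ∈ X → b ∈ X → a ≠ b → ∃ i, q < i ∧ i < m ∧ c i ∈ X := by
    intro a b ha hb hab
    obtain ⟨i, hi, rfl⟩ := hX a ha
    obtain ⟨j, hj, rfl⟩ := hX b hb
    have h1 : q ≤ i := by
      by_contra h
      exact hqmin i (by omega) ha
    have h2 : q ≤ j := by
      by_contra h
      exact hqmin j (by omega) hb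
    rcases Nat.lt_or_ge q i with h3 | h3
    · exact ⟨i, h3, hi, ha⟩
    · refine ⟨j, lt_of_le_of_ne h2 fun h => hab ?_, hj, hb⟩
      rw [← h, show i = q by omega]
  obtain ⟨a, ha, b, hb, hab⟩ := hX2
  obtain ⟨i, hqi, him, hi⟩ := hbound a b ha hb hab
  obtain ⟨p, hqp, hpm, hp, hpmax⟩ : ∃ p, q < p ∧ p < m ∧ c p ∈ X ∧ ∀ i, p < i → i < m → c i ∉ X := by
    have h1 := Nat.le_findGreatest (P := fun i => c i ∈ X) (show i ≤ m - 1 by omega) hi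
    have h2 := Nat.findGreatest_le (P := fun i => c i ∈ X) (m - 1)
    refine ⟨Nat.findGreatest (fun i => c i ∈ X) (m - 1), by omega, by omega,
      Nat.findGreatest_spec (P := fun i => c i ∈ X) (show i ≤ m - 1 by omega) hi, ?_⟩
    intro j hj hjm
    exact Nat.findGreatest_is_greatest hj (by omega)
  have hq0 : 0 < q := by
    rcases Nat.eq_zero_or_pos q with rfl | h
    · exact absurd hq h0X
    · exact h
  by_cases hk : ∃ k, q < k ∧ k < p ∧ c k ∈ Y
  · obtain ⟨k, hk1, hk2, hk⟩ := hk
    refine absurd hpl (hc.not_isPlanar_of_cross (u := x) (v := y) (q := q) (k := k) (p := p) (k' := m)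
      (fun i => Or.inl (Or.inl (hadj i))) hx hy ?_ hk1 hk2 hpm (by omega) ?_ ?_ ?_ ?_)
    · exact Or.inr ⟨hxy, Or.inr ⟨rfl, Set.mem_insert _ _⟩⟩
    · exact Or.inl (Or.inr ⟨(hx _).symm, Or.inl ⟨rfl, hq⟩⟩)
    · exact Or.inl (Or.inr ⟨(hx _).symm, Or.inl ⟨rfl, hp⟩⟩)
    · exact Or.inr ⟨(hy _).symm, Or.inl ⟨rfl, Set.mem_insert_of_mem _ hk⟩⟩
    · refine Or.inr ⟨(hy _).symm, Or.inl ⟨rfl, Set.mem_insert_of_mem _ ?_⟩⟩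
      rwa [hc.eq_zero]
  · push Not at hk
    refine macLane_of_sector (hc.rotate q) (by rwa [hc.arc_rotate]) hxy (fun _ => hx _)
      (fun _ => hy _) hxH hyH ?_ (l := p - q) (by omega) (by omega) ?_ ?_ ?_ ?_
    · exact fun v hv => hc.exists_rotate q (hX v hv)
    · simpa using hq
    · simpa [Nat.sub_add_cancel hqp.le] using hp
    · intro i h1 h2
      rcases Nat.lt_or_ge (i + q) m with h | h
      · exact hpmax _ (by omega) h
      · have h3 := hc.per (i + q - m)
        rw [Nat.sub_add_cancel h] at h3
        rw [h3]
        exact hqmin _ (by omega)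
    · intro v hv
      obtain ⟨i, him, rfl⟩ := hY v hv
      have h1 : i ≤ q ∨ p ≤ i := by
        by_contra! h
        exact hk i h.1 h.2 hv
      rcases h1 with h1 | h1
      · refine ⟨i + m - q, by omega, by omega, ?_⟩
        rw [Nat.sub_add_cancel (by omega), hc.per]
      · refine ⟨i - q, by omega, by omega, ?_⟩
        rw [Nat.sub_add_cancel (by omega)]

theorem macLane_of_loop_of_subset (hc : IsLoop c m) (hf : MacLaneFace H (arc c 0 m)) (hxy : x ≠ y)
    (hx : ∀ i, c i ≠ x) (hy : ∀ i, c i ≠ y) (hxH : ∀ w, ¬ H.Adj x w) (hyH : ∀ w, ¬ H.Adj y w)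
    (hX : ∀ v ∈ X, ∃ i < m, c i = v) (hYX : Y ⊆ X)
    (hY2 : ∃ b ∈ Y, b ≠ c 0) (h0Y : c 0 ∈ Y)
    (hpl : (H ⊔ star x X ⊔ star y (insert x Y)).IsPlanar) :
    MacLane (H ⊔ star x X ⊔ star y (insert x Y)) := by
  have hadj := hc.adj hf.mem.1
  have gx : ∀ v ∈ X, (∃ i, c i = v) → (H ⊔ star x X ⊔ star y (insert x Y)).Adj x v := by
    rintro _ hv ⟨i, rfl⟩
    exact Or.inl (Or.inr ⟨(hx _).symm, Or.inl ⟨rfl, hv⟩⟩)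
  have gy : ∀ v ∈ Y, (∃ i, c i = v) → (H ⊔ star x X ⊔ star y (insert x Y)).Adj y v := by
    rintro _ hv ⟨i, rfl⟩
    exact Or.inr ⟨(hy _).symm, Or.inl ⟨rfl, Set.mem_insert_of_mem _ hv⟩⟩
  have gxy : (H ⊔ star x X ⊔ star y (insert x Y)).Adj x y :=
    Or.inr ⟨hxy, Or.inr ⟨rfl, Set.mem_insert _ _⟩⟩
  obtain ⟨b, hb, hb0⟩ := hY2
  obtain ⟨k, hkm, rfl⟩ := hX b (hYX hb)
  have hk0 : 0 < k := by
    rcases Nat.eq_zero_or_pos k with rfl | h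
    · exact absurd rfl hb0
    · exact h
  by_cases h3 : ∃ k', 0 < k' ∧ k' < m ∧ k' ≠ k ∧ c k' ∈ Y
  · obtain ⟨k', h1, h2, h3, h4⟩ := h3
    have key : ∀ i, c i ∈ Y → (H ⊔ star x X ⊔ star y (insert x Y)).Adj x (c i) ∧
        (H ⊔ star x X ⊔ star y (insert x Y)).Adj y (c i) :=
      fun i hi => ⟨gx _ (hYX hi) ⟨i, rfl⟩, gy _ hi ⟨i, rfl⟩⟩
    rcases lt_or_gt_of_ne h3 with h | h
    · refine absurd hpl (hc.not_isPlanar_of_common (fun i => Or.inl (Or.inl (hadj i))) hx hy gxy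
        h1 h hkm ?_)
      rintro i (rfl | rfl | rfl)
      exacts [key _ h0Y, key _ h4, key _ hb]
    · refine absurd hpl (hc.not_isPlanar_of_common (fun i => Or.inl (Or.inl (hadj i))) hx hy gxy
        hk0 h h2 ?_)
      rintro i (rfl | rfl | rfl)
      exacts [key _ h0Y, key _ hb, key _ h4]
  · push Not at h3
    have hYe : ∀ v ∈ Y, v = c 0 ∨ v = c k := by
      intro v hv
      obtain ⟨i, hi, rfl⟩ := hX v (hYX hv)
      rcases Nat.eq_zero_or_pos i with rfl | h
      · exact Or.inl rfl
      · by_cases hik : i = k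
        · exact Or.inr (by rw [hik])
        · exact absurd hv (h3 i h hi hik)
    by_cases hA : ∃ i, 0 < i ∧ i < k ∧ c i ∈ X
    · by_cases hB : ∃ i, k < i ∧ i < m ∧ c i ∈ X
      · obtain ⟨a, a1, a2, a3⟩ := hA
        obtain ⟨b, b1, b2, b3⟩ := hB
        exact absurd hpl (hc.not_isPlanar_of_cross (u := y) (v := x) (q := 0) (k := a) (p := k)
          (k' := b) (fun i => Or.inl (Or.inl (hadj i))) hy hx gxy.symm a1 a2 b1 (by omega)
          (gy _ h0Y ⟨0, rfl⟩) (gy _ hb ⟨k, rfl⟩) (gx _ a3 ⟨a, rfl⟩) (gx _ b3 ⟨b, rfl⟩))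
      · push Not at hB
        refine macLane_of_sector hc hf hxy hx hy hxH hyH hX (l := k) hk0 hkm (hYX h0Y) (hYX hb) hB ?_
        intro v hv
        rcases hYe v hv with rfl | rfl
        · exact ⟨m, hkm.le, le_rfl, hc.eq_zero⟩
        · exact ⟨k, le_rfl, hkm.le, rfl⟩
    · push Not at hA
      have e1 : c (m - k + k) = c 0 := by rw [Nat.sub_add_cancel hkm.le, hc.eq_zero]
      have e2 : c (m + k) = c k := by rw [add_comm, hc.per]
      refine macLane_of_sector (hc.rotate k) (by rwa [hc.arc_rotate]) hxy (fun _ => hx _)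
        (fun _ => hy _) hxH hyH ?_ (l := m - k) (by omega) (by omega) ?_ ?_ ?_ ?_
      · exact fun v hv => hc.exists_rotate k (hX v hv)
      · simpa using hYX hb
      · exact e1 ▸ hYX h0Y
      · intro i h1 h2
        have h3 := hc.per (i + k - m)
        rw [Nat.sub_add_cancel (by omega)] at h3
        rw [h3]
        exact hA _ (by omega) (by omega)
      · intro v hv
        rcases hYe v hv with rfl | rfl
        · exact ⟨m - k, le_rfl, by omega, e1⟩
        · exact ⟨m, by omega, le_rfl, e2⟩

/-- Reinserting two adjacent vertices in a face of a planar graph. -/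
theorem macLane_of_loop (hc : IsLoop c m) (hf : MacLaneFace H (arc c 0 m)) (hxy : x ≠ y)
    (hx : ∀ i, c i ≠ x) (hy : ∀ i, c i ≠ y) (hxH : ∀ w, ¬ H.Adj x w) (hyH : ∀ w, ¬ H.Adj y w)
    (hX : ∀ v ∈ X, ∃ i < m, c i = v) (hY : ∀ v ∈ Y, ∃ i < m, c i = v)
    (hX2 : ∃ a ∈ X, ∃ b ∈ X, a ≠ b) (hY2 : ∃ a ∈ Y, ∃ b ∈ Y, a ≠ b)
    (hpl : (H ⊔ star x X ⊔ star y (insert x Y)).IsPlanar) :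
    MacLane (H ⊔ star x X ⊔ star y (insert x Y)) := by
  by_cases h : ∃ k, c k ∈ Y ∧ c k ∉ X
  · obtain ⟨k, hk1, hk2⟩ := h
    exact macLane_of_loop_of_notMem (hc.rotate k) (by rwa [hc.arc_rotate]) hxy (fun _ => hx _)
      (fun _ => hy _) hxH hyH (fun v hv => hc.exists_rotate k (hX v hv))
      (fun v hv => hc.exists_rotate k (hY v hv)) hX2 (by simpa using hk1) (by simpa using hk2) hpl
  · push Not at h
    obtain ⟨a, ha, b, hb, hab⟩ := hY2
    obtain ⟨k, -, rfl⟩ := hY a ha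
    refine macLane_of_loop_of_subset (hc.rotate k) (by rwa [hc.arc_rotate]) hxy (fun _ => hx _)
      (fun _ => hy _) hxH hyH (fun v hv => hc.exists_rotate k (hX v hv)) ?_ ⟨b, hb, ?_⟩
      (by simpa using ha) hpl
    · intro v hv
      obtain ⟨i, -, rfl⟩ := hY v hv
      exact h i hv
    · simpa using hab.symm

end Reinsertion

noncomputable section Circuit

variable {V : Type*} [Fintype V] {G H : SimpleGraph V}

/-- The graph with the vertices in `S` isolated. -/
def del (G : SimpleGraph V) (S : Set V) : SimpleGraph V where
  Adj u v := G.Adj u v ∧ u ∉ S ∧ v ∉ S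
  symm := ⟨fun _ _ h => ⟨h.1.symm, h.2.2, h.2.1⟩⟩
  loopless := ⟨fun _ h => h.1.ne rfl⟩

theorem del_adj {S : Set V} {u v : V} : (del G S).Adj u v ↔ G.Adj u v ∧ u ∉ S ∧ v ∉ S := Iff.rfl

theorem del_le {S : Set V} : del G S ≤ G := fun _ _ h => h.1

/-- Any two edges at `p` in `G` lie on a cycle with no further edges at `p`. -/
def CycleThrough (G : SimpleGraph V) (p : V) : Prop :=
  ∀ a b, G.Adj p a → G.Adj p b → a ≠ b →
    ∃ Q ∈ cycles G, Q p a ≠ 0 ∧ Q p b ≠ 0 ∧ ∀ w, Q p w ≠ 0 → w = a ∨ w = b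

theorem cycleThrough_of_forall {p : V} (h : ∀ a b, G.Adj p a → G.Adj p b → ∀ K : Set V, p ∉ K →
    a ∈ K → (∀ u ∈ K, ∀ v, G.Adj u v → v ∈ K ∨ v = p) → b ∈ K) : CycleThrough G p := by
  intro a b ha hb hab
  have hr : (del G {p}).Reachable a b := by
    refine h a b ha hb {w | (del G {p}).Reachable a w} ?_ (SimpleGraph.Reachable.refl _) ?_
    · intro hp
      have := mem_of_reachable (G := del G {p}) (K := {w | w ≠ p}) (fun u _ v huv => huv.2.2) hp ha.ne'
      exact this rfl
    · intro u hu v huv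
      by_cases hvp : v = p
      · exact Or.inr hvp
      · left
        by_cases hup : u = p
        · subst hup
          exact absurd rfl (mem_of_reachable (G := del G {u}) (K := {w | w ≠ u})
            (fun u _ v huv => huv.2.2) hu ha.ne')
        · exact SimpleGraph.Reachable.trans hu (SimpleGraph.Adj.reachable ⟨huv, hup, hvp⟩)
  obtain ⟨f, hf, hb'⟩ := exists_chain_of_reachable hr
  have hfp : ∀ w, f p w = 0 := by
    intro w
    by_contra hne
    exact (adj_of_chains hf hne).2.1 rfl
  refine ⟨f + edge p a + edge p b, ⟨add_mem (add_mem (chains_mono del_le hf) (edge_mem_chains ha))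
    (edge_mem_chains hb), ?_⟩, ?_, ?_, ?_⟩
  · change bd _ = 0
    rw [map_add, map_add, hb', bd_edge, bd_edge]
    funext v
    simp only [Pi.add_apply, Pi.zero_apply]
    grind
  · simp [hfp, edge_apply_left ha.ne, edge_apply_left hb.ne, hab]
  · simp [hfp, edge_apply_left ha.ne, edge_apply_left hb.ne, hab.symm]
  · intro w hw
    simp only [Pi.add_apply, hfp, edge_apply_left ha.ne, edge_apply_left hb.ne, zero_add] at hw
    by_contra hcon
    push Not at hcon
    simp [hcon.1, hcon.2] at hw

/-- A nonzero cycle supported on a face boundary of a 2-connected graph is the whole boundary. -/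
theorem IsPlaneFamily.eq_of_support_subset {ι : Type} [Fintype ι] {F : ι → Chain V}
    (hF : IsPlaneFamily H F) (hcyc : ∀ p, CycleThrough H p)
    (hdeg : ∀ p a, H.Adj p a → ∃ b, H.Adj p b ∧ a ≠ b)
    (hconn : ∀ K : Set V, (∃ k ∈ K, ∃ w, H.Adj k w) → (∀ u ∈ K, ∀ v, H.Adj u v → v ∈ K) →
      ∀ v w, H.Adj v w → v ∈ K)
    {S : Chain V} (hS : S ∈ cycles H) {a₀ b₀ : V} (hne : S a₀ b₀ ≠ 0) {i₀ : ι}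
    (hsub : ∀ a b, S a b ≠ 0 → F i₀ a b ≠ 0) : S = F i₀ := by
  obtain ⟨t, ht0, rfl⟩ := hF.span_avoid i₀ hS
  have hface : ∀ p a, H.Adj p a → ∃ i, F i p a ≠ 0 := by
    intro p a ha
    obtain ⟨b, hb, hab⟩ := hdeg p a ha
    obtain ⟨Q, hQ, hQa, -⟩ := hcyc p a b ha hb hab
    exact hF.exists_face hQ hQa
  let good : V → V → Prop := fun p a => comb F t p a ≠ 0 ∨ ∃ i, F i p a ≠ 0 ∧ t i ≠ 0
  have good_symm : ∀ p a, good p a → good a p := by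
    rintro p a (h | ⟨i, h1, h2⟩)
    · left
      rwa [chains_symm hS.1]
    · right
      refine ⟨i, ?_, h2⟩
      rwa [chains_symm (hF.mem i).1]
  have hprop : ∀ p a b, H.Adj p a → H.Adj p b → good p a → good p b := by
    intro p a b ha hb hga
    by_contra hgb
    have hab : a ≠ b := by
      rintro rfl
      exact hgb hga
    simp only [good] at hgb
    push Not at hgb
    obtain ⟨hSb, htb⟩ := hgb
    obtain ⟨j, hj⟩ := hface p b hb
    by_cases hp : ∀ w, comb F t p w = 0
    · rcases hga with h | ⟨i, h1, h2⟩
      · exact h (hp a)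
      · obtain ⟨Q, hQ, hQa, hQb, hQ'⟩ := hcyc p a b ha hb hab
        have := hF.transfer hp hQ hQ' hQa h1 hj hQb
        exact h2 (this.trans (htb j hj))
    · push Not at hp
      obtain ⟨c, hc⟩ := hp
      have hcb : c ≠ b := by
        rintro rfl
        exact hc hSb
      obtain ⟨Q, hQ, hQc, hQb, hQ'⟩ := hcyc p c b (adj_of_chains hS.1 hc) hb hcb
      obtain ⟨r, hr0, rfl⟩ := hF.span_avoid i₀ hQ
      have hSval : ∀ w, comb F t p w ≠ 0 → comb F (t * r) p w = comb F r p w := by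
        intro w hw
        have h0 := hsub _ _ hw
        obtain ⟨k, hk, hkw⟩ := hF.exists_ne h0
        have e1 := hF.comb_apply hk.symm h0 hkw t
        rw [hF.comb_apply hk.symm h0 hkw, hF.comb_apply hk.symm h0 hkw, Pi.mul_apply, Pi.mul_apply,
          ht0, hr0]
        rw [ht0, zero_add] at e1
        rw [← e1, zmod_two_eq_one hw]
        ring
      have hsum := sum_row_of_cycles (comb_mem hF.mem (t * r)) p
      rw [sum_eq_single c] at hsum
      · rw [hSval c hc] at hsum
        exact hQc hsum
      · intro w _ hwc
        by_cases hw : comb F t p w = 0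
        · by_cases hwb : w = b
          · subst hwb
            rw [hF.comb_mul_of_eq hw hj, htb j hj, zero_mul]
          · refine hF.comb_mul_eq_zero hw ?_
            by_contra hne'
            rcases hQ' w hne' with h | h
            · exact hwc h
            · exact hwb h
        · rw [hSval w hw]
          by_contra hne'
          rcases hQ' w hne' with h | h
          · exact hwc h
          · exact hw (h ▸ hSb)
      · simp
  have hall : ∀ v w, H.Adj v w → good v w := by
    intro v w hvw
    refine hconn {v | ∀ w, H.Adj v w → good v w} ⟨a₀, ?_, b₀, adj_of_chains hS.1 hne⟩ ?_ v w hvw w hvw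
    · intro w hw
      exact hprop a₀ b₀ w (adj_of_chains hS.1 hne) hw (Or.inl hne)
    · intro u hu v huv w hvw
      exact hprop v u w huv.symm hvw (good_symm _ _ (hu v huv))
  funext a b
  by_cases h : F i₀ a b = 0
  · rw [h]
    by_contra hne'
    exact hsub _ _ hne' h
  · have hS1 : comb F t a b ≠ 0 := by
      intro h0
      rcases hall a b (adj_of_chains (hF.mem i₀).1 h) with h1 | ⟨i, h1, h2⟩
      · exact h1 h0
      · exact h2 ((hF.eq_of_comb_eq_zero h0 h1 h).trans ht0)
    rw [zmod_two_eq_one h, zmod_two_eq_one hS1]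

/-- The support of a nonzero cycle contains a loop. -/
theorem exists_loop_of_cycles {C : Chain V} (hC : C ∈ cycles G) {u v : V} (huv : C u v ≠ 0) :
    ∃ c m, IsLoop c m ∧ (∀ a b, arc c 0 m a b ≠ 0 → C a b ≠ 0) := by
  have hadj := adj_of_chains hC.1 huv
  let K : SimpleGraph V :=
    { Adj := fun a b => (C + edge u v) a b ≠ 0
      symm := ⟨fun a b h => by
        rwa [chains_symm (add_mem hC.1 (edge_mem_chains hadj))]⟩
      loopless := ⟨fun a h => (adj_of_chains (add_mem hC.1 (edge_mem_chains hadj)) h).ne rfl⟩ }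
  have hCK : C + edge u v ∈ chains K := by
    rw [mem_chains]
    refine ⟨fun a b => chains_symm (add_mem hC.1 (edge_mem_chains hadj)) _ _, ?_⟩
    intro a b h
    exact not_not.1 h
  have hbd : bd (C + edge u v) = pt u + pt v := by
    have h0 : bd C = 0 := hC.2
    rw [map_add, h0, bd_edge, zero_add]
  have hKC : ∀ a b, K.Adj a b → C a b ≠ 0 ∧ edge u v a b = 0 := by
    intro a b h
    have h1 : C a b + edge u v a b ≠ 0 := h
    by_cases he : edge u v a b = 0
    · rw [he, add_zero] at h1
      exact ⟨h1, he⟩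
    · exfalso
      refine h1 ?_
      have hab : C a b ≠ 0 := by
        rcases (edge_ne_zero he).2 with ⟨rfl, rfl⟩ | ⟨rfl, rfl⟩
        · exact huv
        · rwa [chains_symm hC.1]
      rw [zmod_two_eq_one he, zmod_two_eq_one hab]
      rfl
  obtain ⟨p, hp⟩ := (reachable_of_bd hCK hbd).exists_isPath
  have hlen : 2 ≤ p.length := by
    by_contra hlt
    have h1 : p.length ≠ 0 := fun h => hadj.ne (SimpleGraph.Walk.eq_of_length_eq_zero h)
    have h2 : p.length = 1 := by omega
    have h3 := p.adj_getVert_succ (i := 0) (by omega)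
    rw [p.getVert_zero, zero_add, ← h2, p.getVert_length] at h3
    have := (hKC _ _ h3).2
    rw [edge_apply_self hadj.ne] at this
    exact one_ne_zero this
  set m := p.length + 1 with hm
  have hmod : ∀ i < m, i % m = i := fun i hi => Nat.mod_eq_of_lt hi
  refine ⟨fun i => p.getVert (i % m), m, ⟨by omega, by simp, ?_⟩, ?_⟩
  · intro i j hi hj h
    simp only [hmod i hi, hmod j hj] at h
    exact hp.getVert_injOn (by simp; omega) (by simp; omega) h
  · intro a b hab
    obtain ⟨i, -, hi, h⟩ := arc_ne_zero hab
    have hCi : C (p.getVert (i % m)) (p.getVert ((i + 1) % m)) ≠ 0 := by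
      rw [hmod i hi]
      rcases Nat.lt_or_ge (i + 1) m with h1 | h1
      · rw [hmod _ h1]
        exact (hKC _ _ (p.adj_getVert_succ (by omega))).1
      · have h2 : i = p.length := by omega
        rw [h2, ← hm, Nat.mod_self, p.getVert_zero, p.getVert_length, chains_symm hC.1]
        exact huv
    rcases (edge_ne_zero h).2 with ⟨rfl, rfl⟩ | ⟨rfl, rfl⟩
    · exact hCi
    · rwa [chains_symm hC.1]

theorem IsLoop.arc_mem_cycles {c : ℕ → V} {m : ℕ} (hc : IsLoop c m)
    (h : ∀ a b, arc c 0 m a b ≠ 0 → G.Adj a b) : arc c 0 m ∈ cycles G := by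
  refine ⟨arc_mem_chains fun i _ hi => h _ _ ?_, ?_⟩
  · rw [hc.arc_apply le_rfl (Nat.zero_le _) hi]
    exact one_ne_zero
  · change bd _ = 0
    rw [bd_arc c (Nat.zero_le _), hc.eq_zero, pt_add_self]

end Circuit

noncomputable section Small

variable {V : Type*} [Fintype V] {G H : SimpleGraph V}

/-- The boundary of a triangle. -/
def tri (p q r : V) : Chain V := edge p q + edge q r + edge r p

theorem tri_mem {p q r : V} (h1 : G.Adj p q) (h2 : G.Adj q r) (h3 : G.Adj r p) :
    tri p q r ∈ cycles G := by
  refine ⟨add_mem (add_mem (edge_mem_chains h1) (edge_mem_chains h2)) (edge_mem_chains h3), ?_⟩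
  change bd _ = 0
  rw [tri, map_add, map_add, bd_edge, bd_edge, bd_edge]
  funext a
  simp only [Pi.add_apply, Pi.zero_apply]
  grind

theorem tri_ne_zero {p q r a b : V} (h : tri p q r a b ≠ 0) :
    (a = p ∨ a = q ∨ a = r) ∧ (b = p ∨ b = q ∨ b = r) ∧ a ≠ b := by
  have h' : edge p q a b ≠ 0 ∨ edge q r a b ≠ 0 ∨ edge r p a b ≠ 0 := by
    by_contra! hcon
    exact h (by simp [tri, hcon.1, hcon.2.1, hcon.2.2])
  rcases h' with h' | h' | h' <;>
    obtain ⟨h1, ⟨rfl, rfl⟩ | ⟨rfl, rfl⟩⟩ := edge_ne_zero h' <;> simp [h1]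

/-- Graphs on at most four vertices satisfy MacLane's criterion. -/
theorem macLane_of_four {v a b c : V} (hd : [v, a, b, c].Nodup)
    (h : ∀ p q, G.Adj p q → p ∈ [v, a, b, c]) : MacLane G := by
  let K : SimpleGraph V :=
    { Adj := fun p q => p ≠ q ∧ p ∈ [v, a, b, c] ∧ q ∈ [v, a, b, c]
      symm := ⟨fun _ _ h => ⟨h.1.symm, h.2.2, h.2.1⟩⟩
      loopless := ⟨fun _ h => h.1 rfl⟩ }
  have hGK : G ≤ K := fun p q hpq => ⟨hpq.ne, h p q hpq, h q p hpq.symm⟩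
  have hK : ∀ p q, K.Adj p q ↔ p ≠ q ∧ p ∈ [v, a, b, c] ∧ q ∈ [v, a, b, c] := fun _ _ => Iff.rfl
  simp only [List.nodup_cons, List.mem_cons, List.not_mem_nil, or_false, not_or, not_false_iff,
    List.nodup_nil, and_true] at hd
  obtain ⟨⟨hva, hvb, hvc⟩, ⟨hab, hac⟩, hbc⟩ := hd
  have sva := Ne.symm hva
  have svb := Ne.symm hvb
  have svc := Ne.symm hvc
  have sab := Ne.symm hab
  have sac := Ne.symm hac
  have sbc := Ne.symm hbc
  refine MacLane.mono hGK ?_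
  have m1 : tri v a b ∈ cycles K := tri_mem (by simp [hK, hva]) (by simp [hK, hab])
    (by simp [hK, Ne.symm hvb])
  have m2 : tri v b c ∈ cycles K := tri_mem (by simp [hK, hvb]) (by simp [hK, hbc])
    (by simp [hK, Ne.symm hvc])
  have m3 : tri v c a ∈ cycles K := tri_mem (by simp [hK, hvc]) (by simp [hK, Ne.symm hac])
    (by simp [hK, Ne.symm hva])
  refine macLane_of_span (F := ![tri v a b, tri v b c, tri v c a]) ?_ ?_ ?_
  · intro i
    fin_cases i
    exacts [m1, m2, m3]
  · intro p q
    have hex : ∃ i : Fin 3, (![tri v a b, tri v b c, tri v c a] i) p q = 0 := by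
      by_contra! hall
      obtain ⟨hp1, hq1, hpq⟩ := tri_ne_zero (hall 0)
      obtain ⟨hp2, hq2, -⟩ := tri_ne_zero (hall 1)
      obtain ⟨hp3, hq3, -⟩ := tri_ne_zero (hall 2)
      grind
    obtain ⟨i, hi⟩ := hex
    refine (card_le_card (t := univ.erase i) fun j hj => ?_).trans (by simp)
    rw [mem_filter] at hj
    refine mem_erase.2 ⟨?_, mem_univ _⟩
    rintro rfl
    exact hj.2 hi
  · intro Q hQ
    refine ⟨![Q a b, Q b c, Q c a], ?_⟩
    set D : Chain V := Q + comb ![tri v a b, tri v b c, tri v c a] ![Q a b, Q b c, Q c a] with hD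
    have hDm : D ∈ cycles K := by
      refine add_mem hQ (comb_mem ?_ _)
      intro i
      fin_cases i
      exacts [m1, m2, m3]
    have hDv : ∀ p q, D p q = Q p q + (Q a b * tri v a b p q + Q b c * tri v b c p q +
        Q c a * tri v c a p q) := by
      intro p q
      simp [hD, comb, Fin.sum_univ_three]
    have d1 : D a b = 0 := by
      rw [hDv]
      have e1 : tri v a b a b = 1 := by simp [tri, edge, *]
      have e2 : tri v b c a b = 0 := by simp [tri, edge, *]
      have e3 : tri v c a a b = 0 := by simp [tri, edge, *]
      rw [e1, e2, e3]
      grind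
    have d2 : D b c = 0 := by
      rw [hDv]
      have e1 : tri v a b b c = 0 := by simp [tri, edge, *]
      have e2 : tri v b c b c = 1 := by simp [tri, edge, *]
      have e3 : tri v c a b c = 0 := by simp [tri, edge, *]
      rw [e1, e2, e3]
      grind
    have d3 : D c a = 0 := by
      rw [hDv]
      have e1 : tri v a b c a = 0 := by simp [tri, edge, *]
      have e2 : tri v b c c a = 0 := by simp [tri, edge, *]
      have e3 : tri v c a c a = 1 := by simp [tri, edge, *]
      rw [e1, e2, e3]
      grind
    have hsym := chains_symm hDm.1
    have hoff : ∀ p, (p = a ∨ p = b ∨ p = c) → ∀ q, q ≠ v → D p q = 0 := by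
      intro p hp q hq
      by_contra hne
      obtain ⟨h1, -, h3⟩ := (hK p q).1 (adj_of_chains hDm.1 hne)
      simp only [List.mem_cons, List.not_mem_nil, or_false] at h3
      have d1' := hsym a b
      have d2' := hsym b c
      have d3' := hsym c a
      grind
    have hD0 : ∀ p, p ≠ v → ∀ q, D p q = 0 := by
      intro p hpv q
      by_contra hne
      obtain ⟨-, h2, -⟩ := (hK p q).1 (adj_of_chains hDm.1 hne)
      simp only [List.mem_cons, List.not_mem_nil, or_false] at h2
      have hp := h2.resolve_left hpv
      have hrow := sum_row_of_cycles hDm p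
      rw [sum_eq_single v (fun w _ hw => hoff p hp w hw) (by simp)] at hrow
      by_cases hqv : q = v
      · exact hne (hqv ▸ hrow)
      · exact hne (hoff p hp q hqv)
    have hDz : D = 0 := by
      funext p q
      by_cases hp : p = v
      · by_cases hq : q = v
        · by_contra hne
          exact (adj_of_chains hDm.1 hne).ne (hp.trans hq.symm)
        · rw [hsym]
          exact hD0 q hq p
      · exact hD0 p hp q
    rw [hD] at hDz
    have := congrArg (Q + ·) hDz
    simpa [← add_assoc, chain_add_self] using this

end Small

noncomputable section Vertex

variable {V : Type*} [Fintype V] {G H : SimpleGraph V} {ι : Type} [Fintype ι] {F : ι → Chain V}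

theorem cycles_del {Q : Chain V} {x : V} (hQ : Q ∈ cycles G) (h : ∀ w, Q x w = 0) :
    Q ∈ cycles (del G {x}) := by
  refine ⟨⟨hQ.1.1, ?_⟩, hQ.2⟩
  intro u v huv
  by_contra hne
  refine huv ⟨adj_of_chains hQ.1 hne, ?_, ?_⟩
  · rintro rfl
    exact hne (h v)
  · rintro rfl
    rw [chains_symm hQ.1] at hne
    exact hne (h u)

/-- The indicator of the faces at a vertex. -/
def facesAt (F : ι → Chain V) (x : V) : ι → ZMod 2 := fun i => if ∃ w, F i x w ≠ 0 then 1 else 0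

/-- The faces after deleting a vertex. -/
def delFaces (F : ι → Chain V) (x : V) : Option ι → Chain V := fun o =>
  o.elim (comb F (facesAt F x)) fun i => if ∃ w, F i x w ≠ 0 then 0 else F i

theorem delFaces_none (F : ι → Chain V) (x : V) : delFaces F x none = comb F (facesAt F x) := rfl

theorem delFaces_some_pos {x : V} {i : ι} (h : ∃ w, F i x w ≠ 0) : delFaces F x (some i) = 0 :=
  if_pos h

theorem delFaces_some_neg {x : V} {i : ι} (h : ¬ ∃ w, F i x w ≠ 0) :
    delFaces F x (some i) = F i :=
  if_neg h

theorem facesAt_pos {x : V} {i : ι} (h : ∃ w, F i x w ≠ 0) : facesAt F x i = 1 := if_pos h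

theorem facesAt_neg {x : V} {i : ι} (h : ¬ ∃ w, F i x w ≠ 0) : facesAt F x i = 0 := if_neg h

theorem IsPlaneFamily.delVertex (hF : IsPlaneFamily G F) {x : V} (hx : CycleThrough G x) :
    IsPlaneFamily (del G {x}) (delFaces F x) := by
  have hC : comb F (facesAt F x) ∈ cycles (del G {x}) := by
    refine cycles_del (comb_mem hF.mem _) fun w => ?_
    rw [← hF.sum_apply x w]
    refine sum_congr rfl fun i _ => ?_
    by_cases h : F i x w = 0
    · rw [h, mul_zero]
    · simp only [facesAt]
      rw [if_pos ⟨w, h⟩, one_mul]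
  refine ⟨?_, ?_, ?_, ?_⟩
  · rintro (_ | i)
    · exact hC
    · simp only [delFaces, Option.elim_some]
      split_ifs with h
      · exact zero_mem _
      · push Not at h
        exact cycles_del (hF.mem i) h
  · rw [Fintype.sum_option, ← hF.sum_eq_zero, delFaces_none, comb_eq_sum, ← sum_add_distrib]
    refine sum_congr rfl fun i _ => ?_
    by_cases h : ∃ w, F i x w ≠ 0
    · rw [facesAt_pos h, delFaces_some_pos h, one_smul, add_zero]
    · rw [facesAt_neg h, delFaces_some_neg h, zero_smul, zero_add]
  · intro u v
    by_cases hCu : comb F (facesAt F x) u v = 0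
    · refine le_trans ?_ (hF.card_le u v)
      rw [← card_map Function.Embedding.some (s := univ.filter fun i => F i u v ≠ 0)]
      refine card_le_card ?_
      rintro (_ | i) hi
      · exact absurd hCu (mem_filter.1 hi).2
      · have hi2 := (mem_filter.1 hi).2
        by_cases h : ∃ w, F i x w ≠ 0
        · rw [delFaces_some_pos h] at hi2
          exact absurd rfl hi2
        · rw [delFaces_some_neg h] at hi2
          exact mem_map.2 ⟨i, by simpa using hi2, rfl⟩
    · obtain ⟨k, hk1, hk2⟩ := exists_face_of_comb_ne_zero hCu
      have hsub : (univ.filter fun o => delFaces F x o u v ≠ 0) ⊆ insert none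
          (((univ.filter fun i => F i u v ≠ 0).erase k).map Function.Embedding.some) := by
        rintro (_ | i)
        · simp
        · intro hi
          rw [mem_filter] at hi
          simp only [delFaces, Option.elim_some] at hi
          have hi2 := hi.2
          split_ifs at hi2 with h
          · exact absurd rfl hi2
          · refine mem_insert_of_mem (mem_map.2 ⟨i, mem_erase.2 ⟨?_, by simpa using hi2⟩, rfl⟩)
            rintro rfl
            exact hk1 (by simp [facesAt, h])
      refine (card_le_card hsub).trans ((card_insert_le _ _).trans ?_)
      rw [card_map, card_erase_of_mem (by simpa using hk2)]
      have := hF.card_le u v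
      omega
  · intro Q hQ
    have hQG : Q ∈ cycles G := cycles_mono del_le hQ
    obtain ⟨r, rfl⟩ := hF.span Q hQG
    have hrow : ∀ w, comb F r x w = 0 := by
      intro w
      by_contra hne
      exact (adj_of_chains hQ.1 hne).2.1 rfl
    have hconst : ∀ i j, (∃ w, F i x w ≠ 0) → (∃ w, F j x w ≠ 0) → r i = r j := by
      rintro i j ⟨u, hu⟩ ⟨v, hv⟩
      by_cases huv : u = v
      · subst huv
        exact hF.eq_of_comb_eq_zero (hrow u) hu hv
      · obtain ⟨Q', hQ', h1, h2, h3⟩ := hx u v (adj_of_chains (hF.mem i).1 hu)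
          (adj_of_chains (hF.mem j).1 hv) huv
        exact hF.transfer hrow hQ' h3 h1 hu hv h2
    obtain ⟨κ, hκ⟩ : ∃ κ, ∀ i, (∃ w, F i x w ≠ 0) → r i = κ := by
      by_cases hex : ∃ i, ∃ w, F i x w ≠ 0
      · obtain ⟨i, hi⟩ := hex
        exact ⟨r i, fun j hj => hconst j i hj hi⟩
      · exact ⟨0, fun i hi => absurd ⟨i, hi⟩ hex⟩
    refine ⟨fun o => o.elim κ r, ?_⟩
    rw [comb_eq_sum, Fintype.sum_option, comb_eq_sum]
    simp only [delFaces, Option.elim_none, Option.elim_some, comb_eq_sum, smul_sum,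
      ← sum_add_distrib]
    refine sum_congr rfl fun i _ => ?_
    by_cases h : ∃ w, F i x w ≠ 0
    · simp only [facesAt, h, if_true, hκ i h, one_smul, smul_zero, add_zero]
    · simp only [facesAt, h, if_false, zero_smul, smul_zero, zero_add]

/-- The boundary created by deleting `x` passes through the neighbours of `x`. -/
theorem IsPlaneFamily.exists_apply_ne_zero (hF : IsPlaneFamily G F) {x v b b' : V}
    (hx : CycleThrough G x) (hv : CycleThrough G v) (hvx : G.Adj v x)
    (hb : (del G {x}).Adj v b) (hb' : (del G {x}).Adj v b') (hbb : b ≠ b')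
    (hvH : CycleThrough (del G {x}) v) : ∃ w, comb F (facesAt F x) v w ≠ 0 := by
  by_contra hcon
  push Not at hcon
  have hxb : x ≠ b := fun h => hb.2.2 h.symm
  obtain ⟨Q₁, hQ₁, h1, h2, h3⟩ := hv x b hvx hb.1 hxb
  obtain ⟨i, hi⟩ := hF.exists_face hQ₁ h1
  have hti : facesAt F x i = 1 := by
    simp only [facesAt]
    rw [if_pos]
    refine ⟨v, ?_⟩
    rwa [chains_symm (hF.mem i).1]
  obtain ⟨Q₂, hQ₂, k1, -⟩ := hvH b b' hb hb' hbb
  obtain ⟨o, ho⟩ := (hF.delVertex hx).exists_face hQ₂ k1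
  rcases o with _ | j
  · exact ho (hcon b)
  · simp only [delFaces, Option.elim_some] at ho
    split_ifs at ho with hj
    · exact ho rfl
    · have := hF.transfer hcon hQ₁ h3 h1 hi ho h2
      rw [hti] at this
      simp only [facesAt, hj, if_false] at this
      exact one_ne_zero this

end Vertex

noncomputable section Wagner

variable {V : Type*} [Fintype V] {G : SimpleGraph V} {x y : V}

/-- Contracting `y` into `x`, leaving `y` isolated. -/
def contract (G : SimpleGraph V) (x y : V) : SimpleGraph V where
  Adj a b := a ≠ b ∧ a ≠ y ∧ b ≠ y ∧ (G.Adj a b ∨ (a = x ∧ G.Adj y b) ∨ (b = x ∧ G.Adj y a))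
  symm := ⟨fun _ _ h => ⟨h.1.symm, h.2.2.1, h.2.1,
    h.2.2.2.imp (fun h => h.symm) fun h => h.symm⟩⟩
  loopless := ⟨fun _ h => h.1 rfl⟩

theorem contract_adj {a b : V} : (contract G x y).Adj a b ↔
    a ≠ b ∧ a ≠ y ∧ b ≠ y ∧ (G.Adj a b ∨ (a = x ∧ G.Adj y b) ∨ (b = x ∧ G.Adj y a)) := Iff.rfl

theorem contract_isPlanar (hxy : G.Adj x y) (h : G.IsPlanar) : (contract G x y).IsPlanar := by
  refine IsPlanar_of_contract (G := G) (S := {x, y}) (p := x) (by simp) (connOn_pair hxy) ?_ ?_ h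
  · rintro u v ⟨-, -, -, h | ⟨rfl, h⟩ | ⟨rfl, h⟩⟩
    · exact Or.inl h
    · exact Or.inr (Or.inl ⟨rfl, y, by simp, h⟩)
    · exact Or.inr (Or.inr ⟨rfl, y, by simp, h⟩)
  · rintro s (rfl | rfl) hs w hw
    · exact hs rfl
    · exact hw.2.1 rfl

theorem darts_contract_lt (hxy : G.Adj x y) : darts (contract G x y) < darts G := by
  unfold darts
  have hmem : (x, y) ∈ univ.filter fun p : V × V => G.Adj p.1 p.2 := by simpa using hxy
  let f : V × V → V × V := fun p =>
    if G.Adj p.1 p.2 then p else if p.1 = x then (y, p.2) else (p.1, y)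
  calc #(univ.filter fun p : V × V => (contract G x y).Adj p.1 p.2)
      ≤ #((univ.filter fun p : V × V => G.Adj p.1 p.2).erase (x, y)) := by
        refine card_le_card_of_injOn f ?_ ?_
        · rintro ⟨a, b⟩ h
          simp only [coe_filter, mem_univ, true_and, Set.mem_ofPred_eq, contract_adj] at h
          obtain ⟨h1, h2, h3, h4⟩ := h
          have hyx := hxy.symm
          simp only [coe_erase, coe_filter, mem_univ, true_and, Set.mem_sdiff, Set.mem_ofPred_eq,
            Set.mem_singleton_iff, f]
          split_ifs with h5 h6
          · exact ⟨h5, by simp [h3]⟩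
          · refine ⟨?_, by simp [hxy.ne']⟩
            rcases h4 with h4 | h4 | h4
            · exact absurd h4 h5
            · exact h4.2
            · exact absurd (h6.trans h4.1.symm) h1
          · refine ⟨?_, by simp [h6]⟩
            rcases h4 with h4 | h4 | h4
            · exact absurd h4 h5
            · exact absurd h4.1 h6
            · exact h4.2.symm
        · rintro ⟨a, b⟩ h ⟨a', b'⟩ h' he
          simp only [coe_filter, mem_univ, true_and, Set.mem_ofPred_eq, contract_adj] at h h'
          simp only [f] at he
          grind
    _ < _ := card_erase_lt_of_mem hmem

/-- Data of a minimal counterexample with a contractible edge and at least five vertices. -/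
structure ContractData (G : SimpleGraph V) (x y : V) : Prop extends MinCex G where
  adj : G.Adj x y
  contractible : ∀ (z : V) (K : Set V), x ∉ K → y ∉ K → z ∉ K → (∃ k ∈ K, ∃ w, G.Adj k w) →
    (∀ u ∈ K, ∀ v, G.Adj u v → v ∈ K ∨ v = x ∨ v = y ∨ v = z) →
      ∀ v w, G.Adj v w → v ∈ K ∨ v = x ∨ v = y ∨ v = z
  five : ∀ a b c d, ∃ v, (∃ w, G.Adj v w) ∧ v ≠ a ∧ v ≠ b ∧ v ≠ c ∧ v ≠ d

theorem MinCex.exists_contractData (h : MinCex G) : ∃ x y, ContractData G x y := by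
  have hne : ∃ x y, G.Adj x y := by
    by_contra! hcon
    refine h.not_macLane (macLane_of_span_singleton (zero_mem _) fun Q hQ => Or.inl ?_)
    funext a b
    by_contra hab
    exact hcon a b (adj_of_chains hQ.1 hab)
  obtain ⟨x, y, hxy, hcon⟩ := h.exists_contractible hne
  refine ⟨x, y, h, hxy, hcon, ?_⟩
  intro p q r s
  obtain ⟨a, ha, -, -⟩ := h.three_le_degree hxy x x
  obtain ⟨b, hb, hba, -⟩ := h.three_le_degree hxy a a
  obtain ⟨c, hc, hca, hcb⟩ := h.three_le_degree hxy a b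
  obtain ⟨e, he, hex⟩ : ∃ e, (∃ w, G.Adj e w) ∧ e ∉ [x, a, b, c] := by
    by_contra! hall
    refine h.not_macLane (macLane_of_four (v := x) (a := a) (b := b) (c := c) ?_ fun p q hpq =>
      hall p ⟨q, hpq⟩)
    simp [ha.ne, hb.ne, hc.ne, hba.symm, hca.symm, hcb.symm]
  by_contra! hcov
  have hsub : ({x, a, b, c, e} : Finset V) ⊆ {p, q, r, s} := by
    have key : ∀ v, (∃ w, G.Adj v w) → v ∈ ({p, q, r, s} : Finset V) := by
      intro v hv
      simp only [mem_insert, mem_singleton]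
      by_contra! h
      exact h.2.2.2 (hcov v hv h.1 h.2.1 h.2.2.1)
    intro v hv
    simp only [mem_insert, mem_singleton] at hv
    rcases hv with rfl | rfl | rfl | rfl | rfl
    exacts [key _ ⟨_, hxy⟩, key _ ⟨_, ha.symm⟩, key _ ⟨_, hb.symm⟩, key _ ⟨_, hc.symm⟩, key _ he]
  have h5 : #({x, a, b, c, e} : Finset V) = 5 := by
    have hn : [x, a, b, c, e].Nodup := by
      simp only [List.mem_cons, List.not_mem_nil, or_false, not_or] at hex
      simp [ha.ne, hb.ne, hc.ne, hba.symm, hca.symm, hcb.symm, Ne.symm hex.1, Ne.symm hex.2.1,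
        Ne.symm hex.2.2.1, Ne.symm hex.2.2.2]
    have := List.toFinset_card_of_nodup hn
    simpa using this
  have := card_le_card hsub
  have h4 : #({p, q, r, s} : Finset V) ≤ 4 := card_le_four
  omega

namespace ContractData

theorem cycleThrough_contract (h : ContractData G x y) (p : V) :
    CycleThrough (contract G x y) p := by
  refine cycleThrough_of_forall fun a b ha hb K hpK haK hcl => ?_
  by_cases hpx : p = x
  · subst hpx
    have := h.conn (x := p) (y := y) (K := K \ {y}) (fun h => hpK h.1) (fun h => h.2 rfl)
      (v := b) ⟨a, ⟨haK, ha.2.2.1⟩, ?_⟩ ?_ (w := if G.Adj p b then p else y) ?_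
    · rcases this with h | h | h
      · exact h.1
      · exact absurd h.symm hb.1
      · exact absurd h hb.2.2.1
    · rcases ha.2.2.2 with h | ⟨-, h⟩ | ⟨h, -⟩
      · exact ⟨p, h.symm⟩
      · exact ⟨y, h.symm⟩
      · exact absurd h.symm ha.1
    · rintro u ⟨hu, huy⟩ v huv
      by_cases hvy : v = y
      · exact Or.inr (Or.inr hvy)
      · rcases hcl u hu v ⟨huv.ne, huy, hvy, Or.inl huv⟩ with h | h
        · exact Or.inl ⟨h, hvy⟩
        · exact Or.inr (Or.inl h)
    · split_ifs with h1
      · exact h1.symm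
      · rcases hb.2.2.2 with h | ⟨-, h⟩ | ⟨h, -⟩
        · exact absurd h h1
        · exact h.symm
        · exact absurd h.symm hb.1
  · have hpy : p ≠ y := ha.2.1
    let φ : V → V := fun v => if v = y then x else v
    have hφ : ∀ v, v ≠ y → φ v = v := fun v hv => if_neg hv
    have hφy : φ y = x := if_pos rfl
    have hnon : ∀ a, (contract G x y).Adj p a → ∃ w, G.Adj a w := by
      intro a ha
      rcases ha.2.2.2 with h' | ⟨h', -⟩ | ⟨h', -⟩
      · exact ⟨p, h'.symm⟩
      · exact absurd h' hpx
      · exact ⟨y, h' ▸ h.adj⟩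
    obtain ⟨w, hw⟩ := hnon b hb
    have := h.conn (x := p) (y := p) (K := {v | φ v ∈ K}) ?_ ?_ ⟨a, ?_, hnon a ha⟩ ?_ hw
    · rcases this with h' | h' | h'
      · rwa [Set.mem_ofPred_eq, hφ b hb.2.2.1] at h'
      · exact absurd h'.symm hb.1
      · exact absurd h'.symm hb.1
    · rwa [Set.mem_ofPred_eq, hφ p hpy]
    · rwa [Set.mem_ofPred_eq, hφ p hpy]
    · rwa [Set.mem_ofPred_eq, hφ a ha.2.2.1]
    · intro u hu v huv
      rw [Set.mem_ofPred_eq] at hu ⊢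
      by_cases he : φ u = φ v
      · exact Or.inl (he ▸ hu)
      · have hadj : (contract G x y).Adj (φ u) (φ v) := by
          have hxy := h.adj.ne
          have hsym := huv.symm
          rw [contract_adj]
          simp only [φ] at he ⊢
          split_ifs at he ⊢ with h1 h2 h2
          · exact absurd rfl he
          · exact ⟨he, hxy, h2, Or.inr (Or.inl ⟨rfl, h1 ▸ huv⟩)⟩
          · exact ⟨he, h1, hxy, Or.inr (Or.inr ⟨rfl, h2 ▸ hsym⟩)⟩
          · exact ⟨he, h1, h2, Or.inl huv⟩
        rcases hcl _ hu _ hadj with h' | h'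
        · exact Or.inl h'
        · right
          left
          by_cases hvy : v = y
          · rw [hvy, hφy] at h'
            exact absurd h'.symm hpx
          · rwa [hφ v hvy] at h'

theorem cycleThrough_del (h : ContractData G x y) (p : V) : CycleThrough (del G {x, y}) p := by
  refine cycleThrough_of_forall fun a b ha hb K hpK haK hcl => ?_
  simp only [del_adj, Set.mem_insert_iff, Set.mem_singleton_iff, not_or] at ha hb
  have := h.contractible p (K \ {x, y}) (by simp) (by simp) (fun h => hpK h.1)
    ⟨a, ⟨haK, by simp [ha.2.2]⟩, p, ha.1.symm⟩ ?_ b p hb.1.symm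
  · rcases this with h' | h' | h' | h'
    · exact h'.1
    · exact absurd h' hb.2.2.1
    · exact absurd h' hb.2.2.2
    · exact absurd h'.symm hb.1.ne
  · rintro u ⟨hu, hu'⟩ v huv
    by_cases hv : v ∈ ({x, y} : Set V)
    · simp only [Set.mem_insert_iff, Set.mem_singleton_iff] at hv
      rcases hv with hv | hv
      · exact Or.inr (Or.inl hv)
      · exact Or.inr (Or.inr (Or.inl hv))
    · rcases hcl u hu v ⟨huv, hu', hv⟩ with h' | h'
      · exact Or.inl ⟨h', hv⟩
      · exact Or.inr (Or.inr (Or.inr h'))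

theorem exists_adj_del (h : ContractData G x y) {p a : V} (ha : (del G {x, y}).Adj p a) :
    ∃ b, (del G {x, y}).Adj p b ∧ a ≠ b := by
  have hp := ha.2.1
  have ha' := ha.2.2
  simp only [Set.mem_insert_iff, Set.mem_singleton_iff, not_or] at hp ha'
  by_contra! hcon
  obtain ⟨v, ⟨w, hvw⟩, h1, h2, h3, h4⟩ := h.five p x y a
  have := h.contractible a {p} (Ne.symm hp.1) (Ne.symm hp.2) ha.1.ne'
    ⟨p, rfl, a, ha.1⟩ ?_ v w hvw
  · simp only [Set.mem_singleton_iff] at this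
    tauto
  · rintro u rfl v huv
    by_cases hv : v ∈ ({x, y} : Set V)
    · simp only [Set.mem_insert_iff, Set.mem_singleton_iff] at hv
      tauto
    · exact Or.inr (Or.inr (Or.inr (hcon v ⟨huv, ha.2.1, hv⟩).symm))

theorem conn_del (h : ContractData G x y) (K : Set V) (hK : ∃ k ∈ K, ∃ w, (del G {x, y}).Adj k w)
    (hcl : ∀ u ∈ K, ∀ v, (del G {x, y}).Adj u v → v ∈ K) (v w : V)
    (hvw : (del G {x, y}).Adj v w) : v ∈ K := by
  obtain ⟨k, hk, k', hkk⟩ := hK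
  have := h.conn (x := x) (y := y) (K := K \ {x, y}) (by simp) (by simp)
    ⟨k, ⟨hk, hkk.2.1⟩, k', hkk.1⟩ ?_ hvw.1
  · have hv := hvw.2.1
    simp only [Set.mem_insert_iff, Set.mem_singleton_iff, not_or] at hv
    rcases this with h' | h' | h'
    · exact h'.1
    · exact absurd h' hv.1
    · exact absurd h' hv.2
  · rintro u ⟨hu, hu'⟩ v huv
    by_cases hv : v ∈ ({x, y} : Set V)
    · simp only [Set.mem_insert_iff, Set.mem_singleton_iff] at hv
      exact Or.inr hv
    · exact Or.inl ⟨hcl u hu v ⟨huv, hu', hv⟩, hv⟩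

theorem del_contract (hxy : G.Adj x y) : del (contract G x y) {x} = del G {x, y} := by
  ext u v
  simp only [del_adj, contract_adj, Set.mem_insert_iff, Set.mem_singleton_iff]
  have := hxy.ne
  constructor
  · rintro ⟨⟨-, h1, h2, h3⟩, h4, h5⟩
    tauto
  · rintro ⟨h1, h2, h3⟩
    have := h1.ne
    tauto

theorem exists_adj_of_adj_contract (h : ContractData G x y) {v : V}
    (hv : (contract G x y).Adj v x) : ∃ w, (del G {x, y}).Adj v w := by
  have hnon : ∃ w, G.Adj v w := by
    rcases hv.2.2.2 with h' | ⟨h', -⟩ | ⟨-, h'⟩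
    · exact ⟨x, h'⟩
    · exact absurd h' hv.1
    · exact ⟨y, h'.symm⟩
  obtain ⟨w, hw⟩ := hnon
  obtain ⟨b, hb, hbx, hby⟩ := h.three_le_degree hw x y
  exact ⟨b, hb, by simp [hv.1, hv.2.1], by simp [hbx, hby]⟩

theorem false (h : ContractData G x y) : False := by
  have hxy := h.adj
  obtain ⟨ι, _, F, hF⟩ := h.ih _ (darts_contract_lt hxy) (contract_isPlanar hxy h.planar)
  have hcyc := h.cycleThrough_contract
  have hF' := hF.delVertex (hcyc x)
  rw [del_contract hxy] at hF'
  set C := comb F (facesAt F x) with hCdef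
  have hC : C ∈ cycles (del G {x, y}) := hF'.mem none
  have hCv : ∀ v, (contract G x y).Adj v x → ∃ w, C v w ≠ 0 := by
    intro v hv
    obtain ⟨b, hb⟩ := h.exists_adj_of_adj_contract hv
    obtain ⟨b', hb', hbb⟩ := h.exists_adj_del hb
    have h1 := h.cycleThrough_del v
    rw [← del_contract hxy] at hb hb' h1
    exact hF.exists_apply_ne_zero (hcyc x) (hcyc v) hv hb hb' hbb h1
  obtain ⟨a, ha, hay, -⟩ := h.three_le_degree hxy y y
  obtain ⟨w₀, hw₀⟩ := hCv a ⟨ha.ne', hay, hxy.ne, Or.inl ha.symm⟩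
  obtain ⟨c, m, hc, hsub⟩ := exists_loop_of_cycles hC hw₀
  have h3 := hc.three_le
  have harc : arc c 0 m ∈ cycles (del G {x, y}) :=
    hc.arc_mem_cycles fun a b hab => adj_of_chains hC.1 (hsub a b hab)
  have hS : arc c 0 m = C := by
    refine hF'.eq_of_support_subset h.cycleThrough_del (fun p a => h.exists_adj_del) h.conn_del harc
      (a₀ := c 0) (b₀ := c 1) ?_ (i₀ := none) hsub
    rw [hc.arc_apply le_rfl le_rfl (by omega)]
    exact one_ne_zero
  have hface : MacLaneFace (del G {x, y}) (arc c 0 m) := ⟨_, _, _, hF', none, hS.symm⟩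
  have hoff : ∀ i, c i ∉ ({x, y} : Set V) := fun i => (hc.adj harc.1 i).2.1
  have hcx : ∀ i, c i ≠ x := fun i h' => hoff i (by simp [h'])
  have hcy : ∀ i, c i ≠ y := fun i h' => hoff i (by simp [h'])
  have hon : ∀ v, (contract G x y).Adj v x → ∃ i < m, c i = v := by
    intro v hv
    obtain ⟨w, hw⟩ := hCv v hv
    rw [← hS] at hw
    obtain ⟨i, -, -, hi⟩ := arc_ne_zero hw
    rcases (edge_ne_zero hi).2 with ⟨rfl, -⟩ | ⟨rfl, -⟩
    · exact hc.exists_index i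
    · exact hc.exists_index (i + 1)
  have hG : del G {x, y} ⊔ star x {v | G.Adj x v ∧ v ≠ y} ⊔
      star y (insert x {v | G.Adj y v ∧ v ≠ x}) = G := by
    ext u v
    simp only [SimpleGraph.sup_adj, del_adj, star_adj, Set.mem_insert_iff, Set.mem_ofPred_eq,
      Set.mem_singleton_iff]
    constructor
    · rintro ((h | ⟨-, ⟨rfl, h⟩ | ⟨rfl, h⟩⟩) | ⟨-, ⟨rfl, rfl | h⟩ | ⟨rfl, rfl | h⟩⟩)
      exacts [h.1, h.1, h.1.symm, hxy.symm, h.1, hxy, h.1.symm]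
    · intro huv
      have h1 := huv.ne
      have h2 := huv.symm
      grind
  have hdeg : ∀ u v, G.Adj u v → ∃ a ∈ {w | G.Adj u w ∧ w ≠ v}, ∃ b ∈ {w | G.Adj u w ∧ w ≠ v},
      a ≠ b := by
    intro u v huv
    obtain ⟨a, ha, hav, -⟩ := h.three_le_degree huv v v
    obtain ⟨b, hb, hbv, hba⟩ := h.three_le_degree huv v a
    exact ⟨a, ⟨ha, hav⟩, b, ⟨hb, hbv⟩, hba.symm⟩
  have := macLane_of_loop (x := x) (y := y) (X := {v | G.Adj x v ∧ v ≠ y})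
    (Y := {v | G.Adj y v ∧ v ≠ x}) hc hface hxy.ne hcx hcy (fun w hw => hw.2.1 (by simp))
    (fun w hw => hw.2.1 (by simp)) ?_ ?_ (hdeg x y hxy) (hdeg y x hxy.symm)
    (by rw [hG]; exact h.planar)
  · rw [hG] at this
    exact h.not_macLane this
  · rintro v ⟨hv, hvy⟩
    exact hon v ⟨hv.ne', hvy, hxy.ne, Or.inl hv.symm⟩
  · rintro v ⟨hv, hvx⟩
    exact hon v ⟨hvx, hv.ne', hxy.ne, Or.inr (Or.inr ⟨rfl, hv⟩)⟩

end ContractData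

theorem macLane_of_isPlanar (h : G.IsPlanar) : MacLane G := by
  induction hn : darts G using Nat.strong_induction_on generalizing G with
  | _ n ih =>
    by_contra hcon
    have hmin : MinCex G := ⟨h, hcon, fun H hH hp => ih _ (hn ▸ hH) hp rfl⟩
    obtain ⟨x, y, hxy⟩ := hmin.exists_contractData
    exact hxy.false

end Wagner

noncomputable section KostochkaYancey

variable {V : Type u} {G H : SimpleGraph V} {S T R A B W : Finset V} {v x y a b : V}

/-- The subgraph induced on `S` is properly `3`-colorable. -/
def ColorableOn (G : SimpleGraph V) (S : Finset V) : Prop :=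
  ∃ φ : V → Fin 3, ∀ u ∈ S, ∀ v ∈ S, G.Adj u v → φ u ≠ φ v

/-- The number of neighbours of `v` in `T`. -/
def degIn (G : SimpleGraph V) (T : Finset V) (v : V) : ℕ := #(T.filter (G.Adj v))

/-- The number of ordered adjacent pairs in `A × B`. -/
def pairs (G : SimpleGraph V) (A B : Finset V) : ℤ := ∑ a ∈ A, (degIn G B a : ℤ)

/-- Twice the Kostochka–Yancey potential `5 |T| - 3 e(T)`. -/
def pot (G : SimpleGraph V) (T : Finset V) : ℤ := 10 * #T - 3 * pairs G T T

theorem degIn_eq_sum (T : Finset V) (v : V) :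
    (degIn G T v : ℤ) = ∑ w ∈ T, if G.Adj v w then 1 else 0 := by
  unfold degIn
  rw [card_filter]
  push_cast
  rfl

theorem pairs_comm : pairs G A B = pairs G B A := by
  unfold pairs
  simp only [degIn_eq_sum]
  rw [sum_comm]
  simp only [G.adj_comm]

theorem pairs_union_left (h : Disjoint A B) : pairs G (A ∪ B) T = pairs G A T + pairs G B T :=
  sum_union h

theorem pairs_union_right (h : Disjoint A B) : pairs G T (A ∪ B) = pairs G T A + pairs G T B := by
  rw [pairs_comm, pairs_union_left h, pairs_comm, pairs_comm (A := B)]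

theorem pairs_union_self (h : Disjoint A B) :
    pairs G (A ∪ B) (A ∪ B) = pairs G A A + pairs G B B + 2 * pairs G A B := by
  rw [pairs_union_left h, pairs_union_right h, pairs_union_right h, pairs_comm (A := B) (B := A)]
  ring

theorem pairs_nonneg : 0 ≤ pairs G A B := sum_nonneg fun _ _ => by positivity

theorem pairs_insert (h : v ∉ T) :
    pairs G (insert v T) (insert v T) = pairs G T T + 2 * degIn G T v := by
  have h1 : Disjoint {v} T := by simpa using h
  rw [insert_eq, pairs_union_self h1]
  simp [pairs, degIn, filter_singleton]

theorem pot_insert (h : v ∉ T) : pot G (insert v T) = pot G T + 10 - 6 * degIn G T v := by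
  unfold pot
  rw [pairs_insert h, card_insert_of_notMem h]
  push_cast
  ring

theorem exists_pot_eq_two_mul (T : Finset V) : ∃ k, pot G T = 2 * k := by
  induction T using Finset.induction_on with
  | empty => exact ⟨0, by simp [pot, pairs]⟩
  | insert v T hv ih =>
    obtain ⟨k, hk⟩ := ih
    exact ⟨k + 5 - 3 * degIn G T v, by rw [pot_insert hv, hk]; ring⟩

theorem degIn_lt_of_mem (h : v ∈ T) : degIn G T v < #T := by
  refine card_lt_card ⟨filter_subset _ _, fun h' => ?_⟩
  have := h' h
  simp at this

theorem pairs_le : pairs G T T ≤ #T * (#T - 1) := by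
  have : ∀ a ∈ T, (degIn G T a : ℤ) ≤ #T - 1 := fun a ha => by
    have := degIn_lt_of_mem (G := G) ha
    omega
  calc pairs G T T ≤ ∑ a ∈ T, ((#T : ℤ) - 1) := sum_le_sum this
    _ = _ := by rw [sum_const, nsmul_eq_mul]

theorem four_le_card_of_not_colorableOn (h : ¬ ColorableOn G S) : 4 ≤ #S := by
  by_contra hlt
  apply h
  obtain ⟨f⟩ := Function.Embedding.nonempty_of_card_le (α := S) (β := Fin 3) (by simp; omega)
  refine ⟨fun v => if hv : v ∈ S then f ⟨v, hv⟩ else 0, fun u hu v hv huv hh => huv.ne ?_⟩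
  simp only [hu, hv, dif_pos] at hh
  simpa using f.injective hh

theorem pot_of_disjoint (h : Disjoint A B) (hT : ∀ x, x ∈ T ↔ x ∈ A ∨ x ∈ B) :
    pot G T = 10 * (#A + #B) - 3 * (pairs G A A + pairs G B B + 2 * pairs G A B) := by
  obtain rfl : T = A ∪ B := by ext; simp [hT]
  unfold pot
  rw [pairs_union_self h, card_union_of_disjoint h]
  push_cast
  ring

/-- A smallest set violating the Kostochka–Yancey bound for `3`-colorings. -/
structure IsMinSparse (G : SimpleGraph V) (S : Finset V) : Prop where
  not_colorable : ¬ ColorableOn G S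
  four_lt : ∀ W ⊆ S, ¬ ColorableOn G W → 4 < pot G W
  ih : ∀ (V' : Type u) (H : SimpleGraph V') (T : Finset V'), #T < #S → ¬ ColorableOn H T →
    ∃ W ⊆ T, ¬ ColorableOn H W ∧ pot H W ≤ 4

theorem IsMinSparse.colorableOn (h : IsMinSparse G S) (hT : T ⊂ S) : ColorableOn G T := by
  by_contra hcon
  obtain ⟨W, hW, h1, h2⟩ := h.ih V G T (card_lt_card hT) hcon
  have := h.four_lt W (hW.trans hT.1) h1
  omega

theorem IsMinSparse.six_le (h : IsMinSparse G S) : 6 ≤ pot G S := by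
  have h1 := h.four_lt S Subset.rfl h.not_colorable
  obtain ⟨k, hk⟩ := exists_pot_eq_two_mul (G := G) S
  omega

theorem exists_color_of_card_lt {t : Finset (Fin 3)} (h : #t < 3) : ∃ c, c ∉ t := by
  by_contra! hcon
  have : t = univ := by ext; simp [hcon]
  simp [this] at h

theorem colorableOn_insert {φ : V → Fin 3} {c : Fin 3}
    (hφ : ∀ u ∈ T, ∀ v ∈ T, G.Adj u v → φ u ≠ φ v)
    (hc : ∀ u ∈ T, G.Adj v u → φ u ≠ c) :
    ∀ u ∈ insert v T, ∀ w ∈ insert v T, G.Adj u w →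
      Function.update φ v c u ≠ Function.update φ v c w := by
  intro u hu w hw huw
  have hne := huw.ne
  rw [mem_insert] at hu hw
  by_cases h1 : u = v
  · subst h1
    rw [Function.update_self, Function.update_of_ne hne.symm]
    exact (hc w (hw.resolve_left hne.symm) huw).symm
  · by_cases h2 : w = v
    · subst h2
      rw [Function.update_self, Function.update_of_ne h1]
      exact hc u (hu.resolve_left h1) huw.symm
    · rw [Function.update_of_ne h1, Function.update_of_ne h2]
      exact hφ u (hu.resolve_left h1) w (hw.resolve_left h2) huw

theorem IsMinSparse.three_le_degIn (h : IsMinSparse G S) (hv : v ∈ S) : 3 ≤ degIn G S v := by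
  by_contra! hlt
  obtain ⟨φ, hφ⟩ := h.colorableOn (erase_ssubset hv)
  obtain ⟨c, hc⟩ := exists_color_of_card_lt
    (card_image_le (s := S.filter (G.Adj v)) (f := φ) |>.trans_lt hlt)
  apply h.not_colorable
  rw [← insert_erase hv]
  refine ⟨_, colorableOn_insert hφ (c := c) fun u hu hvu heq => hc ?_⟩
  rw [mem_image]
  exact ⟨u, by simp [mem_of_mem_erase hu, hvu], heq⟩

/-- The graph obtained by collapsing the colour classes of `φ` on `R` to a triangle. -/
def collapse (G : SimpleGraph V) (R : Finset V) (φ : V → Fin 3) : SimpleGraph (V ⊕ Fin 3) where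
  Adj
    | .inl u, .inl v => G.Adj u v
    | .inl u, .inr i => ∃ w ∈ R, G.Adj u w ∧ φ w = i
    | .inr i, .inl u => ∃ w ∈ R, G.Adj u w ∧ φ w = i
    | .inr i, .inr j => i ≠ j
  symm := ⟨by
    rintro (u | i) (v | j) h
    · exact SimpleGraph.Adj.symm h
    · exact h
    · exact h
    · exact Ne.symm h⟩
  loopless := ⟨by
    rintro (u | i) h
    · exact G.loopless.irrefl _ h
    · exact h rfl⟩

theorem collapse_inl_inl {φ : V → Fin 3} {u v : V} :
    (collapse G R φ).Adj (.inl u) (.inl v) ↔ G.Adj u v := Iff.rfl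

theorem collapse_inl_inr {φ : V → Fin 3} {u : V} {i : Fin 3} :
    (collapse G R φ).Adj (.inl u) (.inr i) ↔ ∃ w ∈ R, G.Adj u w ∧ φ w = i := Iff.rfl

theorem collapse_inr_inr {φ : V → Fin 3} {i j : Fin 3} :
    (collapse G R φ).Adj (.inr i) (.inr j) ↔ i ≠ j := Iff.rfl

theorem IsMinSparse.exists_extension (h : IsMinSparse G S) (hR : R ⊂ S) (hR4 : 4 ≤ #R)
    {φ : V → Fin 3} (hφ : ∀ u ∈ R, ∀ v ∈ R, G.Adj u v → φ u ≠ φ v) :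
    ∃ A ⊆ S \ R, ∃ X : Finset (Fin 3), A.Nonempty ∧ X.Nonempty ∧
      pot G (R ∪ A) ≤ pot G R + 4 - (10 * #X - 3 * (#X * (#X - 1))) -
        6 * pairs G A (R.filter fun w => φ w ∉ X) := by
  set Y := collapse G R φ with hY
  set S' := (S \ R).disjSum (univ : Finset (Fin 3)) with hS'
  have hcard : #S' < #S := by
    rw [hS', card_disjSum, card_sdiff_of_subset hR.1]
    have := card_le_card hR.1
    simp
    omega
  have hnot : ¬ ColorableOn Y S' := by
    rintro ⟨ψ, hψ⟩
    have hinr : ∀ i, Sum.inr i ∈ S' := fun i => by simp [hS']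
    have hinl : ∀ u, u ∈ S → u ∉ R → Sum.inl u ∈ S' := fun u h1 h2 => by simp [hS', h1, h2]
    refine h.not_colorable ⟨fun v => if v ∈ R then ψ (.inr (φ v)) else ψ (.inl v), ?_⟩
    intro u hu v hv huv
    by_cases h1 : u ∈ R <;> by_cases h2 : v ∈ R
    · simp only [h1, h2, if_true]
      exact hψ _ (hinr _) _ (hinr _) (collapse_inr_inr.2 (hφ u h1 v h2 huv))
    · simp only [h1, h2, if_true, if_false]
      exact (hψ _ (hinl v hv h2) _ (hinr _) (collapse_inl_inr.2 ⟨u, h1, huv.symm, rfl⟩)).symm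
    · simp only [h1, h2, if_true, if_false]
      exact hψ _ (hinl u hu h1) _ (hinr _) (collapse_inl_inr.2 ⟨v, h2, huv, rfl⟩)
    · simp only [h1, h2, if_false]
      exact hψ _ (hinl u hu h1) _ (hinl v hv h2) (collapse_inl_inl.2 huv)
  obtain ⟨W, hWS, hW, hpot⟩ := h.ih _ Y S' hcard hnot
  set A := W.toLeft with hA
  set X := W.toRight with hX
  have hWeq : W = A.disjSum X := by rw [hA, hX, toLeft_disjSum_toRight]
  have hAS : A ⊆ S \ R := by
    intro a ha
    have := hWS (mem_toLeft.1 ha)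
    simpa [hS'] using this
  have hX0 : X.Nonempty := by
    rw [nonempty_iff_ne_empty]
    intro h0
    have : A ⊂ S := by
      refine ⟨hAS.trans sdiff_subset, fun hh => ?_⟩
      obtain ⟨r, hr⟩ := card_pos.1 (show 0 < #R by omega)
      have := hAS (hh (hR.1 hr))
      simp [hr] at this
    obtain ⟨χ, hχ⟩ := h.colorableOn this
    refine hW ⟨Sum.elim χ fun _ => 0, ?_⟩
    rw [hWeq, h0]
    rintro (u | i) hu (v | j) hv huv
    · exact hχ u (by simpa using hu) v (by simpa using hv) huv
    · simp at hv
    · simp at hu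
    · simp at hu
  have hA0 : A.Nonempty := by
    rw [nonempty_iff_ne_empty]
    intro h0
    refine hW ⟨Sum.elim (fun _ => 0) id, ?_⟩
    rw [hWeq, h0]
    rintro (u | i) hu (v | j) hv huv
    · simp at hu
    · simp at hu
    · simp at hv
    · exact huv
  refine ⟨A, hAS, X, hA0, hX0, ?_⟩
  have hdisj : Disjoint R A :=
    disjoint_left.2 fun r hr hrA => (mem_sdiff.1 (hAS hrA)).2 hr
  -- the degrees in the collapsed graph
  have hdX : ∀ i ∈ X, (degIn Y (X.map .inr) (.inr i) : ℤ) ≤ #X - 1 := fun i hi => by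
    have := degIn_lt_of_mem (G := Y) (T := X.map .inr) (v := .inr i) (by simpa using hi)
    rw [card_map] at this
    omega
  have hdAA : ∀ u, degIn Y (A.map .inl) (.inl u) = degIn G A u := fun u => by
    unfold degIn
    rw [filter_map, card_map]
    rfl
  have hdAX : ∀ u, degIn Y (X.map .inr) (.inl u) ≤ degIn G (R.filter fun w => φ w ∈ X) u :=
    fun u => by
    unfold degIn
    rw [filter_map, card_map]
    refine (card_le_card (t := ((R.filter fun w => φ w ∈ X).filter (G.Adj u)).image φ) ?_).trans
      card_image_le
    intro i hi
    simp only [mem_filter, mem_image, Function.comp] at hi ⊢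
    obtain ⟨hi, w, hw, huw, rfl⟩ := hi
    exact ⟨w, ⟨⟨hw, hi⟩, huw⟩, rfl⟩
  have hd2 : Disjoint (A.map (.inl : V ↪ V ⊕ Fin 3)) (X.map .inr) := by
    rw [disjoint_left]
    rintro (u | i) <;> simp
  have e1 : pairs Y (X.map .inr) (X.map .inr) ≤ #X * (#X - 1) := by
    unfold pairs
    rw [sum_map]
    calc _ ≤ ∑ i ∈ X, ((#X : ℤ) - 1) := sum_le_sum hdX
      _ = _ := by rw [sum_const, nsmul_eq_mul]
  have e2 : pairs Y (A.map .inl) (A.map .inl) = pairs G A A := by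
    unfold pairs
    rw [sum_map]
    exact sum_congr rfl fun u _ => by exact_mod_cast hdAA u
  have e3 : pairs Y (A.map .inl) (X.map .inr) ≤ pairs G A (R.filter fun w => φ w ∈ X) := by
    unfold pairs
    rw [sum_map]
    exact sum_le_sum fun u _ => by exact_mod_cast hdAX u
  have e4 : pairs G A R = pairs G A (R.filter fun w => φ w ∈ X) +
      pairs G A (R.filter fun w => φ w ∉ X) := by
    rw [← pairs_union_right (disjoint_filter_filter_not R R _), filter_union_filter_not_eq]
  have e5 : pot Y W = 10 * (#A + #X) - 3 * (pairs Y (A.map .inl) (A.map .inl) +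
      pairs Y (X.map .inr) (X.map .inr) + 2 * pairs Y (A.map .inl) (X.map .inr)) := by
    rw [pot_of_disjoint hd2 (T := W), card_map, card_map]
    rw [hWeq]
    rintro (u | i) <;> simp
  have e6 : pot G (R ∪ A) = pot G R + 10 * #A - 3 * pairs G A A - 6 * pairs G A R := by
    rw [pot_of_disjoint hdisj fun x => mem_union, pairs_comm (A := R) (B := A)]
    unfold pot
    ring
  rw [e6, e4]
  rw [e5, e2] at hpot
  nlinarith

end KostochkaYancey

noncomputable section KostochkaYancey

variable {V : Type u} {G H : SimpleGraph V} {S T R A B W : Finset V} {v x y a b : V}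

theorem card_cases {X : Finset (Fin 3)} (hX : X.Nonempty) : #X = 1 ∨ #X = 2 ∨ #X = 3 := by
  have h1 := card_pos.2 hX
  have h2 := card_le_univ X
  simp at h2
  omega

theorem pot_le_of_card_le (h2 : 2 ≤ #T) (h3 : #T ≤ 3) : 12 ≤ pot G T := by
  have := pairs_le (G := G) (T := T)
  unfold pot
  obtain h | h : #T = 2 ∨ #T = 3 := by omega
  all_goals rw [h] at this ⊢; push_cast at this ⊢; omega

theorem IsMinSparse.twelve_le (h : IsMinSparse G S) (hR : R ⊂ S) (hR2 : 2 ≤ #R) :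
    12 ≤ pot G R := by
  induction hn : #S - #R using Nat.strong_induction_on generalizing R with
  | _ n ih =>
  by_cases h3 : #R ≤ 3
  · exact pot_le_of_card_le hR2 h3
  by_contra! hlt
  obtain ⟨φ, hφ⟩ := h.colorableOn hR
  obtain ⟨A, hAS, X, hA, hX, hpot⟩ := h.exists_extension hR (by omega) hφ
  have hp := pairs_nonneg (G := G) (A := A) (B := R.filter fun w => φ w ∉ X)
  have hdisj : Disjoint R A :=
    disjoint_left.2 fun r hr hrA => (mem_sdiff.1 (hAS hrA)).2 hr
  have hcard : #(R ∪ A) = #R + #A := card_union_of_disjoint hdisj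
  have hApos := card_pos.2 hA
  have hsub : R ∪ A ⊆ S := union_subset hR.1 (hAS.trans sdiff_subset)
  have hlt' : pot G (R ∪ A) < 6 := by
    obtain h' | h' | h' := card_cases hX <;> rw [h'] at hpot <;> norm_num at hpot <;> omega
  by_cases hS : R ∪ A = S
  · rw [hS] at hlt'
    have := h.six_le
    omega
  · have hss := hsub.ssubset_of_ne hS
    have := card_lt_card hss
    have := ih _ (by omega) hss (by omega) rfl
    omega

/-- The vertices of `R` with a neighbour in `S \ R`. -/
def boundaryIn (G : SimpleGraph V) (S R : Finset V) : Finset V :=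
  R.filter fun r => ∃ s ∈ S \ R, G.Adj r s

theorem mem_boundaryIn : v ∈ boundaryIn G S R ↔ v ∈ R ∧ ∃ s ∈ S \ R, G.Adj v s := by
  simp [boundaryIn]

theorem IsMinSparse.exists_boundary (h : IsMinSparse G S) (hR : R ⊂ S) (hR2 : 2 ≤ #R) :
    ∃ p ∈ boundaryIn G S R, ∃ q ∈ boundaryIn G S R, p ≠ q := by
  by_contra! hcon
  obtain ⟨p, hp, hb⟩ : ∃ p ∈ R, ∀ q ∈ boundaryIn G S R, q = p := by
    by_cases hne : (boundaryIn G S R).Nonempty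
    · obtain ⟨p, hp⟩ := hne
      exact ⟨p, (mem_boundaryIn.1 hp).1, fun q hq => hcon q hq p hp⟩
    · obtain ⟨p, hp⟩ := card_pos.1 (show 0 < #R by omega)
      exact ⟨p, hp, fun q hq => absurd ⟨q, hq⟩ hne⟩
  obtain ⟨φ, hφ⟩ := h.colorableOn hR
  have hT : insert p (S \ R) ⊂ S := by
    refine ⟨insert_subset (hR.1 hp) sdiff_subset, fun hh => ?_⟩
    obtain ⟨r, hr, hrp⟩ := exists_mem_ne (show 1 < #R by omega) p
    have := hh (hR.1 hr)
    simp [hrp, hr] at this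
  obtain ⟨ψ, hψ⟩ := h.colorableOn hT
  have hpb : ∀ u ∈ R, ∀ w ∈ S, w ∉ R → G.Adj u w → u = p := fun u hu w hw hwR huw =>
    hb u (mem_boundaryIn.2 ⟨hu, w, by simp [hw, hwR], huw⟩)
  have key : ∀ u ∈ R, ∀ w ∈ S, w ∉ R → G.Adj u w → φ u ≠ Equiv.swap (φ p) (ψ p) (ψ w) := by
    intro u hu w hw hwR huw
    obtain rfl := hpb u hu w hw hwR huw
    intro hh
    have h2 : Equiv.swap (φ u) (ψ u) (ψ u) = Equiv.swap (φ u) (ψ u) (ψ w) := by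
      rw [Equiv.swap_apply_right]
      exact hh
    exact hψ u (mem_insert_self _ _) w (by simp [hw, hwR]) huw ((Equiv.swap _ _).injective h2)
  apply h.not_colorable
  refine ⟨fun v => if v ∈ R then φ v else Equiv.swap (φ p) (ψ p) (ψ v), ?_⟩
  intro u hu w hw huw
  by_cases h1 : u ∈ R <;> by_cases h2 : w ∈ R
  · simp only [h1, h2, if_true]
    exact hφ u h1 w h2 huw
  · simp only [h1, h2, if_true, if_false]
    exact key u h1 w hw h2 huw
  · simp only [h1, h2, if_true, if_false]
    exact (key w h2 u hu h1 huw.symm).symm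
  · simp only [h1, h2, if_false]
    exact fun hh => hψ u (by simp [hu, h1]) w (by simp [hw, h2]) huw ((Equiv.swap _ _).injective hh)

theorem pairs_sup_edge_le (p q : V) :
    pairs (G ⊔ SimpleGraph.edge p q) T T ≤ pairs G T T + 2 := by
  by_cases hpq : p = q
  · subst hpq
    simp
  have h1 : ∀ u ∈ T, (degIn (G ⊔ SimpleGraph.edge p q) T u : ℤ) ≤
      degIn G T u + ((if u = p then 1 else 0) + if u = q then 1 else 0) := by
    intro u _
    have : degIn (G ⊔ SimpleGraph.edge p q) T u ≤ #(T.filter (G.Adj u) ∪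
        ((if u = p then {q} else ∅) ∪ if u = q then {p} else ∅)) := by
      refine card_le_card fun w => ?_
      simp only [mem_filter, SimpleGraph.sup_adj, SimpleGraph.edge_adj, mem_union]
      rintro ⟨hw, h | ⟨⟨rfl, rfl⟩ | ⟨rfl, rfl⟩, -⟩⟩
      · exact .inl ⟨hw, h⟩
      · simp
      · simp
    have h2 := this.trans ((card_union_le _ _).trans
      (Nat.add_le_add_left (card_union_le _ _) _))
    have h3 : #(if u = p then ({q} : Finset V) else ∅) = if u = p then 1 else 0 := by
      split_ifs <;> simp
    have h4 : #(if u = q then ({p} : Finset V) else ∅) = if u = q then 1 else 0 := by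
      split_ifs <;> simp
    rw [h3, h4] at h2
    unfold degIn at h2 ⊢
    exact_mod_cast h2
  have h5 : ∀ r : V, (∑ u ∈ T, if u = r then (1 : ℤ) else 0) ≤ 1 := fun r => by
    rw [sum_ite_eq']
    split_ifs <;> simp
  calc _ ≤ _ := sum_le_sum h1
    _ ≤ _ := by
      rw [sum_add_distrib, sum_add_distrib]
      have := h5 p
      have := h5 q
      unfold pairs
      omega

theorem IsMinSparse.fourteen_le (h : IsMinSparse G S) (hR : R ⊂ S) (hR4 : 4 ≤ #R) :
    14 ≤ pot G R := by
  by_contra! hlt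
  obtain ⟨p, hp, q, hq, hpq⟩ := h.exists_boundary hR (by omega)
  obtain ⟨hpR, s, hs, hps⟩ := mem_boundaryIn.1 hp
  obtain ⟨hqR, t, ht, hqt⟩ := mem_boundaryIn.1 hq
  have hcol : ColorableOn (G ⊔ SimpleGraph.edge p q) R := by
    by_contra hcon
    obtain ⟨W, hWR, hW, hpot⟩ := h.ih _ _ R (card_lt_card hR) hcon
    have h4 := four_le_card_of_not_colorableOn hW
    have h12 := h.twelve_le (hWR.trans_ssubset hR) (by omega)
    have := pairs_sup_edge_le (G := G) (T := W) p q
    unfold pot at h12 hpot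
    omega
  obtain ⟨φ, hφ⟩ := hcol
  have hne : φ p ≠ φ q := hφ p hpR q hqR (by simp [SimpleGraph.edge_adj, hpq])
  obtain ⟨A, hAS, X, hA, hX, hpot⟩ := h.exists_extension hR (by omega)
    fun u hu v hv huv => hφ u hu v hv (.inl huv)
  have hp0 := pairs_nonneg (G := G) (A := A) (B := R.filter fun w => φ w ∉ X)
  have hdisj : Disjoint R A :=
    disjoint_left.2 fun r hr hrA => (mem_sdiff.1 (hAS hrA)).2 hr
  have hcard : #(R ∪ A) = #R + #A := card_union_of_disjoint hdisj
  have hsub : R ∪ A ⊆ S := union_subset hR.1 (hAS.trans sdiff_subset)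
  have hlt' : pot G (R ∪ A) < 12 := by
    obtain h' | h' | h' := card_cases hX <;> rw [h'] at hpot <;> norm_num at hpot <;> omega
  have hS : R ∪ A = S := by
    by_contra hS
    have := h.twelve_le (hsub.ssubset_of_ne hS) (by omega)
    omega
  have h6 := h.six_le
  rw [hS] at hpot
  have hp1 : pairs G A (R.filter fun w => φ w ∉ X) = 0 := by
    obtain h' | h' | h' := card_cases hX <;> rw [h'] at hpot <;> norm_num at hpot <;> omega
  have hX1 : #X = 1 := by
    obtain h' | h' | h' := card_cases hX
    · exact h'
    all_goals rw [h'] at hpot; norm_num at hpot; omega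
  have hmem : ∀ r ∈ R, ∀ s ∈ S \ R, G.Adj r s → φ r ∈ X := by
    intro r hr s hs hrs
    by_contra hrX
    have hsA : s ∈ A := by
      obtain ⟨h1, h2⟩ := mem_sdiff.1 hs
      rw [← hS, mem_union] at h1
      exact h1.resolve_left h2
    have h0 := (sum_eq_zero_iff_of_nonneg fun _ _ => by positivity).1 hp1 s hsA
    have h0' : degIn G (R.filter fun w => φ w ∉ X) s = 0 := by exact_mod_cast h0
    rw [degIn, card_eq_zero] at h0'
    have : r ∈ (R.filter fun w => φ w ∉ X).filter (G.Adj s) := by simp [hr, hrX, hrs.symm]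
    rw [h0'] at this
    simp at this
  exact hne (card_le_one.1 hX1.le _ (hmem p hpR s hs hps) _ (hmem q hqR t ht hqt))

theorem IsMinSparse.pairs_lt_ten (h : IsMinSparse G S) (hT : T ⊆ S) (hT4 : #T = 4) :
    pairs G T T < 10 := by
  by_contra! hcon
  by_cases hTS : T = S
  · subst hTS
    have h1 : ∑ v ∈ T, (3 : ℤ) ≤ pairs G T T :=
      sum_le_sum fun v hv => by exact_mod_cast h.three_le_degIn hv
    have h2 := h.six_le
    unfold pot at h2
    rw [sum_const, hT4] at h1
    rw [hT4] at h2
    norm_num at h1 h2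
    omega
  · have := h.twelve_le (hT.ssubset_of_ne hTS) (by omega)
    unfold pot at this
    rw [hT4] at this
    norm_num at this
    omega

/-- The graph in which `a` additionally receives all neighbours of `b`. -/
def absorb (G : SimpleGraph V) (a b : V) : SimpleGraph V :=
  SimpleGraph.fromRel fun u v => G.Adj u v ∨ u = a ∧ G.Adj b v

theorem absorb_adj {u v : V} : (absorb G a b).Adj u v ↔
    u ≠ v ∧ (G.Adj u v ∨ u = a ∧ G.Adj b v ∨ v = a ∧ G.Adj b u) := by
  rw [absorb, SimpleGraph.fromRel_adj, G.adj_comm v u]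
  tauto

theorem IsMinSparse.adj_of_degIn_eq_three (h : IsMinSparse G S) (hx : x ∈ S) (hy : y ∈ S)
    (ha : a ∈ S) (hb : b ∈ S) (hxy : G.Adj x y) (hab : a ≠ b)
    (hNx : ∀ w ∈ S, G.Adj x w → w = y ∨ w = a ∨ w = b) (hxa : G.Adj x a) (hxb : G.Adj x b)
    (hya : y ≠ a) (hyb : y ≠ b) (hdy : degIn G S y = 3) : G.Adj a b := by
  by_contra hnab
  set T := ((S.erase x).erase y).erase b with hT
  have hyx : y ≠ x := hxy.ne'
  have hTS : T ⊆ S := fun w hw => by simp [hT] at hw; exact hw.2.2.2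
  have hTcard : #T < #S := card_lt_card ⟨hTS, fun hh => by have := hh hb; simp [hT] at this⟩
  have hnot : ¬ ColorableOn (absorb G a b) T := by
    rintro ⟨φ, hφ⟩
    -- pull back to `S` without `x` and `y`
    have h1 : ∀ u ∈ insert b T, ∀ w ∈ insert b T, G.Adj u w →
        Function.update φ b (φ a) u ≠ Function.update φ b (φ a) w := by
      refine colorableOn_insert (fun u hu w hw huw => hφ u hu w hw ?_) fun u hu hbu => ?_
      · exact absorb_adj.2 ⟨huw.ne, .inl huw⟩
      · have hua : u ≠ a := by
          rintro rfl
          exact hnab hbu.symm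
        refine hφ u hu a ?_ (absorb_adj.2 ⟨hua, .inr (.inr ⟨rfl, hbu⟩)⟩)
        simp [hT, hab, hya.symm, hxa.ne', ha]
    set φ1 := Function.update φ b (φ a) with hφ1
    -- the vertex `y`
    have hdy' : #(((S.filter (G.Adj y)).erase x).image φ1) < 3 := by
      refine card_image_le.trans_lt ?_
      rw [card_erase_of_mem (by simp [hx, hxy.symm])]
      unfold degIn at hdy
      omega
    obtain ⟨c, hc⟩ := exists_color_of_card_lt hdy'
    have h2 := colorableOn_insert (v := y) (c := c) h1 fun u hu hyu h' => hc <| by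
      rw [mem_image]
      refine ⟨u, ?_, h'⟩
      have hu' : u ≠ x ∧ u ∈ S := by
        rw [mem_insert] at hu
        obtain rfl | hu := hu
        · exact ⟨hxb.ne', hb⟩
        · simp [hT] at hu
          exact hu.2.2
      simp [hu'.1, hu'.2, hyu]
    set φ2 := Function.update φ1 y c with hφ2
    have hφab : φ2 a = φ2 b := by
      rw [hφ2, Function.update_of_ne hya.symm, Function.update_of_ne hyb.symm, hφ1,
        Function.update_self, Function.update_of_ne hab]
    obtain ⟨c', hc'⟩ := exists_color_of_card_lt (t := {φ2 a, φ2 y})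
      (card_le_two.trans_lt (by norm_num))
    have h3 := colorableOn_insert (v := x) (c := c') h2 fun u hu hxu h' => hc' <| by
      have huS : u ∈ S := by
        simp only [mem_insert] at hu
        obtain rfl | rfl | hu := hu
        exacts [hy, hb, hTS hu]
      rw [← h']
      obtain rfl | rfl | rfl := hNx u huS hxu
      · simp
      · simp
      · simp [hφab]
    refine h.not_colorable ⟨_, fun u hu w hw huw => h3 u ?_ w ?_ huw⟩
    · simp [hT, hu]; tauto
    · simp [hT, hw]; tauto
  obtain ⟨W, hWT, hW, hpot⟩ := h.ih _ _ T hTcard hnot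
  have hW4 := four_le_card_of_not_colorableOn hW
  have hWm : ∀ w ∈ W, w ≠ b ∧ w ≠ y ∧ w ≠ x ∧ w ∈ S := fun w hw => by
    simpa [hT] using hWT hw
  have hxW : x ∉ W := fun hh => (hWm x hh).2.2.1 rfl
  have hbW : b ∉ W := fun hh => (hWm b hh).1 rfl
  have hyW : y ∉ W := fun hh => (hWm y hh).2.1 rfl
  by_cases haW : a ∈ W
  · set R := insert x (insert b W) with hR
    have hyR : y ∉ R := by simp [hR, hyx, hyb, hyW]
    have hRS : R ⊂ S := by
      refine ⟨?_, fun hh => hyR (hh hy)⟩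
      exact insert_subset hx (insert_subset hb fun w hw => (hWm w hw).2.2.2)
    have hRcard : #W + 1 ≤ #R := by
      rw [hR, ← card_insert_of_notMem hbW]
      exact card_le_card (subset_insert _ _)
    have h14 := h.fourteen_le hRS (by omega)
    have hxbW : x ∉ insert b W := by simp [hxb.ne, hxW]
    have h2 : 2 ≤ degIn G (insert b W) x := by
      unfold degIn
      rw [← card_pair hab]
      refine card_le_card fun w hw => ?_
      simp only [mem_insert, mem_singleton] at hw
      obtain rfl | rfl := hw <;> simp [haW, hxa, hxb]
    -- removing `a` leaves both graphs equal
    have haE : a ∉ W.erase a := by simp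
    have hWa : insert a (W.erase a) = W := insert_erase haW
    have e1 : pot (absorb G a b) W = pot (absorb G a b) (W.erase a) + 10 -
        6 * degIn (absorb G a b) (W.erase a) a := by
      conv_lhs => rw [← hWa]
      exact pot_insert haE
    have e2 : pot G W = pot G (W.erase a) + 10 - 6 * degIn G (W.erase a) a := by
      conv_lhs => rw [← hWa]
      exact pot_insert haE
    have e3 : pot (absorb G a b) (W.erase a) = pot G (W.erase a) := by
      unfold pot pairs degIn
      congr 2
      refine sum_congr rfl fun u hu => ?_
      congr 2
      refine filter_congr fun w hw => ?_
      rw [absorb_adj]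
      have := ne_of_mem_erase hu
      have := ne_of_mem_erase hw
      constructor
      · tauto
      · exact fun hh => ⟨hh.ne, .inl hh⟩
    have e4 : degIn (absorb G a b) (W.erase a) a ≤ degIn G (W.erase a) a + degIn G W b := by
      refine le_trans (card_le_card (t := (W.erase a).filter (G.Adj a) ∪ W.filter (G.Adj b)) ?_)
        (card_union_le _ _)
      intro w hw
      simp only [mem_filter, mem_erase, absorb_adj, mem_union] at hw ⊢
      tauto
    have e5 := pot_insert (G := G) hbW
    have e6 := pot_insert (G := G) hxbW
    rw [← hR] at e6
    have e4' : (degIn (absorb G a b) (W.erase a) a : ℤ) ≤ degIn G (W.erase a) a + degIn G W b := by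
      exact_mod_cast e4
    omega
  · refine hW ?_
    have hss : W ⊂ S := ⟨hWT.trans hTS, fun hh => hxW (hh hx)⟩
    obtain ⟨φ, hφ⟩ := h.colorableOn hss
    refine ⟨φ, fun u hu w hw huw => hφ u hu w hw ?_⟩
    rw [absorb_adj] at huw
    obtain ⟨-, h1 | ⟨rfl, -⟩ | ⟨rfl, -⟩⟩ := huw
    · exact h1
    · exact absurd hu haW
    · exact absurd hw haW

theorem IsMinSparse.card_filter_le_one (h : IsMinSparse G S) (hx : x ∈ S)
    (hdx : degIn G S x = 3) : #((S.filter (G.Adj x)).filter fun w => degIn G S w = 3) ≤ 1 := by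
  rw [card_le_one]
  by_contra! hcon
  obtain ⟨y, hy, z, hz, hyz⟩ := hcon
  simp only [mem_filter] at hy hz
  obtain ⟨⟨hyS, hxy⟩, hdy⟩ := hy
  obtain ⟨⟨hzS, hxz⟩, hdz⟩ := hz
  have hsub : {y, z} ⊆ S.filter (G.Adj x) := by
    intro w
    simp only [mem_insert, mem_singleton, mem_filter]
    rintro (rfl | rfl) <;> simp [*]
  obtain ⟨a, ha⟩ : ((S.filter (G.Adj x)) \ {y, z}).Nonempty := by
    rw [← card_pos, card_sdiff_of_subset hsub, card_pair hyz]
    unfold degIn at hdx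
    omega
  simp only [mem_sdiff, mem_filter, mem_insert, mem_singleton, not_or] at ha
  obtain ⟨⟨haS, hxa⟩, hay, haz⟩ := ha
  have hc3 : #({y, z, a} : Finset V) = 3 := card_eq_three.2 ⟨y, z, a, hyz, Ne.symm hay, Ne.symm haz, rfl⟩
  have hN : S.filter (G.Adj x) = {y, z, a} := by
    symm
    refine eq_of_subset_of_card_le ?_ (by rw [hc3]; exact hdx.le)
    intro w
    simp only [mem_insert, mem_singleton, mem_filter]
    rintro (rfl | rfl | rfl) <;> simp [*]
  have hNx : ∀ w ∈ S, G.Adj x w → w = y ∨ w = z ∨ w = a := fun w hw hxw => by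
    have : w ∈ S.filter (G.Adj x) := by simp [hw, hxw]
    simpa [hN] using this
  have hza : G.Adj z a := h.adj_of_degIn_eq_three hx hyS hzS haS hxy (Ne.symm haz) hNx hxz hxa hyz
    (Ne.symm hay) hdy
  have hya : G.Adj y a := h.adj_of_degIn_eq_three hx hzS hyS haS hxz (Ne.symm hay)
    (fun w hw hxw => by have := hNx w hw hxw; tauto) hxy hxa hyz.symm (Ne.symm haz) hdz
  have h1 : x ∉ ({y, z, a} : Finset V) := by simp [hxy.ne, hxz.ne, hxa.ne]
  have h2 : a ∉ ({y, z} : Finset V) := by simp [hay, haz]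
  have hT : insert x ({y, z, a} : Finset V) ⊆ S := by
    intro w
    simp only [mem_insert, mem_singleton]
    rintro (rfl | rfl | rfl | rfl) <;> assumption
  have h10 := h.pairs_lt_ten hT (by rw [card_insert_of_notMem h1, hc3])
  rw [pairs_insert h1, show ({y, z, a} : Finset V) = insert a {y, z} by ext; simp; tauto,
    pairs_insert h2] at h10
  have d1 : degIn G (insert a {y, z}) x = 3 := by
    unfold degIn
    rw [filter_true_of_mem, ← hc3]
    · congr 1; ext; simp; tauto
    · intro w
      simp only [mem_insert, mem_singleton]
      rintro (rfl | rfl | rfl) <;> assumption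
  have d2 : degIn G {y, z} a = 2 := by
    unfold degIn
    rw [filter_true_of_mem, card_pair hyz]
    intro w
    simp only [mem_insert, mem_singleton]
    rintro (rfl | rfl)
    exacts [hya.symm, hza.symm]
  rw [d1, d2] at h10
  have := pairs_nonneg (G := G) (A := {y, z}) (B := {y, z})
  push_cast at h10
  omega

theorem not_isMinSparse : ¬ IsMinSparse G S := by
  intro h
  have h6 := h.six_le
  -- every vertex of degree at least four sends charge one to each neighbour of degree three
  set g : V → V → ℤ := fun u v =>
    if G.Adj u v ∧ 4 ≤ degIn G S u ∧ degIn G S v = 3 then 1 else 0 with hg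
  have hbal : ∑ v ∈ S, ∑ w ∈ S, g v w = ∑ v ∈ S, ∑ w ∈ S, g w v := sum_comm
  have hv : ∀ v ∈ S, (0 : ℤ) ≤ 6 * degIn G S v - 20 - ∑ w ∈ S, g v w + ∑ w ∈ S, g w v := by
    intro v hv
    have hin : 0 ≤ ∑ w ∈ S, g w v := sum_nonneg fun w _ => by
      simp only [hg]; split_ifs <;> simp
    by_cases h4 : 4 ≤ degIn G S v
    · have : ∑ w ∈ S, g v w ≤ degIn G S v := by
        rw [degIn_eq_sum]
        refine sum_le_sum fun w _ => ?_
        simp only [hg]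
        split_ifs <;> simp_all
      omega
    · have h3 : degIn G S v = 3 := by
        have := h.three_le_degIn hv
        omega
      have hout : ∑ w ∈ S, g v w = 0 := sum_eq_zero fun w _ => by simp [hg, h4]
      have h1 := h.card_filter_le_one hv h3
      have h2 : ∑ w ∈ S, g w v =
          #((S.filter (G.Adj v)).filter fun w => ¬ degIn G S w = 3) := by
        simp only [hg]
        rw [sum_boole, filter_filter]
        congr 2
        refine filter_congr fun w hw => ?_
        have := h.three_le_degIn hw
        rw [G.adj_comm]
        constructor
        · rintro ⟨h1, h2, -⟩
          exact ⟨h1, by omega⟩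
        · rintro ⟨h1, h2⟩
          exact ⟨h1, by omega, h3⟩
      have h5 := card_filter_add_card_filter_not (s := S.filter (G.Adj v))
        (fun w => degIn G S w = 3)
      unfold degIn at h3
      have h3' : degIn G S v = 3 := h3
      rw [h2, hout, h3']
      omega
  have hsum := sum_nonneg hv
  rw [sum_add_distrib, sum_sub_distrib, sum_sub_distrib, hbal, ← mul_sum, sum_const] at hsum
  unfold pot pairs at h6
  simp only [nsmul_eq_mul] at hsum
  omega

theorem exists_sparse_of_not_colorableOn (h : ¬ ColorableOn G S) :
    ∃ W ⊆ S, ¬ ColorableOn G W ∧ pot G W ≤ 4 := by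
  induction hn : #S using Nat.strong_induction_on generalizing V with
  | _ n ih =>
  by_contra! hcon
  exact not_isMinSparse (G := G) (S := S)
    ⟨h, hcon, fun V' H T hT hH => ih _ (hn ▸ hT) hH rfl⟩

end KostochkaYancey

noncomputable section ShortFace

variable {V : Type u} [Fintype V] {G H : SimpleGraph V} {a b c d x y : V} {W : Finset V}

theorem darts_eq_two_mul : darts G = 2 * Fintype.card G.edgeSet := by
  rw [← SimpleGraph.edgeFinset_card, ← SimpleGraph.sum_degrees_eq_twice_card_edges]
  unfold darts
  rw [card_filter, ← univ_product_univ, sum_product]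
  refine sum_congr rfl fun v _ => ?_
  rw [← card_filter, ← SimpleGraph.card_neighborFinset_eq_degree,
    SimpleGraph.neighborFinset_eq_filter]

theorem card_edgeSet_le_finrank_chains :
    Fintype.card G.edgeSet ≤ Module.finrank (ZMod 2) (chains G) := by
  let L : chains G →ₗ[ZMod 2] (G.edgeSet → ZMod 2) :=
    { toFun := fun f e => f.1 (Quot.out e.1).1 (Quot.out e.1).2
      map_add' := fun f g => rfl
      map_smul' := fun r f => rfl }
  have hL : Function.Surjective L := by
    intro g
    refine ⟨⟨fun u v => if h : s(u, v) ∈ G.edgeSet then g ⟨s(u, v), h⟩ else 0, ?_, ?_⟩, ?_⟩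
    · intro u v
      simp only [Sym2.eq_swap (a := u) (b := v)]
    · intro u v h
      exact dif_neg (by rwa [SimpleGraph.mem_edgeSet])
    · funext e
      have he : s((Quot.out e.1).1, (Quot.out e.1).2) = e.1 := Quot.out_eq e.1
      have hm := e.2
      simp only [L, LinearMap.coe_mk, AddHom.coe_mk]
      rw [dif_pos (by rw [he]; exact hm)]
      congr 1
      exact Subtype.ext he
  have := LinearMap.finrank_le_finrank_of_surjective hL
  rwa [Module.finrank_fintype_fun_eq_card] at this

theorem card_edgeSet_add_one_le (hne : W.Nonempty) (hW : ∀ u v, G.Adj u v → u ∈ W) :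
    Fintype.card G.edgeSet + 1 ≤ Module.finrank (ZMod 2) (cycles G) + #W := by
  obtain ⟨w, hw⟩ := hne
  let L : chains G →ₗ[ZMod 2] (↥(W.erase w) → ZMod 2) :=
    LinearMap.funLeft (ZMod 2) (ZMod 2) (Subtype.val : ↥(W.erase w) → V) ∘ₗ bd ∘ₗ
      (chains G).subtype
  have h1 := L.finrank_range_add_finrank_ker
  have h2 : Module.finrank (ZMod 2) (LinearMap.range L) ≤ #(W.erase w) := by
    refine (Submodule.finrank_le _).trans ?_
    rw [Module.finrank_fintype_fun_eq_card, Fintype.card_coe]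
  have h3 : Module.finrank (ZMod 2) (LinearMap.ker L) ≤ Module.finrank (ZMod 2) (cycles G) := by
    rw [LinearEquiv.finrank_eq (Submodule.equivMapOfInjective (chains G).subtype
      (Submodule.injective_subtype _) (LinearMap.ker L))]
    refine Submodule.finrank_mono ?_
    rintro _ ⟨f, hf, rfl⟩
    refine ⟨f.2, ?_⟩
    have hf' : ∀ v ∈ W, v ≠ w → bd f.1 v = 0 := fun v hv hvw =>
      congrFun (show L f = 0 from hf) ⟨v, mem_erase.2 ⟨hvw, hv⟩⟩
    have hout : ∀ v, v ∉ W → bd f.1 v = 0 := fun v hv =>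
      sum_eq_zero fun u _ => f.2.2 v u fun h => hv (hW v u h)
    have hrest : ∀ v, v ≠ w → bd f.1 v = 0 := fun v hvw => by
      by_cases hv : v ∈ W
      exacts [hf' v hv hvw, hout v hv]
    change bd f.1 = 0
    funext v
    by_cases hvw : v = w
    · subst hvw
      have hs := bd_sum_univ f.2
      rwa [sum_eq_single v (fun u _ hu => hrest u hu) (by simp)] at hs
    · exact hrest v hvw
  have h4 := card_edgeSet_le_finrank_chains (G := G)
  rw [card_erase_of_mem hw] at h2
  have := card_pos.2 ⟨w, hw⟩
  omega

/-- The number of ordered pairs in the support of a chain. -/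
def size (f : Chain V) : ℕ := #(univ.filter fun p : V × V => f p.1 p.2 ≠ 0)

theorem add_edge_symm {f : Chain V} (hs : ∀ u v, f u v = f v u) (u v : V) :
    (f + edge a b) u v = (f + edge a b) v u := by
  simp only [Pi.add_apply, hs u v, edge_symm a b u v]

theorem size_add_edge_lt {f : Chain V} (hs : ∀ u v, f u v = f v u) (hab : a ≠ b)
    (h : f a b ≠ 0) : size (f + edge a b) + 2 ≤ size f := by
  unfold size
  have h1 : (a, b) ∉ insert (b, a)
      (univ.filter fun p : V × V => (f + edge a b) p.1 p.2 ≠ 0) := by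
    simp [hab, edge_apply_self, zmod_two_eq_one h, zmod_two_add_self]
  have h2 : (b, a) ∉ (univ.filter fun p : V × V => (f + edge a b) p.1 p.2 ≠ 0) := by
    have := zmod_two_eq_one h
    rw [hs] at this
    simp [edge_symm a b b a, hab, edge_apply_self, this, zmod_two_add_self]
  calc _ = #(insert (a, b) (insert (b, a)
        (univ.filter fun p : V × V => (f + edge a b) p.1 p.2 ≠ 0))) := by
        rw [card_insert_of_notMem h1, card_insert_of_notMem h2]
    _ ≤ _ := by
      refine card_le_card ?_
      intro p hp
      simp only [mem_insert, mem_filter, mem_univ, true_and] at hp ⊢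
      obtain rfl | rfl | hp := hp
      · exact h
      · rwa [hs] at h
      · by_cases he : edge a b p.1 p.2 = 0
        · simpa [he] using hp
        · rcases (edge_ne_zero he).2 with ⟨h1, h2⟩ | ⟨h1, h2⟩
          · rwa [h1, h2]
          · rwa [h1, h2, ← hs]

theorem exists_other_of_cycles {Q : Chain V} (hQ : Q ∈ cycles G) {p u : V} (h : Q p u ≠ 0) :
    ∃ w, w ≠ u ∧ Q p w ≠ 0 := by
  by_contra! hcon
  have := sum_row_of_cycles hQ p
  rw [sum_eq_single u (fun w _ hw => hcon w hw) (by simp)] at this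
  exact h this

/-- The `4`-cycle through the given vertices. -/
def fourCycle (a b c d : V) : Chain V := edge a b + edge b c + edge c d + edge d a

theorem eq_fourCycle_of_size_lt {Q : Chain V} (hQ : Q ∈ cycles G) (h0 : Q ≠ 0)
    (hs : size Q < 10) (ht : ∀ a b c, G.Adj a b → G.Adj b c → ¬ G.Adj a c) :
    ∃ a b c d, G.Adj a b ∧ G.Adj b c ∧ G.Adj c d ∧ G.Adj d a ∧ a ≠ c ∧ b ≠ d ∧
      Q = fourCycle a b c d := by
  have hsym : ∀ u v, Q u v = Q v u := hQ.1.1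
  have hadj : ∀ {u v}, Q u v ≠ 0 → G.Adj u v := fun {u v} h => by
    by_contra hh
    exact h (hQ.1.2 u v hh)
  obtain ⟨a, b, hab⟩ : ∃ a b, Q a b ≠ 0 := by
    by_contra! hcon
    exact h0 (by funext u v; exact hcon u v)
  have hba : Q b a ≠ 0 := by rwa [hsym]
  obtain ⟨c, hca, hbc⟩ := exists_other_of_cycles hQ hba
  obtain ⟨d, hdb, had⟩ := exists_other_of_cycles hQ hab
  have hda : Q d a ≠ 0 := by rwa [hsym]
  have hcb : Q c b ≠ 0 := by rwa [hsym]
  have nab := (hadj hab).ne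
  have nbc := (hadj hbc).ne
  have nad := (hadj had).ne
  have ncd : c ≠ d := by
    rintro rfl
    exact ht a b c (hadj hab) (hadj hbc) (hadj had)
  have hQ1 := add_edge_symm (a := a) (b := b) hsym
  have hQ2 := add_edge_symm (a := b) (b := c) hQ1
  have hQ3 := add_edge_symm (a := d) (b := a) hQ2
  have s1 := size_add_edge_lt hsym nab hab
  have s2 := size_add_edge_lt (a := b) (b := c) hQ1 nbc (by
    simpa [edge_apply_of_ne_right hca nbc.symm] using hbc)
  have s3 := size_add_edge_lt (a := d) (b := a) hQ2 nad.symm (by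
    simpa [edge_apply_of_ne nad.symm hdb, edge_apply_of_ne hdb ncd.symm] using hda)
  by_cases hcd : Q c d = 0
  · exfalso
    obtain ⟨x, hxb, hcx⟩ := exists_other_of_cycles hQ hcb
    obtain ⟨y, hya, hdy⟩ := exists_other_of_cycles hQ hda
    have hdc : Q d c = 0 := by rwa [hsym]
    have hxd : x ≠ d := by rintro rfl; exact hcx hcd
    have hyc : y ≠ c := by rintro rfl; exact hdy hdc
    have ncx := (hadj hcx).ne
    have ndy := (hadj hdy).ne
    have hxa : x ≠ a := by
      rintro rfl
      exact ht x b c (hadj hab) (hadj hbc) (hadj hcx).symm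
    have s4 := size_add_edge_lt (a := c) (b := x) hQ3 ncx (by
      simpa [edge_apply_of_ne hca nbc.symm, edge_apply_of_ne_right hxb ncx.symm,
        edge_apply_of_ne ncd hca] using hcx)
    have hQ4 := add_edge_symm (a := c) (b := x) hQ3
    have s5 := size_add_edge_lt (a := d) (b := y) hQ4 ndy (by
      simpa [edge_apply_of_ne nad.symm hdb, edge_apply_of_ne hdb ncd.symm,
        edge_apply_of_ne_right (a := d) ndy.symm hya, edge_apply_of_ne ncd.symm hxd.symm]
        using hdy)
    omega
  · refine ⟨a, b, c, d, hadj hab, hadj hbc, hadj hcd, hadj hda, hca.symm, hdb.symm, ?_⟩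
    have h4 : (Q + edge a b + edge b c + edge d a) c d ≠ 0 := by
      simpa [edge_apply_of_ne hca nbc.symm, edge_apply_of_ne_right hdb ncd.symm,
        edge_apply_of_ne ncd hca] using hcd
    have s4 := size_add_edge_lt (a := c) (b := d) hQ3 ncd h4
    set P := Q + edge a b + edge b c + edge d a + edge c d with hP
    have hP0 : P = 0 := by
      by_contra hne
      obtain ⟨u, v, huv⟩ : ∃ u v, P u v ≠ 0 := by
        by_contra! hcon
        exact hne (by funext u v; exact hcon u v)
      have hPsym : ∀ u v, P u v = P v u := add_edge_symm (a := c) (b := d) hQ3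
      have hPuv : u ≠ v := by
        rintro rfl
        apply huv
        have : Q u u = 0 := hQ.1.2 u u (G.loopless.irrefl u)
        have he : ∀ p q : V, edge p q u u = 0 := fun p q => by
          by_contra hh
          exact (edge_ne_zero hh).1 rfl
        simp [hP, this, he]
      have := size_add_edge_lt hPsym hPuv huv
      omega
    funext u v
    have := congrFun (congrFun hP0 u) v
    simp only [hP, fourCycle, Pi.add_apply, Pi.zero_apply] at this ⊢
    grind

theorem IsPlaneFamily.finrank_le {ι : Type} [Fintype ι] {F : ι → Chain V}
    (hF : IsPlaneFamily G F) :
    Module.finrank (ZMod 2) (cycles G) ≤ #(univ.filter fun i => F i ≠ 0) := by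
  have : cycles G ≤ Submodule.span (ZMod 2)
      (((univ.filter fun i => F i ≠ 0).image F : Finset (Chain V)) : Set (Chain V)) := by
    intro Q hQ
    obtain ⟨t, rfl⟩ := hF.span Q hQ
    rw [comb_eq_sum]
    refine sum_mem fun i _ => Submodule.smul_mem _ _ ?_
    by_cases hi : F i = 0
    · rw [hi]; exact zero_mem _
    · exact Submodule.subset_span (by simp only [coe_image]; exact ⟨i, by simp [hi], rfl⟩)
  exact (Submodule.finrank_mono this).trans
    ((finrank_span_finset_le_card _).trans card_image_le)

theorem IsPlaneFamily.sum_size_le {ι : Type} [Fintype ι] {F : ι → Chain V}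
    (hF : IsPlaneFamily G F) : ∑ i, size (F i) ≤ 2 * darts G := by
  have h1 : ∀ i, size (F i) = ∑ p ∈ univ.filter (fun p : V × V => G.Adj p.1 p.2),
      if F i p.1 p.2 ≠ 0 then 1 else 0 := by
    intro i
    unfold size
    rw [← card_filter, filter_filter]
    congr 1
    refine filter_congr fun p _ => ⟨fun h => ⟨?_, h⟩, And.right⟩
    by_contra hh
    exact h ((hF.mem i).1.2 _ _ hh)
  simp only [h1]
  rw [sum_comm, mul_comm, darts, ← smul_eq_mul]
  refine sum_le_card_nsmul _ _ _ fun p _ => ?_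
  rw [← card_filter]
  exact hF.card_le p.1 p.2

theorem IsPlaneFamily.exists_fourCycle {ι : Type} [Fintype ι] {F : ι → Chain V}
    (hF : IsPlaneFamily G F) (ht : ∀ a b c, G.Adj a b → G.Adj b c → ¬ G.Adj a c)
    (hne : W.Nonempty) (hW : ∀ u v, G.Adj u v → u ∈ W) (hcard : 10 * #W ≤ 3 * darts G + 4) :
    ∃ i a b c d, G.Adj a b ∧ G.Adj b c ∧ G.Adj c d ∧ G.Adj d a ∧ a ≠ c ∧ b ≠ d ∧
      F i = fourCycle a b c d := by
  by_contra! hcon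
  have h1 : ∀ i ∈ univ.filter (fun i => F i ≠ 0), 10 ≤ size (F i) := by
    intro i hi
    by_contra! hlt
    obtain ⟨a, b, c, d, h1, h2, h3, h4, h5, h6, h7⟩ :=
      eq_fourCycle_of_size_lt (hF.mem i) (by simpa using hi) hlt ht
    exact hcon i a b c d h1 h2 h3 h4 h5 h6 h7
  have h2 := card_nsmul_le_sum _ _ _ h1
  have h3 : ∑ i ∈ univ.filter (fun i => F i ≠ 0), size (F i) ≤ ∑ i, size (F i) :=
    sum_le_sum_of_subset (subset_univ _)
  have h4 := hF.sum_size_le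
  have h5 := hF.finrank_le
  have h6 := card_edgeSet_add_one_le hne hW
  rw [darts_eq_two_mul] at h4 hcard
  rw [smul_eq_mul] at h2
  omega

end ShortFace

noncomputable section Identification

variable {V : Type u} [Fintype V] {G H : SimpleGraph V} {a b c d x y : V}

/-- The map sending `c` to `a` and fixing all other vertices. -/
def retract (a c v : V) : V := if v = c then a else v

/-- The graph obtained by identifying `c` with `a`; the vertex `c` becomes isolated. -/
def mergeGraph (G : SimpleGraph V) (a c : V) : SimpleGraph V where
  Adj u v := u ≠ v ∧ ∃ u' v', G.Adj u' v' ∧ retract a c u' = u ∧ retract a c v' = v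
  symm := ⟨fun _ _ ⟨h, u', v', h1, h2, h3⟩ => ⟨h.symm, v', u', h1.symm, h3, h2⟩⟩
  loopless := ⟨fun _ h => h.1 rfl⟩

theorem not_mergeGraph_adj_right (hac : a ≠ c) (u : V) : ¬ (mergeGraph G a c).Adj u c := by
  rintro ⟨-, u', v', -, -, h⟩
  unfold retract at h
  split_ifs at h with h'
  exacts [hac h, h' h]

theorem mergeGraph_adj_of_ne {u v : V} (hu : u ≠ a) (hv : v ≠ a) :
    (mergeGraph G a c).Adj u v → G.Adj u v := by
  rintro ⟨-, u', v', h, h1, h2⟩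
  unfold retract at h1 h2
  split_ifs at h1 h2 with h3 h4 h4
  · exact absurd h1.symm hu
  · exact absurd h1.symm hu
  · exact absurd h2.symm hv
  · rwa [h1, h2] at h

theorem mergeGraph_adj_left {v : V} (hv : v ≠ a) :
    (mergeGraph G a c).Adj a v → G.Adj a v ∨ G.Adj c v := by
  rintro ⟨-, u', v', h, h1, h2⟩
  unfold retract at h1 h2
  split_ifs at h1 h2 with h3 h4 h4
  · exact absurd h2.symm hv
  · subst h3 h2
    exact .inr h
  · exact absurd h2.symm hv
  · subst h1 h2
    exact .inl h

theorem colorableOn_of_mergeGraph (hac : ¬ G.Adj a c)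
    (h : ColorableOn (mergeGraph G a c) univ) : ColorableOn G univ := by
  obtain ⟨φ, hφ⟩ := h
  refine ⟨φ ∘ retract a c, fun u _ v _ huv => hφ _ (mem_univ _) _ (mem_univ _) ⟨?_, u, v, huv, rfl,
    rfl⟩⟩
  unfold retract
  have := huv.ne
  split_ifs with h1 h2 h2
  · exact absurd (h1.trans h2.symm) this
  · rintro rfl
    rw [h1] at huv
    exact hac huv.symm
  · rintro rfl
    rw [h2] at huv
    exact hac huv
  · exact this

theorem darts_mergeGraph_lt (hac : a ≠ c) (hab : G.Adj a b) (hbc : G.Adj b c) :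
    darts (mergeGraph G a c) < darts G := by
  unfold darts
  set s := univ.filter fun p : V × V => G.Adj p.1 p.2 with hs
  set f : V × V → V × V := fun p => (retract a c p.1, retract a c p.2) with hf
  have h1 : univ.filter (fun p : V × V => (mergeGraph G a c).Adj p.1 p.2) ⊆ s.image f := by
    rintro ⟨u, v⟩ h
    simp only [mem_filter, mem_univ, true_and] at h
    obtain ⟨-, u', v', h', rfl, rfl⟩ := h
    exact mem_image.2 ⟨(u', v'), by simp [hs, h'], rfl⟩
  refine (card_le_card h1).trans_lt (lt_of_le_of_ne card_image_le fun he => ?_)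
  rw [card_image_iff] at he
  have := he (show (a, b) ∈ (s : Set (V × V)) by simp [hs, hab])
    (show (c, b) ∈ (s : Set (V × V)) by simp [hs, hbc.symm]) (by simp [hf, retract])
  exact hac (congrArg Prod.fst this)

/-- If identifying `a` and `c` creates a triangle, there is a path of length three between them. -/
theorem exists_path_of_triangle (ht : ∀ a b c, G.Adj a b → G.Adj b c → ¬ G.Adj a c) (hac : a ≠ c)
    (h : ¬ ∀ u v w, (mergeGraph G a c).Adj u v → (mergeGraph G a c).Adj v w →
      ¬ (mergeGraph G a c).Adj u w) :
    ∃ x y, G.Adj a x ∧ G.Adj x y ∧ G.Adj y c := by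
  push Not at h
  obtain ⟨u, v, w, huv, hvw, huw⟩ := h
  have key : ∀ v w, (mergeGraph G a c).Adj a v → (mergeGraph G a c).Adj v w →
      (mergeGraph G a c).Adj a w → ∃ x y, G.Adj a x ∧ G.Adj x y ∧ G.Adj y c := by
    intro v w hv hvw hw
    have h1 := mergeGraph_adj_of_ne hv.ne' hw.ne' hvw
    rcases mergeGraph_adj_left hv.ne' hv with h2 | h2 <;>
      rcases mergeGraph_adj_left hw.ne' hw with h3 | h3
    · exact absurd h3 (ht a v w h2 h1)
    · exact ⟨v, w, h2, h1, h3.symm⟩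
    · exact ⟨w, v, h3, h1.symm, h2.symm⟩
    · exact absurd h3 (ht c v w h2 h1)
  by_cases hu : u = a
  · subst hu
    exact key v w huv hvw huw
  by_cases hv : v = a
  · subst hv
    exact key u w huv.symm huw hvw
  by_cases hw : w = a
  · subst hw
    exact key u v huw.symm huv hvw.symm
  exact absurd (mergeGraph_adj_of_ne hu hw huw)
    (ht u v w (mergeGraph_adj_of_ne hu hv huv) (mergeGraph_adj_of_ne hv hw hvw))

/-- The image of a chain under the identification of `c` with `a`. -/
def push (a c : V) : Chain V →ₗ[ZMod 2] Chain V where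
  toFun f u v := if u = c ∨ v = c then 0 else
    f u v + (if u = a then f c v else 0) + (if v = a then f u c else 0) +
      if u = a ∧ v = a then f c c else 0
  map_add' f g := by
    funext u v
    simp only [Pi.add_apply]
    split_ifs <;> ring
  map_smul' r f := by
    funext u v
    simp only [Pi.smul_apply, smul_eq_mul, RingHom.id_apply]
    split_ifs <;> ring

theorem push_apply (f : Chain V) (u v : V) : push a c f u v = if u = c ∨ v = c then 0 else
    f u v + (if u = a then f c v else 0) + (if v = a then f u c else 0) +
      if u = a ∧ v = a then f c c else 0 := rfl

theorem push_left (f : Chain V) (v : V) : push a c f c v = 0 := by simp [push_apply]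

theorem push_right (f : Chain V) (u : V) : push a c f u c = 0 := by simp [push_apply]

theorem push_of_ne (f : Chain V) {u v : V} (h1 : u ≠ a) (h2 : u ≠ c) (h3 : v ≠ a) (h4 : v ≠ c) :
    push a c f u v = f u v := by simp [push_apply, h1, h2, h3, h4]

theorem push_merged (f : Chain V) {v : V} (hac : a ≠ c) (h3 : v ≠ a) (h4 : v ≠ c) :
    push a c f a v = f a v + f c v := by simp [push_apply, hac, h3, h4]

theorem push_symm {f : Chain V} (hf : ∀ u v, f u v = f v u) (u v : V) :
    push a c f u v = push a c f v u := by
  simp only [push_apply, hf u v, hf c v, hf u c, or_comm (a := u = c), and_comm (a := u = a)]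
  split_ifs <;> ring

theorem push_merged_self {f : Chain V} (hf : f ∈ chains G) :
    push a c f a a = 0 := by
  have h1 : ∀ v, f v v = 0 := fun v => hf.2 v v (G.loopless.irrefl v)
  simp [push_apply, h1, hf.1 c a, zmod_two_add_self]

theorem bd_push (f : Chain V) (hac : a ≠ c) {u : V} (hu : u ≠ c) :
    bd (push a c f) u = bd f u + if u = a then bd f c else 0 := by
  have h1 : ∀ v, push a c f u v = (f u v + if u = a then f c v else 0) +
      ((if v = c then (f u c + if u = a then f c c else 0) else 0) +
        if v = a then (f u c + if u = a then f c c else 0) else 0) := by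
    intro v
    rw [push_apply]
    by_cases hv : v = c
    · subst hv
      simp [hac.symm, zmod_two_add_self]
    · by_cases hva : v = a <;> by_cases hua : u = a <;> simp [hv, hva, hua, hu, hac]
      ring
  rw [bd_apply, sum_congr rfl fun v _ => h1 v, sum_add_distrib, sum_add_distrib, sum_add_distrib,
    sum_ite_eq' univ c, sum_ite_eq' univ a]
  simp only [mem_univ, if_true]
  rw [zmod_two_add_self, add_zero]
  split_ifs <;> simp [bd_apply]

theorem push_path_eq_zero (hab : a ≠ b) (hac : a ≠ c) (hbc : b ≠ c) :
    push a c (edge a b + edge b c) = 0 := by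
  funext u v
  rw [push_apply]
  simp only [edge, Pi.add_apply, Pi.zero_apply]
  by_cases h1 : u = c <;> by_cases h2 : v = c <;> by_cases h3 : u = a <;> by_cases h4 : v = a <;>
    by_cases h5 : u = b <;> by_cases h6 : v = b <;>
    simp_all [zmod_two_add_self, eq_comm]

theorem push_fourCycle_eq_zero (hab : a ≠ b) (hac : a ≠ c) (hbc : b ≠ c) (hda : d ≠ a)
    (hdc : d ≠ c) : push a c (fourCycle a b c d) = 0 := by
  have : fourCycle a b c d = (edge a b + edge b c) + (edge a d + edge d c) := by
    rw [fourCycle, edge_comm c d, edge_comm d a]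
    abel
  rw [this, map_add, push_path_eq_zero hab hac hbc, push_path_eq_zero hda.symm hac hdc, add_zero]

theorem push_mem {f : Chain V} (hf : f ∈ cycles G) (hac : a ≠ c) :
    push a c f ∈ cycles (mergeGraph G a c) := by
  have hadj : ∀ {u v}, f u v ≠ 0 → G.Adj u v := fun {u v} h => by
    by_contra hh
    exact h (hf.1.2 u v hh)
  have hsym := push_symm (a := a) (c := c) hf.1.1
  refine ⟨⟨hsym, ?_⟩, ?_⟩
  · have key : ∀ v, v ≠ a → ¬ (mergeGraph G a c).Adj a v → push a c f a v = 0 := by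
      intro v hva h
      by_cases hvc : v = c
      · rw [hvc, push_right]
      rw [push_merged f hac hva hvc]
      have h1 : f a v = 0 := by
        by_contra hne
        exact h ⟨hva.symm, a, v, hadj hne, by simp [retract], by simp [retract, hvc]⟩
      have h2 : f c v = 0 := by
        by_contra hne
        exact h ⟨hva.symm, c, v, hadj hne, by simp [retract], by simp [retract, hvc]⟩
      rw [h1, h2, add_zero]
    intro u v h
    by_cases hu : u = a
    · subst hu
      by_cases hv : v = u
      · rw [hv, push_merged_self hf.1]
      · exact key v hv h
    by_cases hv : v = a
    · subst hv
      rw [hsym]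
      exact key u hu fun hh => h hh.symm
    by_cases huc : u = c
    · rw [huc, push_left]
    by_cases hvc : v = c
    · rw [hvc, push_right]
    rw [push_of_ne f hu huc hv hvc]
    by_contra hne
    exact h ⟨(hadj hne).ne, u, v, hadj hne, by simp [retract, huc], by simp [retract, hvc]⟩
  · change bd _ = 0
    have h0 : bd f = 0 := hf.2
    funext u
    by_cases hu : u = c
    · subst hu
      simp [bd_apply, push_left]
    · rw [bd_push f hac hu, h0]
      simp

theorem exists_push_eq (hac : a ≠ c) (hnac : ¬ G.Adj a c) (hab : G.Adj a b) (hbc : G.Adj b c)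
    {Q : Chain V} (hQ : Q ∈ cycles (mergeGraph G a c)) : ∃ f ∈ cycles G, push a c f = Q := by
  have hQs : ∀ u v, Q u v = Q v u := hQ.1.1
  have hQ0 : ∀ u v, ¬ (mergeGraph G a c).Adj u v → Q u v = 0 := hQ.1.2
  have hQc : ∀ u, Q u c = 0 := fun u => hQ0 u c (not_mergeGraph_adj_right hac u)
  have hQc' : ∀ u, Q c u = 0 := fun u => by rw [hQs, hQc]
  have hQd : ∀ u, Q u u = 0 := fun u => hQ0 u u ((mergeGraph G a c).loopless.irrefl u)
  set f : Chain V := fun u v => if ¬ G.Adj u v then 0 else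
    if u = c then (if G.Adj a v then 0 else Q a v) else
    if v = c then (if G.Adj a u then 0 else Q a u) else Q u v with hf
  have hfch : f ∈ chains G := by
    refine ⟨fun u v => ?_, fun u v h => by simp [hf, h]⟩
    simp only [hf]
    by_cases huv : G.Adj u v
    · by_cases hu : u = c
      · have hv : v ≠ c := by
          rintro rfl
          exact huv.ne hu
        rw [hu] at huv ⊢
        simp [huv, huv.symm, hv]
      · by_cases hv : v = c
        · rw [hv] at huv ⊢
          simp [huv, huv.symm, hu]
        · simp [huv, huv.symm, hu, hv, hQs u v]
    · simp only [G.adj_comm v u, huv, not_false_eq_true, if_true]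
  have hpush_a : ∀ v, v ≠ a → v ≠ c → push a c f a v = Q a v := by
    intro v hva hvc
    rw [push_merged f hac hva hvc]
    by_cases h1 : G.Adj a v
    · simp [hf, h1, hac, hvc]
    · by_cases h2 : G.Adj c v
      · simp [hf, h1, h2]
      · simp only [hf, h1, h2, not_false_eq_true, if_true, add_zero]
        refine (hQ0 a v fun h => ?_).symm
        exact (mergeGraph_adj_left hva h).elim h1 h2
  have hpush : push a c f = Q := by
    funext u v
    by_cases huc : u = c
    · rw [huc, push_left, hQc']
    by_cases hvc : v = c
    · rw [hvc, push_right, hQc]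
    by_cases hu : u = a
    · subst hu
      by_cases hv : v = u
      · rw [hv, push_merged_self hfch, hQd]
      · exact hpush_a v hv hvc
    by_cases hv : v = a
    · subst hv
      rw [push_symm hfch.1, hQs]
      exact hpush_a u hu huc
    rw [push_of_ne f hu huc hv hvc]
    by_cases h : G.Adj u v
    · simp [hf, h, huc, hvc]
    · simp only [hf, h, not_false_eq_true, if_true]
      exact (hQ0 u v fun hh => h (mergeGraph_adj_of_ne hu hv hh)).symm
  have hQbd : bd Q = 0 := hQ.2
  have hbd1 : ∀ u, u ≠ a → u ≠ c → bd f u = 0 := by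
    intro u hu huc
    have := bd_push f hac huc
    rw [hpush, hQbd, if_neg hu, add_zero] at this
    exact this.symm
  have hbd2 : bd f a = bd f c := by
    have := bd_push f hac hac
    rw [hpush, hQbd, if_pos rfl] at this
    exact CharTwo.add_eq_zero.1 this.symm
  by_cases hz : bd f a = 0
  · refine ⟨f, ⟨hfch, ?_⟩, hpush⟩
    change bd f = 0
    funext u
    by_cases hu : u = a
    · rw [hu, hz]; rfl
    by_cases huc : u = c
    · rw [huc, ← hbd2, hz]; rfl
    exact hbd1 u hu huc
  · refine ⟨f + (edge a b + edge b c), ⟨add_mem hfch (add_mem (edge_mem_chains hab)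
      (edge_mem_chains hbc)), ?_⟩, by rw [map_add, hpush, push_path_eq_zero hab.ne hac hbc.ne,
        add_zero]⟩
    change bd _ = 0
    rw [map_add, map_add, bd_edge, bd_edge]
    have h1 := zmod_two_eq_one hz
    have h2 := h1
    rw [hbd2] at h2
    funext u
    simp only [Pi.add_apply, Pi.zero_apply, pt]
    by_cases hu : u = a
    · subst hu
      simp [h1, hac, hab.ne, zmod_two_add_self]
    by_cases huc : u = c
    · subst huc
      simp [h2, hac.symm, hbc.ne', zmod_two_add_self]
    simp [hbd1 u hu huc, hu, huc, zmod_two_add_self]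

theorem fourCycle_mem (hab : G.Adj a b) (hbc : G.Adj b c) (hcd : G.Adj c d) (hda : G.Adj d a) :
    fourCycle a b c d ∈ cycles G := by
  refine ⟨add_mem (add_mem (add_mem (edge_mem_chains hab) (edge_mem_chains hbc))
    (edge_mem_chains hcd)) (edge_mem_chains hda), ?_⟩
  change bd _ = 0
  simp only [fourCycle, map_add, bd_edge]
  funext u
  simp only [Pi.add_apply, Pi.zero_apply]
  grind

theorem macLane_mergeGraph_of_common (hf : MacLaneFace G (fourCycle a b c d)) (hab : G.Adj a b)
    (hbc : G.Adj b c) (hcd : G.Adj c d) (hda : G.Adj d a) (hac : a ≠ c) (hbd : b ≠ d)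
    (hnac : ¬ G.Adj a c) (hcom : ∀ v, G.Adj a v → G.Adj c v → v = b ∨ v = d) :
    MacLane (mergeGraph G a c) := by
  obtain ⟨ι, _, F, hF, i₀, hi₀⟩ := hf
  have hp0 : push a c (F i₀) = 0 := by
    rw [hi₀, push_fourCycle_eq_zero hab.ne hac hbc.ne hda.ne hcd.ne']
  have key : ∀ v, v ≠ a → #{i | push a c (F i) a v ≠ 0} ≤ 2 := by
    intro v hva
    by_cases hvc : v = c
    · subst hvc
      simp [push_right]
    simp only [push_merged _ hac hva hvc]
    by_cases h1 : G.Adj a v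
    · by_cases h2 : G.Adj c v
      · have e1 : F i₀ a v ≠ 0 ∧ F i₀ c v ≠ 0 := by
          rw [hi₀]
          have := hab.ne
          have := hbc.ne
          have := hcd.ne
          have := hda.ne
          rcases hcom v h1 h2 with rfl | rfl <;> simp [fourCycle, edge] <;> grind
        obtain ⟨j, hj, hj'⟩ := hF.exists_ne e1.1
        obtain ⟨k, hk, hk'⟩ := hF.exists_ne e1.2
        refine (card_le_card (t := {j, k}) ?_).trans card_le_two
        intro i hi
        simp only [mem_filter, mem_univ, true_and, mem_insert, mem_singleton] at hi ⊢
        have hii : i ≠ i₀ := by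
          rintro rfl
          have := congrFun (congrFun hp0 a) v
          rw [push_merged _ hac hva hvc] at this
          exact hi this
        by_contra! hcon
        apply hi
        have z1 : F i a v = 0 := by
          by_contra hne
          exact (hF.eq_or_eq hj.symm e1.1 hj' hne).elim hii hcon.1
        have z2 : F i c v = 0 := by
          by_contra hne
          exact (hF.eq_or_eq hk.symm e1.2 hk' hne).elim hii hcon.2
        rw [z1, z2, add_zero]
      · have : ∀ i, F i c v = 0 := fun i => (hF.mem i).1.2 c v h2
        simpa [this] using hF.card_le a v
    · have : ∀ i, F i a v = 0 := fun i => (hF.mem i).1.2 a v h1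
      simpa [this] using hF.card_le c v
  refine macLane_of_span (F := fun i => push a c (F i)) (fun i => push_mem (hF.mem i) hac) ?_ ?_
  · intro u v
    by_cases huc : u = c
    · subst huc
      simp [push_left]
    by_cases hvc : v = c
    · subst hvc
      simp [push_right]
    by_cases hu : u = a
    · subst hu
      by_cases hv : v = u
      · subst hv
        simp [push_merged_self (hF.mem _).1]
      · exact key v hv
    by_cases hv : v = a
    · subst hv
      simp only [push_symm (hF.mem _).1.1 u v]
      exact key u hu
    simp only [push_of_ne _ hu huc hv hvc]
    exact hF.card_le u v
  · intro Q hQ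
    obtain ⟨f, hfG, rfl⟩ := exists_push_eq hac hnac hab hbc hQ
    obtain ⟨t, rfl⟩ := hF.span f hfG
    exact ⟨t, by simp [comb_eq_sum, map_sum]⟩

theorem macLane_mergeGraph (hf : MacLaneFace G (fourCycle a b c d)) (hab : G.Adj a b)
    (hbc : G.Adj b c) (hcd : G.Adj c d) (hda : G.Adj d a) (hac : a ≠ c) (hbd : b ≠ d)
    (hnac : ¬ G.Adj a c) : MacLane (mergeGraph G a c) := by
  -- remove the edges from `c` to further common neighbours, which become parallel edges
  let P : V → Prop := fun v => G.Adj a v ∧ v ≠ b ∧ v ≠ d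
  let G' : SimpleGraph V :=
    { Adj := fun u v => G.Adj u v ∧ ¬ (u = c ∧ P v) ∧ ¬ (v = c ∧ P u)
      symm := ⟨fun _ _ ⟨h1, h2, h3⟩ => ⟨h1.symm, h3, h2⟩⟩
      loopless := ⟨fun _ h => h.1.ne rfl⟩ }
  have hle : G' ≤ G := fun _ _ h => h.1
  have hab' : G'.Adj a b := ⟨hab, fun h => hac h.1, fun h => hbc.ne h.1⟩
  have hbc' : G'.Adj b c := ⟨hbc, fun h => hbc.ne h.1, fun h => h.2.2.1 rfl⟩
  have hcd' : G'.Adj c d := ⟨hcd, fun h => h.2.2.2 rfl, fun h => hcd.ne' h.1⟩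
  have hda' : G'.Adj d a := ⟨hda, fun h => hcd.ne' h.1, fun h => hac h.1⟩
  have hM := macLane_mergeGraph_of_common (hf.mono hle (fourCycle_mem hab' hbc' hcd' hda'))
    hab' hbc' hcd' hda' hac hbd (fun h => hnac h.1) (by
      intro v h1 h2
      by_contra! hcon
      exact h2.2.1 ⟨rfl, h1.1, hcon⟩)
  refine hM.mono ?_
  rintro u v ⟨hne, u', v', h, rfl, rfl⟩
  refine ⟨hne, ?_⟩
  by_cases h1 : u' = c ∧ P v'
  · obtain ⟨rfl, h1⟩ := h1
    refine ⟨a, v', ⟨h1.1, fun hh => hac hh.1, fun hh => h.ne hh.1.symm⟩, ?_, rfl⟩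
    simp [retract]
  by_cases h2 : v' = c ∧ P u'
  · obtain ⟨rfl, h2⟩ := h2
    refine ⟨u', a, ⟨h2.1.symm, fun hh => h.ne hh.1, fun hh => hac hh.1⟩, rfl, ?_⟩
    simp [retract]
  exact ⟨u', v', ⟨h, h1, h2⟩, rfl, rfl⟩

end Identification

noncomputable section Grotzsch

variable {V : Type u} [Fintype V] {G : SimpleGraph V} {a b c d x y z w : V}

theorem fourCycle_rotate : fourCycle b c d a = fourCycle a b c d := by
  unfold fourCycle
  abel

/-- The chain of a closed walk of length five. -/
def fiveCycle (a b c y x : V) : Chain V := edge a b + edge b c + edge c y + edge y x + edge x a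

theorem fiveCycle_mem (hab : G.Adj a b) (hbc : G.Adj b c) (hcy : G.Adj c y) (hyx : G.Adj y x)
    (hxa : G.Adj x a) : fiveCycle a b c y x ∈ cycles G := by
  refine ⟨add_mem (add_mem (add_mem (add_mem (edge_mem_chains hab) (edge_mem_chains hbc))
    (edge_mem_chains hcy)) (edge_mem_chains hyx)) (edge_mem_chains hxa), ?_⟩
  change bd _ = 0
  simp only [fiveCycle, map_add, bd_edge]
  funext u
  simp only [Pi.add_apply, Pi.zero_apply]
  grind

/-- Paths of length three joining the two pairs of opposite vertices of a quadrilateral face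
cannot both exist in a triangle-free plane graph. -/
theorem not_macLaneFace_of_crossing (ht : ∀ a b c, G.Adj a b → G.Adj b c → ¬ G.Adj a c)
    (hf : MacLaneFace G (fourCycle a b c d)) (hab : G.Adj a b) (hbc : G.Adj b c)
    (hcd : G.Adj c d) (hda : G.Adj d a) (hac : a ≠ c) (hbd : b ≠ d)
    (hax : G.Adj a x) (hxy : G.Adj x y) (hyc : G.Adj y c)
    (hbz : G.Adj b z) (hzw : G.Adj z w) (hwd : G.Adj w d) : False := by
  obtain ⟨ι, _, F, hF, i₀, hi₀⟩ := hf
  have n1 := hab.ne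
  have n2 := hbc.ne
  have n3 := hcd.ne
  have n4 := hda.ne
  have n5 := hax.ne
  have n6 := hxy.ne
  have n7 := hyc.ne
  have n8 := hbz.ne
  have n9 := hzw.ne
  have n10 := hwd.ne
  have m1 : x ≠ b := by rintro rfl; exact ht _ _ _ hxy hyc hbc
  have m2 : x ≠ d := by rintro rfl; exact ht _ _ _ hxy hyc hcd.symm
  have m3 : y ≠ b := by rintro rfl; exact ht _ _ _ hax hxy hab
  have m4 : y ≠ d := by rintro rfl; exact ht _ _ _ hax hxy hda.symm
  have m5 : z ≠ a := by rintro rfl; exact ht _ _ _ hzw hwd hda.symm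
  have m6 : z ≠ c := by rintro rfl; exact ht _ _ _ hzw hwd hcd
  have m7 : w ≠ a := by rintro rfl; exact ht _ _ _ hbz hzw hab.symm
  have m8 : w ≠ c := by rintro rfl; exact ht _ _ _ hbz hzw hbc
  have m9 : z ≠ x := by rintro rfl; exact ht _ _ _ hab hbz hax
  have m10 : z ≠ y := by rintro rfl; exact ht _ _ _ hbz hyc hbc
  have m11 : w ≠ x := by rintro rfl; exact ht _ _ _ hwd hda hax.symm
  have m12 : w ≠ y := by rintro rfl; exact ht _ _ _ hyc hcd hwd
  have m13 : y ≠ a := by rintro rfl; exact ht _ _ _ hab hbc hyc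
  have m14 : x ≠ c := by rintro rfl; exact ht _ _ _ hab hbc hax
  have m15 : w ≠ b := by rintro rfl; exact ht _ _ _ hbc hcd hwd
  have m16 : z ≠ d := by rintro rfl; exact ht _ _ _ hbc hcd hbz
  obtain ⟨t, ht0, hQ₁⟩ := hF.span_avoid i₀ (fiveCycle_mem hab hbc hyc.symm hxy.symm hax.symm)
  obtain ⟨r, hr0, hQ₂⟩ := hF.span_avoid i₀ (fiveCycle_mem hbc hcd hwd.symm hzw.symm hbz.symm)
  have hD := comb_mem hF.mem (t * r)
  have off₁ : ∀ {p} q, p ≠ a → p ≠ b → p ≠ c → p ≠ x → p ≠ y → comb F t p q = 0 := by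
    intro p q h1 h2 h3 h4 h5
    simp [hQ₁, fiveCycle, edge_apply_of_ne, h1, h2, h3, h4, h5]
  have hF1 : F i₀ b c ≠ 0 := by
    simp [hi₀, fourCycle, edge]
    grind
  have hF2 : F i₀ b a ≠ 0 := by
    simp [hi₀, fourCycle, edge]
    grind
  have hF3 : F i₀ d c ≠ 0 := by
    simp [hi₀, fourCycle, edge]
    grind
  have hbc1 : comb F (t * r) b c ≠ 0 := by
    obtain ⟨j, hj, hj'⟩ := hF.exists_ne hF1
    have h1 := hF.comb_apply hj.symm hF1 hj' t
    have h2 := hF.comb_apply hj.symm hF1 hj' r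
    have h3 : comb F t b c = 1 := by
      rw [hQ₁]
      simp [fiveCycle, edge]
      grind
    have h4 : comb F r b c = 1 := by
      rw [hQ₂]
      simp [fiveCycle, edge]
      grind
    rw [h3, ht0, zero_add] at h1
    rw [h4, hr0, zero_add] at h2
    rw [hF.comb_apply hj.symm hF1 hj']
    simp [ht0, ← h1, ← h2]
  have hba : comb F (t * r) b a = 0 := by
    have h : comb F r b a = 0 := by
      rw [hQ₂]
      simp [fiveCycle, edge]
      grind
    rw [mul_comm, hF.comb_mul_of_eq h hF2, hr0, zero_mul]
  have hbz1 : comb F (t * r) b z ≠ 0 := by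
    obtain ⟨v, hv, hv'⟩ := exists_other_of_cycles hD hbc1
    rwa [show z = v from ?_]
    by_contra hne
    refine hv' ?_
    by_cases hva : v = a
    · rw [hva, hba]
    refine hF.comb_mul_eq_zero ?_ ?_
    · rw [hQ₁]
      simp [fiveCycle, edge]
      grind
    · rw [hQ₂]
      simp [fiveCycle, edge]
      grind
  have hzw1 : comb F (t * r) z w ≠ 0 := by
    obtain ⟨v, hv, hv'⟩ := exists_other_of_cycles hD (by rwa [hD.1.1 z b])
    rwa [show w = v from ?_]
    by_contra hne
    refine hv' (hF.comb_mul_eq_zero (off₁ v m5 n8.symm m6 m9 m10) ?_)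
    rw [hQ₂]
    simp [fiveCycle, edge]
    grind
  have hwd1 : comb F (t * r) w d ≠ 0 := by
    obtain ⟨v, hv, hv'⟩ := exists_other_of_cycles hD (by rwa [hD.1.1 w z])
    rwa [show d = v from ?_]
    by_contra hne
    refine hv' (hF.comb_mul_eq_zero (off₁ v m7 m15 m8 m11 m12) ?_)
    rw [hQ₂]
    simp [fiveCycle, edge]
    grind
  obtain ⟨v, hv, hv'⟩ := exists_other_of_cycles hD (by rwa [hD.1.1 d w])
  refine hv' ?_
  have hd : ∀ v, comb F t d v = 0 := fun v => off₁ v n4 hbd.symm n3.symm m2.symm m4.symm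
  by_cases hvc : v = c
  · rw [hvc, hF.comb_mul_of_eq (hd c) hF3, ht0, zero_mul]
  refine hF.comb_mul_eq_zero (hd v) ?_
  rw [hQ₂]
  simp [fiveCycle, edge]
  grind

theorem colorableOn_univ_of_macLane (hM : MacLane G)
    (ht : ∀ a b c, G.Adj a b → G.Adj b c → ¬ G.Adj a c) : ColorableOn G univ := by
  induction hn : darts G using Nat.strong_induction_on generalizing G with
  | _ n ih =>
  by_contra hG
  obtain ⟨W, -, hW, hpot⟩ := exists_sparse_of_not_colorableOn hG
  have hWG : ∀ u v, G.Adj u v → u ∈ W := by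
    by_contra! hcon
    obtain ⟨p, q, hpq, hp⟩ := hcon
    let H : SimpleGraph V :=
      { Adj := fun u v => G.Adj u v ∧ u ∈ W ∧ v ∈ W
        symm := ⟨fun _ _ h => ⟨h.1.symm, h.2.2, h.2.1⟩⟩
        loopless := ⟨fun _ h => h.1.ne rfl⟩ }
    have hle : H ≤ G := fun _ _ h => h.1
    obtain ⟨φ, hφ⟩ := ih _ (hn ▸ darts_lt hle hpq fun h => hp h.2.1) (hM.mono hle)
      (fun a b c h1 h2 h3 => ht a b c h1.1 h2.1 h3.1) rfl
    exact hW ⟨φ, fun u hu v hv h => hφ u (mem_univ _) v (mem_univ _) ⟨h, hu, hv⟩⟩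
  have hcard : 10 * #W ≤ 3 * darts G + 4 := by
    have h : pairs G W W ≤ darts G := by
      unfold pairs degIn darts
      rw [← Nat.cast_sum, ← card_sigma]
      refine Nat.cast_le.2 (card_le_card_of_injOn (fun p => (p.1, p.2)) ?_ ?_)
      · rintro ⟨p, q⟩ h
        simp only [coe_sigma, Set.mem_sigma_iff, mem_coe, mem_filter] at h
        simp [h.2.2]
      · rintro ⟨p, q⟩ - ⟨p', q'⟩ - h
        simpa using h
    unfold pot at hpot
    omega
  have hne : W.Nonempty := card_pos.1 (by have := four_le_card_of_not_colorableOn hW; omega)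
  obtain ⟨ι, _, F, hF⟩ := id hM
  obtain ⟨i, a, b, c, d, hab, hbc, hcd, hda, hac, hbd, hFi⟩ := hF.exists_fourCycle ht hne hWG hcard
  have key : ∀ {a b c d}, MacLaneFace G (fourCycle a b c d) → G.Adj a b → G.Adj b c →
      G.Adj c d → G.Adj d a → a ≠ c → b ≠ d → ∃ x y, G.Adj a x ∧ G.Adj x y ∧ G.Adj y c := by
    intro a b c d hf hab hbc hcd hda hac hbd
    refine exists_path_of_triangle ht hac fun h => hG ?_
    exact colorableOn_of_mergeGraph (ht a b c hab hbc)
      (ih _ (hn ▸ darts_mergeGraph_lt hac hab hbc)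
        (macLane_mergeGraph hf hab hbc hcd hda hac hbd (ht a b c hab hbc)) h rfl)
  have hf : MacLaneFace G (fourCycle a b c d) := ⟨ι, _, F, hF, i, hFi⟩
  obtain ⟨x, y, hax, hxy, hyc⟩ := key hf hab hbc hcd hda hac hbd
  obtain ⟨z, w, hbz, hzw, hwd⟩ := key (by rwa [fourCycle_rotate]) hbc hcd hda hab hbd hac.symm
  exact not_macLaneFace_of_crossing ht hf hab hbc hcd hda hac hbd hax hxy hyc hbz hzw hwd

end Grotzsch

end TwoBasis

theorem grotzsch {V : Type*} [Fintype V] (G : SimpleGraph V)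
    (hplanar : G.IsPlanar)
    (htri : ∀ t : Finset V, ¬ G.IsNClique 3 t) :
    G.Colorable 3 := by
  classical
  obtain ⟨φ, hφ⟩ := TwoBasis.colorableOn_univ_of_macLane (TwoBasis.macLane_of_isPlanar hplanar)
    fun a b c hab hbc hac => htri {a, b, c} (SimpleGraph.is3Clique_triple_iff.2 ⟨hab, hac, hbc⟩)
  exact ⟨SimpleGraph.Coloring.mk φ fun {u v} h => hφ u (Finset.mem_univ u) v (Finset.mem_univ v) h⟩
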